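/- arXiv:math-ph/0406001 — 4 statements merged into one kernel-verified Lean document; each statement's English description precedes it below -/
import Mathlib

section
/- Let β₁<β₂<β₋ be reals and let K(β,ξ₁;β',ξ₂) be the kernel defined by K(β,ξ₁;β',ξ₂) = (2π(β₋−β))^{−1/2} e^{−ξ₁²/(2(β₋−β))} if β ≥ β', and = (2π(β₋−β))^{−1/2} e^{−ξ₁²/(2(β₋−β))} − (2π(β'−β))^{−1/2} e^{−(ξ₂−ξ₁)²/(2(β'−β))} if β < β'. Then for all s₁,s₂∈ℝ: 1 − ∫_{s₁}^∞ K(β₁,ξ;β₁,ξ)dξ − ∫_{s₂}^∞ K(β₂,ξ;β₂,ξ)dξ + ∫_{s₁}^∞∫_{s₂}^∞ [K(β₁,ξ₁;β₁,ξ₁)K(β₂,ξ₂;β₂,ξ₂) − K(β₁,ξ₁;β₂,ξ₂)K(β₂,ξ₂;β₁,ξ₁)] dξ₂ dξ₁ = ∫_{−∞}^{s₁}∫_{−∞}^{s₂} (2π(β₂−β₁))^{−1/2} e^{−(ξ₂−ξ₁)²/(2(β₂−β₁))} · (2π(β₋−β₂))^{−1/2} e^{−ξ₂²/(2(β₋−β₂))}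 dξ₂ dξ₁. Moreover, for each fixed β the 2×2 determinant det(K(β,ξ_i;β,ξ_j))_{i,j=1,2} vanishes identically, so all higher terms of the corresponding Fredholm expansion vanish. -/
noncomputable section
open MeasureTheory Real Set

/-- The Brownian-type kernel `𝒦_{G-}` (with parameter `β₋`). -/
def gaussKer (βm β ξ₁ β' ξ₂ : ℝ) : ℝ :=
  if β' ≤ β then
    Real.exp (-ξ₁ ^ 2 / (2 * (βm - β))) / Real.sqrt (2 * Real.pi * (βm - β))
  else
    Real.exp (-ξ₁ ^ 2 / (2 * (βm - β))) / Real.sqrt (2 * Real.pi * (βm - β))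
      - Real.exp (-(ξ₂ - ξ₁) ^ 2 / (2 * (β' - β))) / Real.sqrt (2 * Real.pi * (β' - β))

/-- The centered Gaussian density of variance `v`. -/
def centeredGaussian (v x : ℝ) : ℝ :=
  Real.exp (-x ^ 2 / (2 * v)) / Real.sqrt (2 * Real.pi * v)

lemma centeredGaussian_sub_comm (v x y : ℝ) :
    centeredGaussian v (x - y) = centeredGaussian v (y - x) := by
  unfold centeredGaussian
  rw [sub_sq_comm]

lemma integrable_centeredGaussian {v : ℝ} (hv : 0 < v) : Integrable (centeredGaussian v) := by
  have h := (integrable_exp_neg_mul_sq (b := 1 / (2 * v)) (by positivity)).div_const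
    (Real.sqrt (2 * Real.pi * v))
  refine h.congr (Filter.Eventually.of_forall fun x ↦ ?_)
  simp only [centeredGaussian]
  congr 2
  ring

lemma integral_centeredGaussian {v : ℝ} (hv : 0 < v) : ∫ x, centeredGaussian v x = 1 := by
  have h (x : ℝ) : centeredGaussian v x
      = Real.exp (-(1 / (2 * v)) * x ^ 2) / Real.sqrt (2 * Real.pi * v) := by
    unfold centeredGaussian
    congr 2
    ring
  simp_rw [h]
  rw [integral_div, integral_gaussian, show Real.pi / (1 / (2 * v)) = 2 * Real.pi * v by
    field_simp]
  exact div_self (by positivity)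

lemma centeredGaussian_mul {a b : ℝ} (ha : 0 < a) (hb : 0 < b) (x y : ℝ) :
    centeredGaussian a (y - x) * centeredGaussian b y
      = centeredGaussian (a + b) x * centeredGaussian (a * b / (a + b)) (y - b * x / (a + b)) := by
  have hs : 0 < a + b := add_pos ha hb
  unfold centeredGaussian
  rw [div_mul_div_comm, div_mul_div_comm, ← Real.exp_add, ← Real.exp_add,
    ← Real.sqrt_mul (by positivity), ← Real.sqrt_mul (by positivity)]
  congr 2
  · field_simp
    ring
  · field_simp

lemma integral_centeredGaussian_mul {a b : ℝ} (ha : 0 < a) (hb : 0 < b) (x : ℝ) :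
    ∫ y, centeredGaussian a (y - x) * centeredGaussian b y = centeredGaussian (a + b) x := by
  simp_rw [centeredGaussian_mul ha hb]
  rw [integral_const_mul, integral_sub_right_eq_self (centeredGaussian (a * b / (a + b))),
    integral_centeredGaussian (by positivity), mul_one]

lemma integrable_centeredGaussian_mul {a b : ℝ} (ha : 0 < a) (hb : 0 < b) (x : ℝ) :
    Integrable fun y ↦ centeredGaussian a (y - x) * centeredGaussian b y := by
  simp_rw [centeredGaussian_mul ha hb]
  exact ((integrable_centeredGaussian (by positivity)).comp_sub_right _).const_mul _

lemma integrable_prod_centeredGaussian_mul {a b : ℝ} (ha : 0 < a) (hb : 0 < b) :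
    Integrable (fun p : ℝ × ℝ ↦ centeredGaussian a (p.2 - p.1) * centeredGaussian b p.2)
      (volume.prod volume) := by
  have h := Integrable.convolution_integrand (ContinuousLinearMap.mul ℝ ℝ)
    (integrable_centeredGaussian hb) (integrable_centeredGaussian ha)
  refine h.congr (Filter.Eventually.of_forall fun p ↦ ?_)
  simp only [ContinuousLinearMap.mul_apply']
  rw [centeredGaussian_sub_comm, mul_comm]

/-- Inclusion–exclusion for the Gaussian pair with joint density
`centeredGaussian a (y - x) * centeredGaussian b y`. -/
lemma centeredGaussian_inclusion_exclusion {a b : ℝ} (ha : 0 < a) (hb : 0 < b) (s t : ℝ) :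
    1 - (∫ x in Set.Ioi s, centeredGaussian (a + b) x) - (∫ y in Set.Ioi t, centeredGaussian b y)
        + ∫ x in Set.Ioi s, ∫ y in Set.Ioi t,
            centeredGaussian a (y - x) * centeredGaussian b y
      = ∫ x in Set.Iic s, ∫ y in Set.Iic t,
          centeredGaussian a (y - x) * centeredGaussian b y := by
  have hJ : Integrable (fun p : ℝ × ℝ ↦ centeredGaussian a (p.2 - p.1) * centeredGaussian b p.2)
      (volume.prod (volume.restrict (Set.Iic t))) := by
    have h := (integrable_prod_centeredGaussian_mul ha hb).integrableOn (s := Set.univ ×ˢ Set.Iic t)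
    rwa [IntegrableOn, ← Measure.prod_restrict, Measure.restrict_univ] at h
  have hF : Integrable fun x ↦ ∫ y in Set.Iic t,
      centeredGaussian a (y - x) * centeredGaussian b y := hJ.integral_prod_left
  have hinner (x : ℝ) : ∫ y in Set.Ioi t, centeredGaussian a (y - x) * centeredGaussian b y
      = centeredGaussian (a + b) x
        - ∫ y in Set.Iic t, centeredGaussian a (y - x) * centeredGaussian b y := by
    rw [← integral_centeredGaussian_mul ha hb x, ← integral_add_compl (measurableSet_Iic (a := t))
      (integrable_centeredGaussian_mul ha hb x), Set.compl_Iic]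
    ring
  have hmarg (y : ℝ) : ∫ x, centeredGaussian a (y - x) * centeredGaussian b y
      = centeredGaussian b y := by
    rw [integral_mul_const, integral_sub_left_eq_self (centeredGaussian a),
      integral_centeredGaussian ha, one_mul]
  have htot : ∫ x, ∫ y in Set.Iic t, centeredGaussian a (y - x) * centeredGaussian b y
      = ∫ y in Set.Iic t, centeredGaussian b y := by
    rw [integral_integral_swap hJ]
    simp_rw [hmarg]
  have hsplit := integral_add_compl (measurableSet_Iic (a := s)) hF
  have hone := integral_add_compl (measurableSet_Iic (a := t)) (integrable_centeredGaussian hb)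
  rw [htot, Set.compl_Iic] at hsplit
  rw [integral_centeredGaussian hb, Set.compl_Iic] at hone
  simp_rw [hinner]
  rw [integral_sub (integrable_centeredGaussian (add_pos ha hb)).integrableOn hF.integrableOn]
  linarith

lemma gaussKer_of_le {βm β β' : ℝ} (h : β' ≤ β) (ξ₁ ξ₂ : ℝ) :
    gaussKer βm β ξ₁ β' ξ₂ = centeredGaussian (βm - β) ξ₁ :=
  if_pos h

lemma gaussKer_of_lt {βm β β' : ℝ} (h : β < β') (ξ₁ ξ₂ : ℝ) :
    gaussKer βm β ξ₁ β' ξ₂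
      = centeredGaussian (βm - β) ξ₁ - centeredGaussian (β' - β) (ξ₂ - ξ₁) :=
  if_neg h.not_ge

/-- The Fredholm expansion of the Brownian kernel `𝒦_{G-}` at two
points truncates and equals the two-point distribution of a Brownian-type process;
moreover every `2×2` determinant at a single time vanishes identically. -/
theorem gaussKer_two_point_identity (βm β₁ β₂ : ℝ) (h12 : β₁ < β₂) (h2m : β₂ < βm)
    (s₁ s₂ : ℝ) :
    (1 - (∫ ξ in Set.Ioi s₁, gaussKer βm β₁ ξ β₁ ξ)
        - (∫ ξ in Set.Ioi s₂, gaussKer βm β₂ ξ β₂ ξ)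
        + ∫ ξ₁ in Set.Ioi s₁, ∫ ξ₂ in Set.Ioi s₂,
            (gaussKer βm β₁ ξ₁ β₁ ξ₁ * gaussKer βm β₂ ξ₂ β₂ ξ₂
              - gaussKer βm β₁ ξ₁ β₂ ξ₂ * gaussKer βm β₂ ξ₂ β₁ ξ₁) =
      ∫ ξ₁ in Set.Iic s₁, ∫ ξ₂ in Set.Iic s₂,
        Real.exp (-(ξ₂ - ξ₁) ^ 2 / (2 * (β₂ - β₁))) / Real.sqrt (2 * Real.pi * (β₂ - β₁))
          * (Real.exp (-ξ₂ ^ 2 / (2 * (βm - β₂))) / Real.sqrt (2 * Real.pi * (βm - β₂))))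
    ∧ ∀ β ξ₁ ξ₂ : ℝ,
        gaussKer βm β ξ₁ β ξ₁ * gaussKer βm β ξ₂ β ξ₂
          - gaussKer βm β ξ₁ β ξ₂ * gaussKer βm β ξ₂ β ξ₁ = 0 := by
  refine ⟨?_, fun β ξ₁ ξ₂ ↦ ?_⟩
  · have hdet (ξ₁ ξ₂ : ℝ) : gaussKer βm β₁ ξ₁ β₁ ξ₁ * gaussKer βm β₂ ξ₂ β₂ ξ₂
        - gaussKer βm β₁ ξ₁ β₂ ξ₂ * gaussKer βm β₂ ξ₂ β₁ ξ₁
        = centeredGaussian (β₂ - β₁) (ξ₂ - ξ₁) * centeredGaussian (βm - β₂) ξ₂ := by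
      rw [gaussKer_of_lt h12, gaussKer_of_le le_rfl, gaussKer_of_le le_rfl, gaussKer_of_le h12.le]
      ring
    simp_rw [hdet, gaussKer_of_le le_rfl]
    have h := centeredGaussian_inclusion_exclusion (sub_pos.2 h12) (sub_pos.2 h2m) s₁ s₂
    rw [show β₂ - β₁ + (βm - β₂) = βm - β₁ by ring] at h
    exact h
  · simp_rw [gaussKer_of_le le_rfl]
    ring

end
end

section
/- (Proposition 4.1, conditional on the Tracy–Widom resolvent relations.) Fix the Airy function Ai(x)=(1/π)∫₀^∞cos(t³/3+xt)dt and let B:ℝ×(ℝ∖{0})→ℝ be smooth with ∂_y B(y,ω)=Ai(y)−ωB(y,ω) and ∂_ω B(y,ω)=Ai'(y)−ωAi(y)+(ω²−y)B(y,ω), and of at most exponential growth in y. Suppose smooth functions R(s;x,y), Q(s,y), P(s,y) (defined for x,y ≥ s) together with all their first derivatives decay in x,y faster than any exponential, uniformly for s in compacts, and satisfy, with q(s)=Q(s,s), p(s)=P(s,s), u(s)=∫_s^∞Q(s,x)Ai(x)dx, v(s)=∫_s^∞P(s,x)Ai(x)dx: (1) Q(s,x)=Ai(x)+∫_s^∞R(s;x,y)Ai(y)dy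 and P(s,x)=Ai'(x)+∫_s^∞R(s;x,y)Ai'(y)dy; (2) R(s;x,y)=(Q(s,x)P(s,y)−P(s,x)Q(s,y))/(x−y) for x≠y; (3) ∂_s Q(s,y)=−q(s)R(s;s,y); (4) (∂_s+∂_x+∂_y)R(s;x,y)=−Q(s,x)Q(s,y); (5) ∂_y Q(s,y)=P(s,y)−u(s)Q(s,y)+q(s)R(s;s,y); (6) ∂_y P(s,y)=yQ(s,y)−2v(s)Q(s,y)+u(s)P(s,y)+p(s)R(s;s,y); (7) u(s)²−2v(s)=q(s)²; (8) q'(s)=p(s)−q(s)u(s). Define a(s,ω)=1−∫_s^∞Ai(x)B(x,ω)dx−∫_s^∞∫_s^∞R(s;x,y)Ai(x)B(y,ω)dxdy and b(s,ω)=B(s,ω)+∫_s^∞R(s;s,y)B(y,ω)dy. Then: ∂_s a = q b, ∂_s b = q a − ω b, ∂_ω a = q² a − (q'+ωq) b, and ∂_ω b = (q'−ωq) a + (ω²−s−q²) b. -/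
noncomputable section
open MeasureTheory Real Filter Topology Set

/-- Improper Riemann-type integral over `(0, ∞)`: the limit of `∫_0^T f` as `T → ∞`. -/
def iInt (f : ℝ → ℝ) : ℝ := limUnder atTop fun T : ℝ => ∫ t in (0:ℝ)..T, f t

/-- The Airy function `Ai(x) = (1/π) ∫_0^∞ cos(t³/3 + x t) dt`. -/
def Airy (x : ℝ) : ℝ := (1 / Real.pi) * iInt fun t => Real.cos (t ^ 3 / 3 + x * t)

/-- `f` grows at most exponentially at `+∞`. -/
def ExpGrowth (f : ℝ → ℝ) : Prop :=
  ∃ c : ℝ, f =O[atTop] fun y => Real.exp (c * y)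

/-- `f` decays faster than every exponential at `+∞`. -/
def SuperExpDecay (f : ℝ → ℝ) : Prop :=
  ∀ c : ℝ, f =O[atTop] fun y => Real.exp (-(c * y))

theorem isBigO_exp_mul_of_le {c d : ℝ} (h : c ≤ d) :
    (fun y : ℝ => Real.exp (c * y)) =O[atTop] fun y => Real.exp (d * y) := by
  refine Asymptotics.IsBigO.of_bound 1 ?_
  filter_upwards [eventually_ge_atTop 0] with y hy
  simp only [Real.norm_eq_abs, Real.abs_exp, one_mul]
  exact Real.exp_le_exp.2 (mul_le_mul_of_nonneg_right h hy)

/-- An exponential bound near `+∞` extends to each half-line by continuity. -/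
theorem exists_exp_bound_of_isBigO {f : ℝ → ℝ} {d : ℝ}
    (hd : f =O[atTop] fun y => Real.exp (d * y)) (hc : Continuous f) (a : ℝ) :
    ∃ D : ℝ, ∀ y, a ≤ y → |f y| ≤ D * Real.exp (d * y) := by
  obtain ⟨D, hD⟩ := hd.bound
  obtain ⟨Y, hY⟩ := eventually_atTop.1 hD
  have hcont : Continuous fun y => |f y| * Real.exp (-(d * y)) := by fun_prop
  obtain ⟨M, hM⟩ := (isCompact_Icc (a := a) (b := Y)).bddAbove_image hcont.continuousOn
  refine ⟨max D M, fun y hy => ?_⟩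
  rcases le_total Y y with h | h
  · have h1 := hY y h
    simp only [Real.norm_eq_abs, Real.abs_exp] at h1
    exact h1.trans (mul_le_mul_of_nonneg_right (le_max_left _ _) (Real.exp_pos _).le)
  · have h1 : |f y| * Real.exp (-(d * y)) ≤ M := hM ⟨y, ⟨hy, h⟩, rfl⟩
    calc |f y| = |f y| * Real.exp (-(d * y)) * Real.exp (d * y) := by
          rw [mul_assoc, ← Real.exp_add]; simp
      _ ≤ max D M * Real.exp (d * y) :=
          mul_le_mul_of_nonneg_right (h1.trans (le_max_right _ _)) (Real.exp_pos _).le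

namespace ExpGrowth

variable {f g : ℝ → ℝ}

theorem const (k : ℝ) : ExpGrowth fun _ => k :=
  ⟨0, by simpa using Asymptotics.isBigO_const_const k (one_ne_zero (α := ℝ)) (atTop : Filter ℝ)⟩

theorem self : ExpGrowth fun y => y := by
  refine ⟨1, Asymptotics.IsBigO.of_bound 1 ?_⟩
  filter_upwards [eventually_ge_atTop 0] with y hy
  simp only [Real.norm_eq_abs, Real.abs_exp, one_mul, abs_of_nonneg hy]
  linarith [Real.add_one_le_exp y]

theorem exp_mul (c : ℝ) : ExpGrowth fun y => Real.exp (c * y) :=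
  ⟨c, Asymptotics.isBigO_refl _ _⟩

theorem add (hf : ExpGrowth f) (hg : ExpGrowth g) : ExpGrowth fun y => f y + g y := by
  obtain ⟨c, hc⟩ := hf
  obtain ⟨d, hd⟩ := hg
  exact ⟨max c d, (hc.trans (isBigO_exp_mul_of_le (le_max_left c d))).add
    (hd.trans (isBigO_exp_mul_of_le (le_max_right c d)))⟩

theorem mul (hf : ExpGrowth f) (hg : ExpGrowth g) : ExpGrowth fun y => f y * g y := by
  obtain ⟨c, hc⟩ := hf
  obtain ⟨d, hd⟩ := hg
  refine ⟨c + d, (hc.mul hd).congr_right fun y => ?_⟩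
  rw [← Real.exp_add]
  ring_nf

theorem sub (hf : ExpGrowth f) (hg : ExpGrowth g) : ExpGrowth fun y => f y - g y := by
  simpa [sub_eq_add_neg] using hf.add ((const (-1)).mul hg)

theorem abs (hf : ExpGrowth f) : ExpGrowth fun y => |f y| := by
  obtain ⟨c, hc⟩ := hf
  exact ⟨c, hc.abs_left⟩

theorem of_abs_le (hf : ExpGrowth f) {a : ℝ} (h : ∀ y, a ≤ y → |g y| ≤ |f y|) :
    ExpGrowth g := by
  obtain ⟨c, hc⟩ := hf
  refine ⟨c, Asymptotics.IsBigO.trans (Asymptotics.IsBigO.of_bound 1 ?_) hc⟩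
  filter_upwards [eventually_ge_atTop a] with y hy
  simpa using h y hy

end ExpGrowth

namespace SuperExpDecay

variable {f g : ℝ → ℝ}

theorem of_bound {a : ℝ} (h : ∀ c, ∃ C, ∀ y, a ≤ y → |f y| ≤ C * Real.exp (-(c * y))) :
    SuperExpDecay f := by
  intro c
  obtain ⟨C, hC⟩ := h c
  refine Asymptotics.IsBigO.of_bound C ?_
  filter_upwards [eventually_ge_atTop a] with y hy
  simpa using hC y hy

theorem expGrowth (hf : SuperExpDecay f) : ExpGrowth f :=
  ⟨0, by simpa using hf 0⟩

theorem sub (hf : SuperExpDecay f) (hg : SuperExpDecay g) :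
    SuperExpDecay fun y => f y - g y :=
  fun c => (hf c).sub (hg c)

theorem mul_expGrowth (hf : SuperExpDecay f) (hg : ExpGrowth g) :
    SuperExpDecay fun y => f y * g y := by
  obtain ⟨d, hd⟩ := hg
  intro c
  refine ((hf (c + d)).mul hd).congr_right fun y => ?_
  rw [← Real.exp_add]
  ring_nf

theorem abs (hf : SuperExpDecay f) : SuperExpDecay fun y => |f y| :=
  fun c => (hf c).abs_left

theorem tendsto (hf : SuperExpDecay f) : Tendsto f atTop (𝓝 0) := by
  refine (hf 1).trans_tendsto ?_
  simpa using Real.tendsto_exp_neg_atTop_nhds_zero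

theorem integrableOn (hf : SuperExpDecay f) {a : ℝ} (hc : ContinuousOn f (Ici a)) :
    IntegrableOn f (Ioi a) :=
  integrable_of_isBigO_exp_neg one_pos hc (by simpa using hf 1)

theorem exists_abs_le (hf : SuperExpDecay f) (hc : Continuous f) (a : ℝ) :
    ∃ K, ∀ y, a ≤ y → |f y| ≤ K := by
  have h0 : f =O[atTop] fun y => Real.exp (0 * y) := by simpa using hf 0
  simpa using exists_exp_bound_of_isBigO h0 hc a

end SuperExpDecay

theorem expGrowth_of_abs_deriv_le {f f' : ℝ → ℝ} {a K : ℝ}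
    (hf : ∀ y, a ≤ y → HasDerivAt f (f' y) y) (hK : ∀ y, a ≤ y → |f' y| ≤ K) :
    ExpGrowth f := by
  have h : ∀ y, a ≤ y → |f y| ≤ |(|f a| + K * (y - a))| := fun y hy => by
    have h1 := Convex.norm_image_sub_le_of_norm_hasDerivWithin_le (s := Ici a)
      (fun x hx => (hf x hx).hasDerivWithinAt) hK (convex_Ici a) self_mem_Ici hy
    rw [Real.norm_eq_abs, Real.norm_eq_abs, abs_of_nonneg (sub_nonneg.2 hy)] at h1
    have h2 := abs_sub_abs_le_abs_sub (f y) (f a)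
    exact (by linarith : |f y| ≤ |f a| + K * (y - a)).trans (le_abs_self _)
  exact ((ExpGrowth.const |f a|).add
    ((ExpGrowth.const K).mul (ExpGrowth.self.sub (ExpGrowth.const a)))).of_abs_le h

/-- A solution of the Airy equation has exponential growth as soon as some `g` with
`g' = f - k g` has. -/
theorem expGrowth_of_airy_ode {f f' g : ℝ → ℝ} {k : ℝ}
    (hf : ∀ y, HasDerivAt f (f' y) y) (hf' : ∀ y, HasDerivAt f' (y * f y) y)
    (hg : ∀ y, HasDerivAt g (f y - k * g y) y) (hgrowth : ExpGrowth g) : ExpGrowth f := by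
  have hsq : ∀ y, HasDerivAt (fun z => f z ^ 2) (2 * (f y * f' y)) y := fun y => by
    refine HasDerivAt.congr_deriv ((hf y).pow 2) ?_
    norm_num
    ring
  have hprod : ∀ y, HasDerivAt (fun z => f z * f' z) (f' y * f' y + f y * (y * f y)) y :=
    fun y => (hf y).mul (hf' y)
  have hmono : MonotoneOn (fun z => f z * f' z) (Ici 0) := by
    refine monotoneOn_of_hasDerivWithinAt_nonneg (convex_Ici 0)
      (fun y _ => (hprod y).continuousAt.continuousWithinAt)
      (fun y _ => (hprod y).hasDerivWithinAt) fun y hy => ?_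
    have hy0 : 0 < y := by simpa using hy
    nlinarith [mul_nonneg hy0.le (sq_nonneg (f y)), sq_nonneg (f' y)]
  by_cases h : ∃ a, 0 ≤ a ∧ 0 ≤ f a * f' a
  · obtain ⟨a, ha, hfa⟩ := h
    have hsqmono : MonotoneOn (fun z => f z ^ 2) (Ici a) := by
      refine monotoneOn_of_hasDerivWithinAt_nonneg (convex_Ici a)
        (fun y _ => (hsq y).continuousAt.continuousWithinAt)
        (fun y _ => (hsq y).hasDerivWithinAt) fun y hy => ?_
      have hay : a < y := by simpa using hy
      have : f a * f' a ≤ f y * f' y := hmono ha (ha.trans hay.le) hay.le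
      linarith
    have hG : ∀ y, HasDerivAt (fun z => Real.exp (k * z) * g z) (Real.exp (k * y) * f y) y :=
      fun y => by
        have h1 : HasDerivAt (fun z => Real.exp (k * z)) (Real.exp (k * y) * k) y := by
          simpa using ((hasDerivAt_id y).const_mul k).exp
        exact (h1.mul (hg y)).congr_deriv (by ring)
    obtain ⟨c, hc⟩ := hgrowth
    have hshift : ExpGrowth fun y => g (y + 1) := by
      refine ⟨c, (hc.comp_tendsto (tendsto_atTop_add_const_right atTop 1 tendsto_id)).trans ?_⟩
      refine Asymptotics.IsBigO.of_bound (Real.exp c) (Eventually.of_forall fun y => ?_)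
      simp only [Function.comp_apply, id_eq, Real.norm_eq_abs, Real.abs_exp]
      rw [← Real.exp_add]
      ring_nf
      exact le_rfl
    have hbd : ∀ y, a ≤ y →
        |f y| ≤ |Real.exp |k| * (Real.exp |k| * |g (y + 1)| + |g y|)| := fun y hy => by
      obtain ⟨ξ, hξ, hξe⟩ := exists_hasDerivAt_eq_slope (fun z => Real.exp (k * z) * g z)
        (fun z => Real.exp (k * z) * f z) (lt_add_one y)
        (fun z _ => (hG z).continuousAt.continuousWithinAt) (fun z _ => hG z)
      have h1 : |f y| ≤ |f ξ| := sq_le_sq.1 (hsqmono hy (hy.trans hξ.1.le) hξ.1.le)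
      have h2 : f ξ = Real.exp (k * (y - ξ)) * (Real.exp k * g (y + 1) - g y) := by
        have h3 : Real.exp (k * ξ) * f ξ
            = Real.exp (k * y) * (Real.exp k * g (y + 1) - g y) := by
          rw [hξe, mul_sub, ← mul_assoc, ← Real.exp_add]
          ring_nf
        rw [mul_sub k, Real.exp_sub, div_mul_eq_mul_div, ← h3]
        field_simp
      have h4 : k * (y - ξ) ≤ |k| := by
        have hle : |y - ξ| ≤ 1 := by rw [abs_le]; constructor <;> linarith [hξ.1, hξ.2]
        calc k * (y - ξ) ≤ |k * (y - ξ)| := le_abs_self _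
          _ = |k| * |y - ξ| := abs_mul _ _
          _ ≤ |k| := mul_le_of_le_one_right (abs_nonneg k) hle
      rw [abs_of_nonneg (by positivity : (0:ℝ) ≤
        Real.exp |k| * (Real.exp |k| * |g (y + 1)| + |g y|))]
      refine h1.trans ?_
      rw [h2, abs_mul, Real.abs_exp]
      refine mul_le_mul (Real.exp_le_exp.2 h4) ?_ (abs_nonneg _) (Real.exp_pos _).le
      refine (abs_sub _ _).trans ?_
      rw [abs_mul, Real.abs_exp]
      gcongr
      exact le_abs_self k
    exact ((ExpGrowth.const (Real.exp |k|)).mul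
      (((ExpGrowth.const (Real.exp |k|)).mul hshift.abs).add
        (ExpGrowth.abs ⟨c, hc⟩))).of_abs_le hbd
  · push Not at h
    have hanti : AntitoneOn (fun z => f z ^ 2) (Ici 0) := by
      refine antitoneOn_of_hasDerivWithinAt_nonpos (convex_Ici 0)
        (fun y _ => (hsq y).continuousAt.continuousWithinAt)
        (fun y _ => (hsq y).hasDerivWithinAt) fun y hy => ?_
      have := h y (by simpa using interior_subset hy)
      linarith
    exact (ExpGrowth.const (f 0)).of_abs_le (a := 0)
      fun y hy => sq_le_sq.1 (hanti self_mem_Ici hy hy)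

theorem HasFDerivAt.hasDerivAt_fst {E : Type*} [NormedAddCommGroup E] [NormedSpace ℝ E]
    {g : ℝ × ℝ → E} {L : ℝ × ℝ →L[ℝ] E} {x y : ℝ} (h : HasFDerivAt g L (x, y)) :
    HasDerivAt (fun x' => g (x', y)) (L (1, 0)) x :=
  h.comp_hasDerivAt (f := fun x' => (x', y)) x ((hasDerivAt_id x).prodMk (hasDerivAt_const x y))

theorem HasFDerivAt.hasDerivAt_snd {E : Type*} [NormedAddCommGroup E] [NormedSpace ℝ E]
    {g : ℝ × ℝ → E} {L : ℝ × ℝ →L[ℝ] E} {x y : ℝ} (h : HasFDerivAt g L (x, y)) :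
    HasDerivAt (fun y' => g (x, y')) (L (0, 1)) y :=
  h.comp_hasDerivAt (f := fun y' => (x, y')) y ((hasDerivAt_const y x).prodMk (hasDerivAt_id y))

section MixedPartials

variable {B : ℝ → ℝ → ℝ}

theorem contDiffAt_uncurry_of_ne_zero
    (hBsmooth : ContDiffOn ℝ (⊤ : ℕ∞) (fun pr : ℝ × ℝ => B pr.1 pr.2)
      (Set.univ ×ˢ {ω : ℝ | ω ≠ 0})) (y : ℝ) {ω : ℝ} (hω : ω ≠ 0) :
    ContDiffAt ℝ (⊤ : ℕ∞) (fun pr : ℝ × ℝ => B pr.1 pr.2) (y, ω) :=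
  hBsmooth.contDiffAt ((isOpen_univ.prod isOpen_ne).mem_nhds ⟨mem_univ _, hω⟩)

theorem contDiff_slice_of_ne_zero
    (hBsmooth : ContDiffOn ℝ (⊤ : ℕ∞) (fun pr : ℝ × ℝ => B pr.1 pr.2)
      (Set.univ ×ˢ {ω : ℝ | ω ≠ 0})) {ω : ℝ} (hω : ω ≠ 0) :
    ContDiff ℝ (⊤ : ℕ∞) fun y => B y ω :=
  contDiff_iff_contDiffAt.2 fun y =>
    (contDiffAt_uncurry_of_ne_zero hBsmooth y hω).comp y (f := fun y => (y, ω))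
      (contDiffAt_id.prodMk contDiffAt_const)

/-- The relation for `∂_y B` makes `f` smooth. -/
theorem contDiff_of_partial_fst {f : ℝ → ℝ}
    (hBsmooth : ContDiffOn ℝ (⊤ : ℕ∞) (fun pr : ℝ × ℝ => B pr.1 pr.2)
      (Set.univ ×ˢ {ω : ℝ | ω ≠ 0}))
    (hBy : ∀ y ω : ℝ, ω ≠ 0 → HasDerivAt (fun y' => B y' ω) (f y - ω * B y ω) y) :
    ContDiff ℝ (⊤ : ℕ∞) f := by
  have hB := contDiff_slice_of_ne_zero hBsmooth (one_ne_zero (α := ℝ))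
  have h : f = fun y => deriv (fun y' => B y' 1) y + B y 1 := by
    funext y
    rw [(hBy y 1 one_ne_zero).deriv]
    ring
  rw [h]
  exact ((contDiff_infty_iff_deriv.1 hB).2).add hB

/-- Equality of the mixed partials of `B` is the Airy equation for `f`. -/
theorem airy_ode_of_partials {f : ℝ → ℝ}
    (hBsmooth : ContDiffOn ℝ (⊤ : ℕ∞) (fun pr : ℝ × ℝ => B pr.1 pr.2)
      (Set.univ ×ˢ {ω : ℝ | ω ≠ 0}))
    (hBy : ∀ y ω : ℝ, ω ≠ 0 → HasDerivAt (fun y' => B y' ω) (f y - ω * B y ω) y)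
    (hBω : ∀ y ω : ℝ, ω ≠ 0 → HasDerivAt (fun ω' => B y ω')
      (deriv f y - ω * f y + (ω ^ 2 - y) * B y ω) ω) (y : ℝ) :
    HasDerivAt (deriv f) (y * f y) y := by
  have hfs := contDiff_of_partial_fst hBsmooth hBy
  have hf : HasDerivAt f (deriv f y) y := (hfs.differentiable (by simp) y).hasDerivAt
  have hdf : HasDerivAt (deriv f) (deriv (deriv f) y) y :=
    ((contDiff_infty_iff_deriv.1 hfs).2.differentiable (by simp) y).hasDerivAt
  set g : ℝ × ℝ → ℝ := fun pr => B pr.1 pr.2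
  have hg : ∀ y ω : ℝ, ω ≠ 0 → HasFDerivAt g (fderiv ℝ g (y, ω)) (y, ω) := fun y ω hω =>
    ((contDiffAt_uncurry_of_ne_zero hBsmooth y hω).differentiableAt (by simp)).hasFDerivAt
  have hg₁ : ∀ y ω : ℝ, ω ≠ 0 → fderiv ℝ g (y, ω) (1, 0) = f y - ω * B y ω := fun y ω hω =>
    (hg y ω hω).hasDerivAt_fst.unique (hBy y ω hω)
  have hg₂ : ∀ y ω : ℝ, ω ≠ 0 →
      fderiv ℝ g (y, ω) (0, 1) = deriv f y - ω * f y + (ω ^ 2 - y) * B y ω := fun y ω hω =>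
    (hg y ω hω).hasDerivAt_snd.unique (hBω y ω hω)
  have hgg : HasFDerivAt (fderiv ℝ g) (fderiv ℝ (fderiv ℝ g) (y, 1)) (y, 1) :=
    (((contDiffAt_uncurry_of_ne_zero hBsmooth y one_ne_zero).fderiv_right
      (m := 1) (by norm_cast)).differentiableAt (by simp)).hasFDerivAt
  have h₁₂ : fderiv ℝ (fderiv ℝ g) (y, 1) (1, 0) (0, 1)
      = deriv (deriv f) y - deriv f y - B y 1 + (1 - y) * (f y - B y 1) := by
    have hl : HasDerivAt (fun y' => fderiv ℝ g (y', 1) (0, 1))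
        (fderiv ℝ (fderiv ℝ g) (y, 1) (1, 0) (0, 1)) y :=
      (hgg.hasDerivAt_fst.clm_apply (hasDerivAt_const y ((0 : ℝ), (1 : ℝ)))).congr_deriv
        (by simp)
    have hr : HasDerivAt (fun y' => deriv f y' - 1 * f y' + (1 ^ 2 - y') * B y' 1)
        (deriv (deriv f) y - 1 * deriv f y
          + ((-1) * B y 1 + (1 ^ 2 - y) * (f y - 1 * B y 1))) y :=
      (hdf.sub (hf.const_mul 1)).add
        (((hasDerivAt_id y).const_sub ((1 : ℝ) ^ 2)).mul (hBy y 1 one_ne_zero))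
    have he : (fun y' => fderiv ℝ g (y', 1) (0, 1)) =
        fun y' => deriv f y' - 1 * f y' + (1 ^ 2 - y') * B y' 1 :=
      funext fun y' => hg₂ y' 1 one_ne_zero
    rw [he] at hl
    rw [hl.unique hr]
    ring
  have h₂₁ : fderiv ℝ (fderiv ℝ g) (y, 1) (0, 1) (1, 0)
      = -B y 1 - (deriv f y - f y + (1 - y) * B y 1) := by
    have hl : HasDerivAt (fun ω' => fderiv ℝ g (y, ω') (1, 0))
        (fderiv ℝ (fderiv ℝ g) (y, 1) (0, 1) (1, 0)) 1 :=
      (hgg.hasDerivAt_snd.clm_apply (hasDerivAt_const 1 ((1 : ℝ), (0 : ℝ)))).congr_deriv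
        (by simp)
    have hr : HasDerivAt (fun ω' => f y - ω' * B y ω')
        (-(1 * B y 1 + 1 * (deriv f y - 1 * f y + (1 ^ 2 - y) * B y 1))) 1 :=
      ((hasDerivAt_id 1).mul (hBω y 1 one_ne_zero)).const_sub (f y)
    have he : (fun ω' => fderiv ℝ g (y, ω') (1, 0)) =ᶠ[𝓝 1] fun ω' => f y - ω' * B y ω' := by
      filter_upwards [isOpen_ne.mem_nhds (one_ne_zero (α := ℝ))] with ω' hω'
      exact hg₁ y ω' hω'
    rw [hl.unique (hr.congr_of_eventuallyEq he)]
    ring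
  have hsymm := (contDiffAt_uncurry_of_ne_zero hBsmooth y one_ne_zero).isSymmSndFDerivAt
    (by rw [minSmoothness_of_isRCLikeNormedField]; exact WithTop.coe_le_coe.2 le_top) (1, 0) (0, 1)
  have hsymm' : fderiv ℝ (fderiv ℝ g) (y, 1) (1, 0) (0, 1)
      = fderiv ℝ (fderiv ℝ g) (y, 1) (0, 1) (1, 0) := hsymm
  exact hdf.congr_deriv (by linarith)

end MixedPartials

theorem setIntegral_Ioi_eq_shift (g : ℝ → ℝ) (s : ℝ) :
    ∫ y in Ioi s, g y = ∫ t in Ioi 0, g (s + t) := by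
  have h := (measurePreserving_add_left volume s).setIntegral_preimage_emb
    (Homeomorph.addLeft s).measurableEmbedding g (Ioi s)
  rw [← h]
  simp

/-- Differentiation of `∫_s^∞ K(s, y) f(y) dy` along the diagonal shift `y = s + t`. -/
theorem hasDerivAt_setIntegral_Ioi_shift {K K' : ℝ → ℝ → ℝ} {f f' : ℝ → ℝ} {s C c D d : ℝ}
    (hK : ∀ r ∈ Metric.ball s 1, ∀ t, 0 < t →
      HasDerivAt (fun r' => K r' (r' + t)) (K' r (r + t)) r)
    (hKc : ∀ r, Continuous (K r)) (hKc' : Continuous (K' s))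
    (hf : ∀ y, HasDerivAt f (f' y) y) (hfc' : Continuous f')
    (hKb : ∀ r ∈ Metric.ball s 1, ∀ y, r ≤ y →
      |K r y| ≤ C * Real.exp (-(c * y)) ∧ |K' r y| ≤ C * Real.exp (-(c * y)))
    (hfb : ∀ y, s - 1 ≤ y → |f y| ≤ D * Real.exp (d * y) ∧ |f' y| ≤ D * Real.exp (d * y))
    (hdc : d < c) :
    HasDerivAt (fun r => ∫ y in Ioi r, K r y * f y)
      (∫ y in Ioi s, (K' s y * f y + K s y * f' y)) s := by
  have hfc : Continuous f := continuous_iff_continuousAt.2 fun y => (hf y).continuousAt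
  rw [setIntegral_Ioi_eq_shift _ s,
    funext fun r => setIntegral_Ioi_eq_shift (fun y => K r y * f y) r]
  have hprod : ∀ r ∈ Metric.ball s 1, ∀ t, 0 < t → ∀ A F : ℝ,
      |A| ≤ C * Real.exp (-(c * (r + t))) → |F| ≤ D * Real.exp (d * (r + t)) →
      |A * F| ≤ |C| * |D| * Real.exp ((c - d) * (|s| + 1)) * Real.exp (-(c - d) * t) := by
    intro r hr t ht A F hA hF
    have hA' : |A| ≤ |C| * Real.exp (-(c * (r + t))) :=
      hA.trans (mul_le_mul_of_nonneg_right (le_abs_self C) (Real.exp_pos _).le)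
    have hF' : |F| ≤ |D| * Real.exp (d * (r + t)) :=
      hF.trans (mul_le_mul_of_nonneg_right (le_abs_self D) (Real.exp_pos _).le)
    have hr' : -r ≤ |s| + 1 := by
      rw [Metric.mem_ball, Real.dist_eq, abs_lt] at hr
      linarith [neg_abs_le s]
    calc |A * F| = |A| * |F| := abs_mul _ _
      _ ≤ (|C| * Real.exp (-(c * (r + t)))) * (|D| * Real.exp (d * (r + t))) :=
          mul_le_mul hA' hF' (abs_nonneg _) (by positivity)
      _ = |C| * |D| * (Real.exp ((c - d) * -r) * Real.exp (-(c - d) * t)) := by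
          rw [← Real.exp_add, mul_mul_mul_comm, ← Real.exp_add]
          ring_nf
      _ ≤ |C| * |D| * (Real.exp ((c - d) * (|s| + 1)) * Real.exp (-(c - d) * t)) := by
          gcongr
      _ = _ := by ring
  have hmem : ∀ r ∈ Metric.ball s 1, ∀ t, 0 < t → r ≤ r + t ∧ s - 1 ≤ r + t := by
    intro r hr t ht
    rw [Metric.mem_ball, Real.dist_eq, abs_lt] at hr
    exact ⟨by linarith, by linarith⟩
  have hexp : IntegrableOn (fun t => Real.exp (-(c - d) * t)) (Ioi 0) :=
    exp_neg_integrableOn_Ioi 0 (sub_pos.2 hdc)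
  have hs : s ∈ Metric.ball s (1 : ℝ) := Metric.mem_ball_self one_pos
  refine (hasDerivAt_integral_of_dominated_loc_of_deriv_le (μ := volume.restrict (Ioi 0))
    (F := fun r t => K r (r + t) * f (r + t))
    (F' := fun r t => K' r (r + t) * f (r + t) + K r (r + t) * f' (r + t))
    (bound := fun t => 2 * (|C| * |D| * Real.exp ((c - d) * (|s| + 1)))
      * Real.exp (-(c - d) * t)) (Metric.ball_mem_nhds s one_pos) ?_ ?_ ?_ ?_ ?_ ?_).2
  · exact Eventually.of_forall fun r =>
      (by fun_prop : Continuous fun t => K r (r + t) * f (r + t)).aestronglyMeasurable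
  · refine (hexp.const_mul (|C| * |D| * Real.exp ((c - d) * (|s| + 1)))).mono'
      (by fun_prop : Continuous fun t => K s (s + t) * f (s + t)).aestronglyMeasurable ?_
    filter_upwards [ae_restrict_mem measurableSet_Ioi] with t ht
    exact hprod s hs t ht _ _ (hKb s hs _ (hmem s hs t ht).1).1 (hfb _ (hmem s hs t ht).2).1
  · exact (by fun_prop : Continuous fun t =>
      K' s (s + t) * f (s + t) + K s (s + t) * f' (s + t)).aestronglyMeasurable
  · filter_upwards [ae_restrict_mem measurableSet_Ioi] with t ht r hr
    have h1 := hprod r hr t ht _ _ (hKb r hr _ (hmem r hr t ht).1).2 (hfb _ (hmem r hr t ht).2).1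
    have h2 := hprod r hr t ht _ _ (hKb r hr _ (hmem r hr t ht).1).1 (hfb _ (hmem r hr t ht).2).2
    refine (norm_add_le _ _).trans ?_
    rw [Real.norm_eq_abs, Real.norm_eq_abs]
    linarith
  · exact hexp.const_mul _
  · filter_upwards [ae_restrict_mem measurableSet_Ioi] with t ht r hr
    exact (hK r hr t ht).mul ((hf (r + t)).comp_add_const r t)

/-- Solutions of `∂_y B = f - ω B` are bounded locally uniformly in `ω` on half-lines. -/
theorem abs_le_of_linear_ode {f b : ℝ → ℝ} {s ω W K : ℝ} (hW : |ω| ≤ W)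
    (hK : ∀ y, s ≤ y → |f y| ≤ K) (hb : ∀ y, HasDerivAt b (f y - ω * b y) y) {y : ℝ}
    (hy : s ≤ y) :
    |b y| ≤ Real.exp (W * (y - s)) * (|b s| + K * Real.exp (W * (y - s)) * (y - s)) := by
  have hexp : ∀ z, HasDerivAt (fun z => Real.exp (ω * (z - s))) (Real.exp (ω * (z - s)) * ω) z :=
    fun z => by
      simpa using (((hasDerivAt_id z).sub_const s).const_mul ω).exp
  have hG : ∀ z, HasDerivAt (fun z => Real.exp (ω * (z - s)) * b z)
      (Real.exp (ω * (z - s)) * f z) z := fun z =>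
    ((hexp z).mul (hb z)).congr_deriv (by ring)
  have hmul : ∀ k z : ℝ, |k| ≤ W → s ≤ z → z ≤ y → k * (z - s) ≤ W * (y - s) := by
    intro k z hk hsz hzy
    calc k * (z - s) ≤ W * (z - s) :=
          mul_le_mul_of_nonneg_right ((le_abs_self k).trans hk) (sub_nonneg.2 hsz)
      _ ≤ W * (y - s) := mul_le_mul_of_nonneg_left (by linarith) ((abs_nonneg k).trans hk)
  have hle := Convex.norm_image_sub_le_of_norm_hasDerivWithin_le (s := Icc s y)
    (C := K * Real.exp (W * (y - s)))
    (fun z _ => (hG z).hasDerivWithinAt) (fun z hz => by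
      rw [Real.norm_eq_abs, abs_mul, Real.abs_exp, mul_comm]
      exact mul_le_mul (hK z hz.1) (Real.exp_le_exp.2 (hmul ω z hW hz.1 hz.2))
        (Real.exp_pos _).le ((abs_nonneg _).trans (hK z hz.1)))
    (convex_Icc s y) (left_mem_Icc.2 hy) (right_mem_Icc.2 hy)
  simp only [sub_self, mul_zero, Real.exp_zero, one_mul, Real.norm_eq_abs,
    abs_of_nonneg (sub_nonneg.2 hy)] at hle
  have h1 : |Real.exp (ω * (y - s)) * b y|
      ≤ |b s| + K * Real.exp (W * (y - s)) * (y - s) := by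
    have := abs_sub_abs_le_abs_sub (Real.exp (ω * (y - s)) * b y) (b s)
    linarith
  calc |b y| = Real.exp (-ω * (y - s)) * |Real.exp (ω * (y - s)) * b y| := by
        rw [abs_mul, Real.abs_exp, ← mul_assoc, ← Real.exp_add]
        simp
    _ ≤ _ := mul_le_mul (Real.exp_le_exp.2 (hmul (-ω) y (by rwa [abs_neg]) hy le_rfl)) h1
        (abs_nonneg _) (Real.exp_pos _).le

/-- Differentiation in `ω` of the pairing of `B` with a superexponentially decaying function. -/
theorem hasDerivAt_setIntegral_Ioi_param {B : ℝ → ℝ → ℝ} {f f' G : ℝ → ℝ} {s ω₀ : ℝ}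
    (hω₀ : ω₀ ≠ 0) (hBc : ∀ ω, ω ≠ 0 → Continuous fun y => B y ω)
    (hfc : Continuous f) (hfc' : Continuous f') (hf : SuperExpDecay f) (hf' : ExpGrowth f')
    (hBy : ∀ y ω, ω ≠ 0 → HasDerivAt (fun y' => B y' ω) (f y - ω * B y ω) y)
    (hBω : ∀ y ω, ω ≠ 0 →
      HasDerivAt (fun ω' => B y ω') (f' y - ω * f y + (ω ^ 2 - y) * B y ω) ω)
    (hGc : Continuous G) (hG : SuperExpDecay G) :
    HasDerivAt (fun ω => ∫ y in Ioi s, G y * B y ω)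
      (∫ y in Ioi s, G y * (f' y - ω₀ * f y + (ω₀ ^ 2 - y) * B y ω₀)) ω₀ := by
  set ε : ℝ := |ω₀| / 2 with hε
  have hεpos : 0 < ε := half_pos (abs_pos.2 hω₀)
  set W : ℝ := |ω₀| + ε with hWdef
  have hball : ∀ ω ∈ Metric.closedBall ω₀ ε, ω ≠ 0 ∧ |ω| ≤ W := by
    intro ω hω
    rw [Metric.mem_closedBall, Real.dist_eq] at hω
    constructor
    · rintro rfl
      rw [zero_sub, abs_neg] at hω
      linarith
    · have := abs_sub_abs_le_abs_sub ω ω₀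
      linarith
  obtain ⟨K, hK⟩ := hf.exists_abs_le hfc s
  obtain ⟨M, hM⟩ : ∃ M, ∀ ω ∈ Metric.closedBall ω₀ ε, |B s ω| ≤ M := by
    have hc : ContinuousOn (fun ω => |B s ω|) (Metric.closedBall ω₀ ε) := fun ω hω =>
      (hBω s ω (hball ω hω).1).continuousAt.abs.continuousWithinAt
    obtain ⟨M, hM⟩ := (isCompact_closedBall ω₀ ε).bddAbove_image hc
    exact ⟨M, fun ω hω => hM ⟨ω, hω, rfl⟩⟩
  set β : ℝ → ℝ := fun y =>
    Real.exp (W * (y - s)) * (M + K * Real.exp (W * (y - s)) * (y - s)) with hβ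
  have hβb : ∀ ω ∈ Metric.closedBall ω₀ ε, ∀ y, s ≤ y → |B y ω| ≤ β y := fun ω hω y hy =>
    (abs_le_of_linear_ode (hball ω hω).2 hK (fun z => hBy z ω (hball ω hω).1) hy).trans
      (mul_le_mul_of_nonneg_left (add_le_add (hM ω hω) le_rfl) (Real.exp_pos _).le)
  have hexpg : ExpGrowth fun y => Real.exp (W * (y - s)) := by
    have h := (ExpGrowth.exp_mul W).mul (ExpGrowth.const (Real.exp (-(W * s))))
    simpa only [← Real.exp_add, ← sub_eq_add_neg, ← mul_sub] using h
  have hβg : ExpGrowth β := hexpg.mul ((ExpGrowth.const M).add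
    (((ExpGrowth.const K).mul hexpg).mul (ExpGrowth.self.sub (ExpGrowth.const s))))
  have hβc : Continuous β := by fun_prop
  have hω₀mem : ω₀ ∈ Metric.closedBall ω₀ ε := Metric.mem_closedBall_self hεpos.le
  have hB₀ := hBc ω₀ hω₀
  refine (hasDerivAt_integral_of_dominated_loc_of_deriv_le (μ := volume.restrict (Ioi s))
    (F := fun ω y => G y * B y ω)
    (F' := fun ω y => G y * (f' y - ω * f y + (ω ^ 2 - y) * B y ω))
    (bound := fun y => |G y| * (|f' y| + W * |f y| + (W ^ 2 + |y|) * β y))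
    (Metric.closedBall_mem_nhds ω₀ hεpos) ?_ ?_ ?_ ?_ ?_ ?_).2
  · filter_upwards [isOpen_ne.mem_nhds hω₀] with ω hω
    have := hBc ω hω
    exact (by fun_prop : Continuous fun y => G y * B y ω).aestronglyMeasurable
  · have hint : IntegrableOn (fun y => |G y| * β y) (Ioi s) :=
      (hG.abs.mul_expGrowth hβg).integrableOn (by fun_prop)
    refine hint.mono' (by fun_prop : Continuous fun y => G y * B y ω₀).aestronglyMeasurable ?_
    filter_upwards [ae_restrict_mem measurableSet_Ioi] with y hy
    rw [Real.norm_eq_abs, abs_mul]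
    exact mul_le_mul_of_nonneg_left (hβb ω₀ hω₀mem y (le_of_lt hy)) (abs_nonneg _)
  · exact (by fun_prop : Continuous fun y =>
      G y * (f' y - ω₀ * f y + (ω₀ ^ 2 - y) * B y ω₀)).aestronglyMeasurable
  · filter_upwards [ae_restrict_mem measurableSet_Ioi] with y hy ω hω
    rw [Real.norm_eq_abs, abs_mul]
    refine mul_le_mul_of_nonneg_left ?_ (abs_nonneg _)
    have hW := (hball ω hω).2
    calc |f' y - ω * f y + (ω ^ 2 - y) * B y ω|
        ≤ |f' y| + |ω| * |f y| + (|ω| ^ 2 + |y|) * |B y ω| := by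
          refine (abs_add_le _ _).trans (add_le_add ((abs_sub _ _).trans ?_) ?_)
          · rw [abs_mul]
          · rw [abs_mul]
            refine mul_le_mul_of_nonneg_right ((abs_sub _ _).trans ?_) (abs_nonneg _)
            rw [abs_pow]
      _ ≤ |f' y| + W * |f y| + (W ^ 2 + |y|) * β y := by
          have := hβb ω hω y (le_of_lt hy)
          gcongr
  · exact (hG.abs.mul_expGrowth ((hf'.abs.add ((ExpGrowth.const W).mul hf.expGrowth.abs)).add
      (((ExpGrowth.const (W ^ 2)).add ExpGrowth.self.abs).mul hβg))).integrableOn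
      (by fun_prop)
  · exact Eventually.of_forall fun y ω hω =>
      (hBω y ω (hball ω hω).1).const_mul (G y)

theorem ExpGrowth.exists_integrableOn {f : ℝ → ℝ} (hf : ExpGrowth f) (hc : Continuous f)
    (s : ℝ) :
    ∃ c₀ : ℝ, ∀ c, c₀ ≤ c → IntegrableOn (fun y => Real.exp (-(c * y)) * |f y|) (Ioi s) := by
  obtain ⟨d, hd⟩ := hf
  refine ⟨d + 1, fun c hdc => ?_⟩
  refine integrable_of_isBigO_exp_neg one_pos (by fun_prop) ?_
  have h := (Asymptotics.isBigO_refl (fun y => Real.exp (-(c * y))) atTop).mul hd.abs_left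
  refine (h.congr_right fun y => (Real.exp_add _ _).symm).trans
    ((isBigO_exp_mul_of_le (c := d - c) (d := -1) (by linarith)).congr_left fun y => ?_)
  ring_nf

section Kernel

variable {R : ℝ → ℝ → ℝ} {f g : ℝ → ℝ} {s : ℝ}

theorem superExpDecay_setIntegral_kernel
    (hRb : ∀ c, ∃ C, ∀ x y, s ≤ x → s ≤ y → |R x y| ≤ C * Real.exp (-(c * (x + y))))
    (hfc : Continuous f) (hf : ExpGrowth f) :
    SuperExpDecay fun x => ∫ y in Ioi s, R x y * f y := by
  obtain ⟨c₀, hc₀⟩ := hf.exists_integrableOn hfc s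
  refine SuperExpDecay.of_bound (a := max s 0) fun c => ?_
  obtain ⟨C, hC⟩ := hRb (max c c₀)
  have hint := hc₀ (max c c₀) (le_max_right _ _)
  refine ⟨|C| * ∫ y in Ioi s, Real.exp (-(max c c₀ * y)) * |f y|, fun x hx => ?_⟩
  have hsx : s ≤ x := (le_max_left _ _).trans hx
  have hx0 : 0 ≤ x := (le_max_right _ _).trans hx
  have hint' := hint.const_mul (|C| * Real.exp (-(c * x)))
  calc |∫ y in Ioi s, R x y * f y|
      ≤ ∫ y in Ioi s, |C| * Real.exp (-(c * x)) *
          (Real.exp (-(max c c₀ * y)) * |f y|) := by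
        rw [← Real.norm_eq_abs]
        refine norm_integral_le_of_norm_le hint' ?_
        filter_upwards [ae_restrict_mem measurableSet_Ioi] with y hy
        rw [Real.norm_eq_abs, abs_mul, ← mul_assoc]
        refine mul_le_mul_of_nonneg_right ((hC x y hsx (le_of_lt hy)).trans ?_) (abs_nonneg _)
        rw [mul_add, neg_add, Real.exp_add, ← mul_assoc]
        gcongr
        · exact le_abs_self C
        · exact le_max_left _ _
    _ = _ := by
        rw [integral_const_mul]
        ring

theorem integrable_kernel_mul (hRc : Continuous (Function.uncurry R))
    (hRb : ∀ c, ∃ C, ∀ x y, s ≤ x → s ≤ y → |R x y| ≤ C * Real.exp (-(c * (x + y))))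
    (hfc : Continuous f) (hf : ExpGrowth f) (hgc : Continuous g) (hg : ExpGrowth g) :
    Integrable (Function.uncurry fun x y => R x y * f x * g y)
      ((volume.restrict (Ioi s)).prod (volume.restrict (Ioi s))) := by
  obtain ⟨c₁, hc₁⟩ := hf.exists_integrableOn hfc s
  obtain ⟨c₂, hc₂⟩ := hg.exists_integrableOn hgc s
  obtain ⟨C, hC⟩ := hRb (max c₁ c₂)
  have hint := ((hc₁ _ (le_max_left c₁ c₂)).mul_prod (hc₂ _ (le_max_right c₁ c₂))).const_mul C
  refine hint.mono' ?_ ?_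
  · refine Continuous.aestronglyMeasurable ?_
    exact (hRc.mul (hfc.comp continuous_fst)).mul (hgc.comp continuous_snd)
  · rw [Measure.prod_restrict]
    filter_upwards [ae_restrict_mem (measurableSet_Ioi.prod measurableSet_Ioi)] with z hz
    simp only [Function.uncurry, Real.norm_eq_abs, abs_mul]
    have h := hC z.1 z.2 (le_of_lt hz.1) (le_of_lt hz.2)
    calc |R z.1 z.2| * |f z.1| * |g z.2|
        ≤ C * Real.exp (-(max c₁ c₂ * (z.1 + z.2))) * |f z.1| * |g z.2| := by gcongr
      _ = _ := by
        rw [mul_add, neg_add, Real.exp_add]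
        ring

/-- Self-adjointness of a symmetric kernel on `(s, ∞)`, as an identity of iterated integrals. -/
theorem setIntegral_kernel_swap (hRc : Continuous (Function.uncurry R))
    (hRb : ∀ c, ∃ C, ∀ x y, s ≤ x → s ≤ y → |R x y| ≤ C * Real.exp (-(c * (x + y))))
    (hRsymm : ∀ x y, s ≤ x → s ≤ y → R x y = R y x)
    (hfc : Continuous f) (hf : ExpGrowth f) (hgc : Continuous g) (hg : ExpGrowth g) :
    ∫ x in Ioi s, ∫ y in Ioi s, R x y * f x * g y
      = ∫ y in Ioi s, (∫ x in Ioi s, R y x * f x) * g y := by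
  rw [integral_integral_swap (integrable_kernel_mul hRc hRb hfc hf hgc hg)]
  refine setIntegral_congr_fun measurableSet_Ioi fun y hy => ?_
  simp only [← integral_mul_const]
  refine setIntegral_congr_fun measurableSet_Ioi fun x hx => ?_
  simp only [hRsymm x y (le_of_lt hx) (le_of_lt hy)]

/-- If `F = f + ∫ R f` and `F` decays superexponentially, so does `f`. -/
theorem superExpDecay_of_resolvent {F : ℝ → ℝ}
    (hRb : ∀ c, ∃ C, ∀ x y, s ≤ x → s ≤ y → |R x y| ≤ C * Real.exp (-(c * (x + y))))
    (hfc : Continuous f) (hf : ExpGrowth f) (hF : SuperExpDecay F)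
    (h : ∀ x, s ≤ x → F x = f x + ∫ y in Ioi s, R x y * f y) : SuperExpDecay f := by
  intro c
  refine ((hF.sub (superExpDecay_setIntegral_kernel hRb hfc hf)) c).congr' ?_ EventuallyEq.rfl
  filter_upwards [eventually_ge_atTop s] with x hx
  rw [h x hx, add_sub_cancel_right]

end Kernel

section Pairing

variable {s : ℝ}

theorem setIntegral_Ioi_deriv_mul {F F' g g' : ℝ → ℝ}
    (hF : ∀ y, s ≤ y → HasDerivAt F (F' y) y) (hg : ∀ y, HasDerivAt g (g' y) y)
    (hFd : SuperExpDecay F) (hgd : ExpGrowth g)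
    (hint : IntegrableOn (fun y => F' y * g y + F y * g' y) (Ioi s)) :
    ∫ y in Ioi s, (F' y * g y + F y * g' y) = -(F s * g s) := by
  rw [integral_Ioi_of_hasDerivAt_of_tendsto' (fun y hy => (hF y hy).mul (hg y)) hint
    (hFd.mul_expGrowth hgd).tendsto]
  simp

variable {Q P r f B : ℝ → ℝ} {ω q p u v : ℝ}

theorem setIntegral_P_mul (hQc : Continuous Q) (hPc : Continuous P) (hrc : Continuous r)
    (hfc : Continuous f) (hQ : SuperExpDecay Q) (hP : SuperExpDecay P) (hr : SuperExpDecay r)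
    (hf : SuperExpDecay f) (hBd : ExpGrowth B)
    (hB : ∀ y, HasDerivAt B (f y - ω * B y) y)
    (hQ' : ∀ y, s ≤ y → HasDerivAt Q (P y - u * Q y + q * r y) y)
    (hqs : Q s = q) (hu : u = ∫ y in Ioi s, Q y * f y) :
    ∫ y in Ioi s, P y * B y = u * (∫ y in Ioi s, Q y * B y) - u
      + ω * (∫ y in Ioi s, Q y * B y) - q * (B s + ∫ y in Ioi s, r y * B y) := by
  have hBc : Continuous B := continuous_iff_continuousAt.2 fun y => (hB y).continuousAt
  have iPB : IntegrableOn (fun y => P y * B y) (Ioi s) :=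
    (hP.mul_expGrowth hBd).integrableOn (by fun_prop)
  have iQB : IntegrableOn (fun y => Q y * B y) (Ioi s) :=
    (hQ.mul_expGrowth hBd).integrableOn (by fun_prop)
  have irB : IntegrableOn (fun y => r y * B y) (Ioi s) :=
    (hr.mul_expGrowth hBd).integrableOn (by fun_prop)
  have iQf : IntegrableOn (fun y => Q y * f y) (Ioi s) :=
    (hQ.mul_expGrowth hf.expGrowth).integrableOn (by fun_prop)
  have he : (fun y => (P y - u * Q y + q * r y) * B y + Q y * (f y - ω * B y)) =
      (fun y => P y * B y) - (fun y => u * (Q y * B y)) + (fun y => q * (r y * B y))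
        + (fun y => Q y * f y) - fun y => ω * (Q y * B y) := by
    funext y
    simp only [Pi.add_apply, Pi.sub_apply]
    ring
  have i₁ := iPB.sub (iQB.const_mul u)
  have i₂ := i₁.add (irB.const_mul q)
  have i₃ := i₂.add iQf
  have i₄ := i₃.sub (iQB.const_mul ω)
  have h := setIntegral_Ioi_deriv_mul hQ' hB hQ hBd (by rw [he]; exact i₄)
  rw [he, integral_sub' i₃ (iQB.const_mul ω), integral_add' i₂ iQf,
    integral_add' i₁ (irB.const_mul q), integral_sub' iPB (iQB.const_mul u)] at h
  simp only [integral_const_mul] at h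
  rw [← hu, hqs] at h
  linarith

theorem setIntegral_id_mul_Q_mul (hQc : Continuous Q) (hPc : Continuous P) (hrc : Continuous r)
    (hfc : Continuous f) (hQ : SuperExpDecay Q) (hP : SuperExpDecay P) (hr : SuperExpDecay r)
    (hf : SuperExpDecay f) (hBd : ExpGrowth B)
    (hB : ∀ y, HasDerivAt B (f y - ω * B y) y)
    (hP' : ∀ y, s ≤ y → HasDerivAt P (y * Q y - 2 * v * Q y + u * P y + p * r y) y)
    (hps : P s = p) (hv : v = ∫ y in Ioi s, P y * f y) :
    ∫ y in Ioi s, Q y * (y * B y) = 2 * v * (∫ y in Ioi s, Q y * B y)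
      - u * (∫ y in Ioi s, P y * B y) - v + ω * (∫ y in Ioi s, P y * B y)
      - p * (B s + ∫ y in Ioi s, r y * B y) := by
  have hBc : Continuous B := continuous_iff_continuousAt.2 fun y => (hB y).continuousAt
  have iPB : IntegrableOn (fun y => P y * B y) (Ioi s) :=
    (hP.mul_expGrowth hBd).integrableOn (by fun_prop)
  have iQB : IntegrableOn (fun y => Q y * B y) (Ioi s) :=
    (hQ.mul_expGrowth hBd).integrableOn (by fun_prop)
  have iyQB : IntegrableOn (fun y => Q y * (y * B y)) (Ioi s) :=
    (hQ.mul_expGrowth (ExpGrowth.self.mul hBd)).integrableOn (by fun_prop)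
  have irB : IntegrableOn (fun y => r y * B y) (Ioi s) :=
    (hr.mul_expGrowth hBd).integrableOn (by fun_prop)
  have iPf : IntegrableOn (fun y => P y * f y) (Ioi s) :=
    (hP.mul_expGrowth hf.expGrowth).integrableOn (by fun_prop)
  have he : (fun y => (y * Q y - 2 * v * Q y + u * P y + p * r y) * B y
        + P y * (f y - ω * B y)) =
      (fun y => Q y * (y * B y)) - (fun y => 2 * v * (Q y * B y)) + (fun y => u * (P y * B y))
        + (fun y => p * (r y * B y)) + (fun y => P y * f y) - fun y => ω * (P y * B y) := by
    funext y
    simp only [Pi.add_apply, Pi.sub_apply]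
    ring
  have i₁ := iyQB.sub (iQB.const_mul (2 * v))
  have i₂ := i₁.add (iPB.const_mul u)
  have i₃ := i₂.add (irB.const_mul p)
  have i₄ := i₃.add iPf
  have i₅ := i₄.sub (iPB.const_mul ω)
  have h := setIntegral_Ioi_deriv_mul hP' hB hP hBd (by rw [he]; exact i₅)
  rw [he, integral_sub' i₄ (iPB.const_mul ω), integral_add' i₃ iPf,
    integral_add' i₂ (irB.const_mul p), integral_add' i₁ (iPB.const_mul u),
    integral_sub' iyQB (iQB.const_mul (2 * v))] at h
  simp only [integral_const_mul] at h
  rw [← hv, hps] at h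
  linarith

theorem setIntegral_mul_partial_omega {G f' : ℝ → ℝ} (hGc : Continuous G) (hfc : Continuous f)
    (hfc' : Continuous f') (hBc : Continuous B) (hG : SuperExpDecay G) (hf : ExpGrowth f)
    (hf' : ExpGrowth f') (hBd : ExpGrowth B) :
    ∫ y in Ioi s, G y * (f' y - ω * f y + (ω ^ 2 - y) * B y) =
      (∫ y in Ioi s, G y * f' y) - ω * (∫ y in Ioi s, G y * f y)
        + ω ^ 2 * (∫ y in Ioi s, G y * B y) - ∫ y in Ioi s, G y * (y * B y) := by
  have iGf : IntegrableOn (fun y => G y * f y) (Ioi s) :=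
    (hG.mul_expGrowth hf).integrableOn (by fun_prop)
  have iGf' : IntegrableOn (fun y => G y * f' y) (Ioi s) :=
    (hG.mul_expGrowth hf').integrableOn (by fun_prop)
  have iGB : IntegrableOn (fun y => G y * B y) (Ioi s) :=
    (hG.mul_expGrowth hBd).integrableOn (by fun_prop)
  have iyGB : IntegrableOn (fun y => G y * (y * B y)) (Ioi s) :=
    (hG.mul_expGrowth (ExpGrowth.self.mul hBd)).integrableOn (by fun_prop)
  have he : (fun y => G y * (f' y - ω * f y + (ω ^ 2 - y) * B y)) =
      (fun y => G y * f' y) - (fun y => ω * (G y * f y)) + (fun y => ω ^ 2 * (G y * B y))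
        - fun y => G y * (y * B y) := by
    funext y
    simp only [Pi.add_apply, Pi.sub_apply]
    ring
  have i₁ := iGf'.sub (iGf.const_mul ω)
  have i₂ := i₁.add (iGB.const_mul (ω ^ 2))
  rw [he, integral_sub' i₂ iyGB, integral_add' i₁ (iGB.const_mul (ω ^ 2)),
    integral_sub' iGf' (iGf.const_mul ω)]
  simp only [integral_const_mul]

end Pairing

/-- Proposition 4.1, conditional on the Tracy–Widom resolvent
relations. Given `B` satisfying the two Airy differential relations and resolvent
data `R`, `Q`, `P` satisfying the Tracy–Widom relations (1)–(8), the functions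
`a(s,ω)` and `b(s,ω)` satisfy the Baik–Rains differential system. -/
theorem baik_rains_ab_system
    (B : ℝ → ℝ → ℝ)
    (hBsmooth : ContDiffOn ℝ (⊤ : ℕ∞) (fun pr : ℝ × ℝ => B pr.1 pr.2)
      (Set.univ ×ˢ {ω : ℝ | ω ≠ 0}))
    (hBy : ∀ y ω : ℝ, ω ≠ 0 →
      HasDerivAt (fun y' => B y' ω) (Airy y - ω * B y ω) y)
    (hBω : ∀ y ω : ℝ, ω ≠ 0 →
      HasDerivAt (fun ω' => B y ω')
        (deriv Airy y - ω * Airy y + (ω ^ 2 - y) * B y ω) ω)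
    (hBgrowth : ∀ ω : ℝ, ω ≠ 0 → ∃ C c : ℝ, ∀ y, |B y ω| ≤ C * Real.exp (c * |y|))
    (R : ℝ → ℝ → ℝ → ℝ) (Q P : ℝ → ℝ → ℝ)
    (hRsmooth : ContDiff ℝ (⊤ : ℕ∞) (fun pr : ℝ × ℝ × ℝ => R pr.1 pr.2.1 pr.2.2))
    (hQsmooth : ContDiff ℝ (⊤ : ℕ∞) (fun pr : ℝ × ℝ => Q pr.1 pr.2))
    (hPsmooth : ContDiff ℝ (⊤ : ℕ∞) (fun pr : ℝ × ℝ => P pr.1 pr.2))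
    (hdecay : ∀ Kc : Set ℝ, IsCompact Kc → ∀ c : ℝ, ∃ C : ℝ, ∀ s ∈ Kc, ∀ x y : ℝ,
      s ≤ x → s ≤ y →
      |R s x y| ≤ C * Real.exp (-(c * (x + y))) ∧
      ‖fderiv ℝ (fun pr : ℝ × ℝ × ℝ => R pr.1 pr.2.1 pr.2.2) (s, x, y)‖
        ≤ C * Real.exp (-(c * (x + y))) ∧
      |Q s x| ≤ C * Real.exp (-(c * x)) ∧
      ‖fderiv ℝ (fun pr : ℝ × ℝ => Q pr.1 pr.2) (s, x)‖ ≤ C * Real.exp (-(c * x)) ∧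
      |P s x| ≤ C * Real.exp (-(c * x)) ∧
      ‖fderiv ℝ (fun pr : ℝ × ℝ => P pr.1 pr.2) (s, x)‖ ≤ C * Real.exp (-(c * x)))
    (q p u v : ℝ → ℝ)
    (hq : ∀ s, q s = Q s s) (hp : ∀ s, p s = P s s)
    (hu : ∀ s, u s = ∫ x in Set.Ioi s, Q s x * Airy x)
    (hv : ∀ s, v s = ∫ x in Set.Ioi s, P s x * Airy x)
    -- (1)
    (h1Q : ∀ s x, s ≤ x → Q s x = Airy x + ∫ y in Set.Ioi s, R s x y * Airy y)
    (h1P : ∀ s x, s ≤ x → P s x = deriv Airy x + ∫ y in Set.Ioi s, R s x y * deriv Airy y)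
    -- (2)
    (h2 : ∀ s x y, s ≤ x → s ≤ y → x ≠ y →
      R s x y = (Q s x * P s y - P s x * Q s y) / (x - y))
    -- (3)
    (h3 : ∀ s y, s ≤ y → HasDerivAt (fun s' => Q s' y) (-(q s * R s s y)) s)
    -- (4)
    (h4 : ∀ s x y, s ≤ x → s ≤ y →
      HasDerivAt (fun t => R (s + t) (x + t) (y + t)) (-(Q s x * Q s y)) 0)
    -- (5)
    (h5 : ∀ s y, s ≤ y → HasDerivAt (fun y' => Q s y')
      (P s y - u s * Q s y + q s * R s s y) y)
    -- (6)
    (h6 : ∀ s y, s ≤ y → HasDerivAt (fun y' => P s y')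
      (y * Q s y - 2 * v s * Q s y + u s * P s y + p s * R s s y) y)
    -- (7)
    (h7 : ∀ s, u s ^ 2 - 2 * v s = q s ^ 2)
    -- (8)
    (h8 : ∀ s, HasDerivAt q (p s - q s * u s) s)
    (a b : ℝ → ℝ → ℝ)
    (ha : ∀ s ω, a s ω = 1 - (∫ x in Set.Ioi s, Airy x * B x ω)
      - ∫ x in Set.Ioi s, ∫ y in Set.Ioi s, R s x y * Airy x * B y ω)
    (hb : ∀ s ω, b s ω = B s ω + ∫ y in Set.Ioi s, R s s y * B y ω) :
    ∀ s ω : ℝ, ω ≠ 0 →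
      HasDerivAt (fun s' => a s' ω) (q s * b s ω) s ∧
      HasDerivAt (fun s' => b s' ω) (q s * a s ω - ω * b s ω) s ∧
      HasDerivAt (fun ω' => a s ω')
        (q s ^ 2 * a s ω - (deriv q s + ω * q s) * b s ω) ω ∧
      HasDerivAt (fun ω' => b s ω')
        ((deriv q s - ω * q s) * a s ω + (ω ^ 2 - s - q s ^ 2) * b s ω) ω := by
  have hAs : ContDiff ℝ (⊤ : ℕ∞) Airy := contDiff_of_partial_fst hBsmooth hBy
  have hAc : Continuous Airy := hAs.continuous
  have hA : ∀ y, HasDerivAt Airy (deriv Airy y) y := fun y =>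
    (hAs.differentiable (by simp) y).hasDerivAt
  have hA' : ∀ y, HasDerivAt (deriv Airy) (y * Airy y) y :=
    airy_ode_of_partials hBsmooth hBy hBω
  have hAc' : Continuous (deriv Airy) :=
    continuous_iff_continuousAt.2 fun y => (hA' y).continuousAt
  have hBd : ∀ ω, ω ≠ 0 → ExpGrowth fun y => B y ω := by
    intro ω hω
    obtain ⟨C, c, hC⟩ := hBgrowth ω hω
    refine ⟨c, Asymptotics.IsBigO.of_bound C ?_⟩
    filter_upwards [eventually_ge_atTop 0] with y hy
    simpa [abs_of_nonneg hy] using hC y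
  have hBc : ∀ ω, ω ≠ 0 → Continuous fun y => B y ω := fun ω hω =>
    continuous_iff_continuousAt.2 fun y => (hBy y ω hω).continuousAt
  have hAg : ExpGrowth Airy :=
    expGrowth_of_airy_ode hA hA' (fun y => hBy y 1 one_ne_zero) (hBd 1 one_ne_zero)
  have hRc : ∀ s, Continuous (Function.uncurry (R s)) := fun s =>
    hRsmooth.continuous.comp (continuous_const.prodMk continuous_id)
  have hQc : ∀ s, Continuous (Q s) := fun s =>
    hQsmooth.continuous.comp (continuous_const.prodMk continuous_id)
  have hPc : ∀ s, Continuous (P s) := fun s =>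
    hPsmooth.continuous.comp (continuous_const.prodMk continuous_id)
  have hrc : ∀ s, Continuous (R s s) := fun s =>
    hRsmooth.continuous.comp
      (continuous_const.prodMk (continuous_const.prodMk continuous_id))
  have hRb : ∀ s c, ∃ C, ∀ x y, s ≤ x → s ≤ y →
      |R s x y| ≤ C * Real.exp (-(c * (x + y))) := by
    intro s c
    obtain ⟨C, hC⟩ := hdecay {s} isCompact_singleton c
    exact ⟨C, fun x y hx hy => (hC s rfl x y hx hy).1⟩
  have hQd : ∀ s, SuperExpDecay (Q s) := fun s => SuperExpDecay.of_bound (a := s) fun c => by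
    obtain ⟨C, hC⟩ := hdecay {s} isCompact_singleton c
    exact ⟨C, fun y hy => (hC s rfl y y hy hy).2.2.1⟩
  have hPd : ∀ s, SuperExpDecay (P s) := fun s => SuperExpDecay.of_bound (a := s) fun c => by
    obtain ⟨C, hC⟩ := hdecay {s} isCompact_singleton c
    exact ⟨C, fun y hy => (hC s rfl y y hy hy).2.2.2.2.1⟩
  have hrd : ∀ s, SuperExpDecay (R s s) := fun s => SuperExpDecay.of_bound (a := s) fun c => by
    obtain ⟨C, hC⟩ := hRb s c
    refine ⟨C * Real.exp (-(c * s)), fun y hy => (hC s y le_rfl hy).trans_eq ?_⟩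
    rw [mul_add, neg_add, Real.exp_add, mul_assoc]
  have hAd : SuperExpDecay Airy :=
    superExpDecay_of_resolvent (hRb 0) hAc hAg (hQd 0) (h1Q 0)
  have hAg' : ExpGrowth (deriv Airy) := by
    obtain ⟨K, hK⟩ := (hAd.mul_expGrowth ExpGrowth.self).exists_abs_le (by fun_prop) 0
    exact expGrowth_of_abs_deriv_le (a := 0) (fun y _ => hA' y)
      fun y hy => by simpa only [mul_comm] using hK y hy
  have hAd' : SuperExpDecay (deriv Airy) :=
    superExpDecay_of_resolvent (hRb 0) hAc' hAg' (hPd 0) (h1P 0)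
  have hRsymm : ∀ s x y, s ≤ x → s ≤ y → R s x y = R s y x := by
    intro s x y hx hy
    rcases eq_or_ne x y with rfl | hxy
    · rfl
    · rw [h2 s x y hx hy hxy, h2 s y x hy hx hxy.symm, ← neg_sub x y, div_neg, ← neg_div]
      ring
  have hvQ : ∀ s, v s = ∫ y in Ioi s, Q s y * deriv Airy y := by
    intro s
    have hsw := setIntegral_kernel_swap (hRc s) (hRb s) (hRsymm s) hAc' hAg' hAc hAg
    have e₁ : ∀ y ∈ Ioi s, (∫ x in Ioi s, R s y x * deriv Airy x) * Airy y
        = P s y * Airy y - deriv Airy y * Airy y := fun y hy => by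
      rw [h1P s y (le_of_lt hy)]
      ring
    have e₂ : ∀ x ∈ Ioi s, ∫ y in Ioi s, R s x y * deriv Airy x * Airy y
        = Q s x * deriv Airy x - deriv Airy x * Airy x := fun x hx => by
      rw [h1Q s x (le_of_lt hx), add_mul, ← integral_mul_const, mul_comm (Airy x),
        add_sub_cancel_left]
      exact integral_congr_ae (Eventually.of_forall fun y => by ring)
    have iPA : IntegrableOn (fun y => P s y * Airy y) (Ioi s) :=
      ((hPd s).mul_expGrowth hAg).integrableOn ((hPc s).mul hAc).continuousOn
    have iQA : IntegrableOn (fun y => Q s y * deriv Airy y) (Ioi s) :=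
      ((hQd s).mul_expGrowth hAg').integrableOn ((hQc s).mul hAc').continuousOn
    have iAA : IntegrableOn (fun y => deriv Airy y * Airy y) (Ioi s) :=
      (hAd'.mul_expGrowth hAg).integrableOn (hAc'.mul hAc).continuousOn
    rw [setIntegral_congr_fun measurableSet_Ioi e₁,
      setIntegral_congr_fun measurableSet_Ioi e₂, integral_sub iQA iAA,
      integral_sub iPA iAA, ← hv s] at hsw
    linarith
  have ha' : ∀ s ω, ω ≠ 0 → a s ω = 1 - ∫ y in Ioi s, Q s y * B y ω := by
    intro s ω hω
    have hsw := setIntegral_kernel_swap (hRc s) (hRb s) (hRsymm s) hAc hAg (hBc ω hω) (hBd ω hω)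
    have e₁ : ∀ y ∈ Ioi s, (∫ x in Ioi s, R s y x * Airy x) * B y ω
        = Q s y * B y ω - Airy y * B y ω := fun y hy => by
      rw [h1Q s y (le_of_lt hy)]
      ring
    have iQB : IntegrableOn (fun y => Q s y * B y ω) (Ioi s) :=
      ((hQd s).mul_expGrowth (hBd ω hω)).integrableOn ((hQc s).mul (hBc ω hω)).continuousOn
    have iAB : IntegrableOn (fun y => Airy y * B y ω) (Ioi s) :=
      (hAd.mul_expGrowth (hBd ω hω)).integrableOn (hAc.mul (hBc ω hω)).continuousOn
    rw [setIntegral_congr_fun measurableSet_Ioi e₁, integral_sub iQB iAB] at hsw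
    rw [ha, hsw]
    ring
  intro s ω hω
  have hbω : Continuous fun y => B y ω := hBc ω hω
  have hα := ha' s ω hω
  have hβ := hb s ω
  have hI₁ := setIntegral_P_mul (hQc s) (hPc s) (hrc s) hAc (hQd s) (hPd s) (hrd s) hAd
    (hBd ω hω) (fun y => hBy y ω hω) (h5 s) (hq s).symm (hu s)
  have hI₂ := setIntegral_id_mul_Q_mul (hQc s) (hPc s) (hrc s) hAc (hQd s) (hPd s) (hrd s) hAd
    (hBd ω hω) (fun y => hBy y ω hω) (h6 s) (hp s).symm (hv s)
  have hrA : ∫ y in Ioi s, R s s y * Airy y = q s - Airy s := by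
    rw [hq, h1Q s s le_rfl]
    ring
  have hrA' : ∫ y in Ioi s, R s s y * deriv Airy y = p s - deriv Airy s := by
    rw [hp, h1P s s le_rfl]
    ring
  have iQB : IntegrableOn (fun y => Q s y * B y ω) (Ioi s) :=
    ((hQd s).mul_expGrowth (hBd ω hω)).integrableOn (by fun_prop)
  have iPB : IntegrableOn (fun y => P s y * B y ω) (Ioi s) :=
    ((hPd s).mul_expGrowth (hBd ω hω)).integrableOn (by fun_prop)
  have irB : IntegrableOn (fun y => R s s y * B y ω) (Ioi s) :=
    ((hrd s).mul_expGrowth (hBd ω hω)).integrableOn (by fun_prop)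
  have iQA : IntegrableOn (fun y => Q s y * Airy y) (Ioi s) :=
    ((hQd s).mul_expGrowth hAg).integrableOn (by fun_prop)
  have irA : IntegrableOn (fun y => R s s y * Airy y) (Ioi s) :=
    ((hrd s).mul_expGrowth hAg).integrableOn (by fun_prop)
  have hryB : ∫ y in Ioi s, R s s y * (y * B y ω) = s * (∫ y in Ioi s, R s s y * B y ω)
      - q s * (∫ y in Ioi s, P s y * B y ω) + p s * (∫ y in Ioi s, Q s y * B y ω) := by
    have e : ∀ y ∈ Ioi s, R s s y * (y * B y ω)
        = ((fun y => s * (R s s y * B y ω)) - (fun y => q s * (P s y * B y ω))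
          + fun y => p s * (Q s y * B y ω)) y := fun y hy => by
      have hne : s - y ≠ 0 := (sub_neg.2 hy).ne
      have h : R s s y * (s - y) = q s * P s y - p s * Q s y := by
        rw [h2 s s y le_rfl (le_of_lt hy) (ne_of_lt hy), div_mul_cancel₀ _ hne, hq, hp]
      simp only [Pi.add_apply, Pi.sub_apply]
      linear_combination (-B y ω) * h
    have i₁ := (irB.const_mul s).sub (iPB.const_mul (q s))
    rw [setIntegral_congr_fun measurableSet_Ioi e, integral_add' i₁ (iQB.const_mul (p s)),
      integral_sub' (irB.const_mul s) (iPB.const_mul (q s))]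
    simp only [integral_const_mul]
  have hdq : deriv q s = p s - q s * u s := (h8 s).deriv
  have hdA : Continuous fun y => Airy y - ω * B y ω := by fun_prop
  obtain ⟨D, d, hD⟩ : ∃ D d : ℝ, ∀ y, s - 1 ≤ y → |B y ω| ≤ D * Real.exp (d * y) ∧
      |Airy y - ω * B y ω| ≤ D * Real.exp (d * y) := by
    obtain ⟨d, hd⟩ := (hBd ω hω).abs.add
      (hAg.sub ((ExpGrowth.const ω).mul (hBd ω hω))).abs
    obtain ⟨D, hD⟩ := exists_exp_bound_of_isBigO hd (by fun_prop) (s - 1)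
    refine ⟨D, d, fun y hy => ?_⟩
    have h := (le_abs_self _).trans (hD y hy)
    exact ⟨by linarith [abs_nonneg (Airy y - ω * B y ω)], by linarith [abs_nonneg (B y ω)]⟩
  obtain ⟨C, hC⟩ := hdecay (Icc (s - 1) (s + 1)) isCompact_Icc (d + 1)
  have hball : ∀ r ∈ Metric.ball s 1, r ∈ Icc (s - 1) (s + 1) := by
    intro r hr
    rw [Real.ball_eq_Ioo] at hr
    exact Ioo_subset_Icc_self hr
  refine ⟨?_, ?_, ?_, ?_⟩
  · set g : ℝ × ℝ → ℝ := fun pr => Q pr.1 pr.2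
    have hg : ∀ z, HasFDerivAt g (fderiv ℝ g z) z := fun z =>
      (hQsmooth.differentiable (by simp) z).hasFDerivAt
    have hnorm : ‖((1 : ℝ), (1 : ℝ))‖ = 1 := by simp [Prod.norm_def]
    have hg' : Continuous (fderiv ℝ g) := hQsmooth.continuous_fderiv (by simp)
    have hshift := hasDerivAt_setIntegral_Ioi_shift (K := Q)
      (K' := fun r y => fderiv ℝ g (r, y) (1, 1)) (C := C)
      (fun r _ t _ => (hg (r, r + t)).comp_hasDerivAt (f := fun r' => (r', r' + t)) r
        ((hasDerivAt_id r).prodMk ((hasDerivAt_id r).add_const t)))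
      hQc ((hg'.comp (continuous_const.prodMk continuous_id)).clm_apply continuous_const)
      (fun y => hBy y ω hω) hdA
      (fun r hr y hy => by
        obtain ⟨-, -, h₁, h₂, -⟩ := hC r (hball r hr) y y hy hy
        refine ⟨h₁, ?_⟩
        have h := (fderiv ℝ g (r, y)).le_opNorm (1, 1)
        rw [hnorm, mul_one] at h
        exact h.trans h₂) hD (lt_add_one d)
    have he : ∀ y ∈ Ioi s, fderiv ℝ g (s, y) (1, 1) * B y ω + Q s y * (Airy y - ω * B y ω)
        = ((fun y => P s y * B y ω) - (fun y => (u s + ω) * (Q s y * B y ω))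
          + fun y => Q s y * Airy y) y := fun y hy => by
      have hsum : fderiv ℝ g (s, y) (1, 1) = P s y - u s * Q s y := by
        have h₁ := (hg (s, y)).hasDerivAt_fst.unique (h3 s y (le_of_lt hy))
        have h₂ := (hg (s, y)).hasDerivAt_snd.unique (h5 s y (le_of_lt hy))
        rw [show ((1 : ℝ), (1 : ℝ)) = (1, 0) + (0, 1) by simp, map_add, h₁, h₂]
        ring
      rw [hsum]
      simp only [Pi.add_apply, Pi.sub_apply]
      ring
    rw [setIntegral_congr_fun measurableSet_Ioi he,
      integral_add' (iPB.sub (iQB.const_mul (u s + ω))) iQA,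
      integral_sub' iPB (iQB.const_mul (u s + ω)), integral_const_mul, ← hu s] at hshift
    rw [funext fun r => ha' r ω hω]
    refine (hshift.const_sub 1).congr_deriv ?_
    rw [hI₁, hβ]
    ring
  · set g : ℝ × ℝ × ℝ → ℝ := fun pr => R pr.1 pr.2.1 pr.2.2
    have hg : ∀ z, HasFDerivAt g (fderiv ℝ g z) z := fun z =>
      (hRsmooth.differentiable (by simp) z).hasFDerivAt
    have hnorm : ‖((1 : ℝ), (1 : ℝ), (1 : ℝ))‖ = 1 := by simp [Prod.norm_def]
    have hg' : Continuous (fderiv ℝ g) := hRsmooth.continuous_fderiv (by simp)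
    have hexp : ∀ r ∈ Metric.ball s 1, ∀ y, C * Real.exp (-((d + 1) * (r + y)))
        ≤ |C| * Real.exp (|d + 1| * (|s| + 1)) * Real.exp (-((d + 1) * y)) := by
      intro r hr y
      have hr' : |r| ≤ |s| + 1 := by
        rw [Metric.mem_ball, Real.dist_eq] at hr
        linarith [abs_sub_abs_le_abs_sub r s]
      have h : -((d + 1) * r) ≤ |d + 1| * (|s| + 1) :=
        calc -((d + 1) * r) ≤ |(d + 1) * r| := neg_le_abs _
          _ = |d + 1| * |r| := abs_mul _ _
          _ ≤ |d + 1| * (|s| + 1) := by gcongr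
      rw [mul_add, neg_add, Real.exp_add, ← mul_assoc]
      gcongr
      exact le_abs_self C
    have hshift := hasDerivAt_setIntegral_Ioi_shift (K := fun r y => R r r y)
      (K' := fun r y => fderiv ℝ g (r, r, y) (1, 1, 1))
      (C := |C| * Real.exp (|d + 1| * (|s| + 1)))
      (fun r _ t _ => (hg (r, r, r + t)).comp_hasDerivAt (f := fun r' => (r', r', r' + t)) r
        ((hasDerivAt_id r).prodMk ((hasDerivAt_id r).prodMk ((hasDerivAt_id r).add_const t))))
      hrc ((hg'.comp (continuous_const.prodMk
        (continuous_const.prodMk continuous_id))).clm_apply continuous_const)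
      (fun y => hBy y ω hω) hdA
      (fun r hr y hy => by
        obtain ⟨h₁, h₂, -⟩ := hC r (hball r hr) r y le_rfl hy
        refine ⟨h₁.trans (hexp r hr y), ?_⟩
        have h := (fderiv ℝ g (r, r, y)).le_opNorm (1, 1, 1)
        rw [hnorm, mul_one] at h
        exact (h.trans h₂).trans (hexp r hr y)) hD (lt_add_one d)
    have he : ∀ y ∈ Ioi s, fderiv ℝ g (s, s, y) (1, 1, 1) * B y ω
          + R s s y * (Airy y - ω * B y ω)
        = ((fun y => R s s y * Airy y) - (fun y => q s * (Q s y * B y ω))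
          - fun y => ω * (R s s y * B y ω)) y := fun y hy => by
      have hsum : fderiv ℝ g (s, s, y) (1, 1, 1) = -(Q s s * Q s y) := by
        have hline : HasDerivAt (fun t : ℝ => (s + t, s + t, y + t)) ((1 : ℝ), (1 : ℝ), (1 : ℝ)) 0 :=
          ((hasDerivAt_id 0).const_add s).prodMk
            (((hasDerivAt_id 0).const_add s).prodMk ((hasDerivAt_id 0).const_add y))
        exact ((hg (s, s, y)).comp_hasDerivAt_of_eq 0 hline (by simp)).unique
          (h4 s s y le_rfl (le_of_lt hy))
      rw [hsum, ← hq]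
      simp only [Pi.sub_apply]
      ring
    rw [setIntegral_congr_fun measurableSet_Ioi he,
      integral_sub' (irA.sub (iQB.const_mul (q s))) (irB.const_mul ω),
      integral_sub' irA (iQB.const_mul (q s)), integral_const_mul, integral_const_mul,
      hrA] at hshift
    rw [funext fun r => hb r ω]
    refine ((hBy s ω hω).add hshift).congr_deriv ?_
    rw [hα, hβ]
    ring
  · have hparam := hasDerivAt_setIntegral_Ioi_param (s := s) hω hBc hAc hAc' hAd hAg' hBy hBω
      (hQc s) (hQd s)
    rw [setIntegral_mul_partial_omega (hQc s) hAc hAc' hbω (hQd s) hAg hAg' (hBd ω hω),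
      ← hvQ s, ← hu s, hI₂, hI₁] at hparam
    have he : (fun ω' => a s ω') =ᶠ[𝓝 ω] fun ω' => 1 - ∫ y in Ioi s, Q s y * B y ω' := by
      filter_upwards [isOpen_ne.mem_nhds hω] with ω' hω'
      exact ha' s ω' hω'
    refine ((hparam.const_sub 1).congr_of_eventuallyEq he).congr_deriv ?_
    rw [hdq, hα, hβ, ← h7 s]
    ring
  · have hparam := hasDerivAt_setIntegral_Ioi_param (s := s) hω hBc hAc hAc' hAd hAg' hBy hBω
      (hrc s) (hrd s)
    rw [setIntegral_mul_partial_omega (hrc s) hAc hAc' hbω (hrd s) hAg hAg' (hBd ω hω),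
      hrA, hrA', hryB, hI₁] at hparam
    rw [hdq, hα, hβ, funext fun ω' => hb s ω']
    refine ((hBω s ω hω).add hparam).congr_deriv ?_
    ring

end
end

section
/- (Proposition 5.1, conditional on the resolvent relations.) In the setting of Proposition 4.1 (functions R(s;x,y), Q, P, q, p, u, v satisfying the Tracy–Widom relations (1)–(8), and B(y,ω) defined from the Airy function for ω≠0, with the stated smoothness and decay), assume in addition the resolvent derivative relation ∂_s R(s;x,y) = −R(s;x,s)·R(s;s,y) for x,y>s, and that a(s,ω)→1, b(s,ω)→0 and ∫_s^∞B(y,ω₊)B(y,ω₋)dy + ∫_s^∞∫_s^∞R(s;x,y)B(x,ω₊)B(y,ω₋)dxdy → 0 as s→+∞. Fix ω₊,ω₋∈ℝ∖{0}. Then for all s∈ℝ: 1 − (ω₊+ω₋)·( ∫_s^∞ B(y,ω₊)B(y,ω₋)dy + ∫_s^∞∫_s^∞ R(s;x,y)B(x,ω₊)B(y,ω₋)dxdy ) = a(s,ω₊)a(s,ω₋) − b(s,ω₊)b(s,ω₋), where a(s,ω)=1−∫_s^∞Ai(x)B(x,ω)dx−∫_s^∞∫_s^∞R(s;x,y)Ai(x)B(y,ω)dxdy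 and b(s,ω)=B(s,ω)+∫_s^∞R(s;s,y)B(y,ω)dy. -/
noncomputable section
open MeasureTheory Real Filter Topology Set

/-- At most exponential growth at `+∞`, uniformly on half-lines bounded below. -/
def ExpBounded (g : ℝ → ℝ) : Prop :=
  ∃ c : ℝ, ∀ m : ℝ, ∃ C : ℝ, ∀ y, m ≤ y → |g y| ≤ C * Real.exp (c * y)

/-- Decay of `G s x`, `x ≥ s`, faster than every exponential, locally uniformly in `s`. -/
def KernelDecay (G : ℝ → ℝ → ℝ) : Prop :=
  ∀ K : Set ℝ, IsCompact K → ∀ c : ℝ, ∃ C : ℝ, ∀ s ∈ K, ∀ x, s ≤ x →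
    |G s x| ≤ C * Real.exp (-(c * x))

/-- The two-variable analogue of `KernelDecay`. -/
def KernelDecay₂ (G : ℝ → ℝ × ℝ → ℝ) : Prop :=
  ∀ K : Set ℝ, IsCompact K → ∀ c : ℝ, ∃ C : ℝ, ∀ s ∈ K, ∀ z : ℝ × ℝ, s ≤ z.1 → s ≤ z.2 →
    |G s z| ≤ C * Real.exp (-(c * (z.1 + z.2)))

lemma KernelDecay.mul {G : ℝ → ℝ → ℝ} {g : ℝ → ℝ} (hG : KernelDecay G) (hg : ExpBounded g) :
    KernelDecay fun s x => G s x * g x := by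
  intro K hK c
  obtain ⟨d, hd⟩ := hg
  obtain ⟨m, hm⟩ := hK.bddBelow
  obtain ⟨C, hC⟩ := hd m
  obtain ⟨D, hD⟩ := hG K hK (c + d)
  refine ⟨D * C, fun s hs x hx => ?_⟩
  have h1 := hD s hs x hx
  have h2 := hC x ((hm hs).trans hx)
  rw [abs_mul]
  calc |G s x| * |g x| ≤ (D * Real.exp (-((c + d) * x))) * (C * Real.exp (d * x)) :=
        mul_le_mul h1 h2 (abs_nonneg _) ((abs_nonneg _).trans h1)
    _ = D * C * (Real.exp (-((c + d) * x)) * Real.exp (d * x)) := by ring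
    _ = _ := by rw [← Real.exp_add]; ring_nf

lemma KernelDecay.add {G H : ℝ → ℝ → ℝ} (hG : KernelDecay G) (hH : KernelDecay H) :
    KernelDecay fun s x => G s x + H s x := by
  intro K hK c
  obtain ⟨C, hC⟩ := hG K hK c
  obtain ⟨D, hD⟩ := hH K hK c
  refine ⟨C + D, fun s hs x hx => (abs_add_le _ _).trans ?_⟩
  rw [add_mul]
  exact add_le_add (hC s hs x hx) (hD s hs x hx)

lemma KernelDecay₂.add {G H : ℝ → ℝ × ℝ → ℝ} (hG : KernelDecay₂ G) (hH : KernelDecay₂ H) :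
    KernelDecay₂ fun s z => G s z + H s z := by
  intro K hK c
  obtain ⟨C, hC⟩ := hG K hK c
  obtain ⟨D, hD⟩ := hH K hK c
  refine ⟨C + D, fun s hs z h1 h2 => (abs_add_le _ _).trans ?_⟩
  rw [add_mul]
  exact add_le_add (hC s hs z h1 h2) (hD s hs z h1 h2)

lemma KernelDecay₂.mul {G : ℝ → ℝ × ℝ → ℝ} {g h : ℝ → ℝ} (hG : KernelDecay₂ G)
    (hg : ExpBounded g) (hh : ExpBounded h) :
    KernelDecay₂ fun s z => G s z * g z.1 * h z.2 := by
  intro K hK c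
  obtain ⟨d, hd⟩ := hg
  obtain ⟨e, he⟩ := hh
  obtain ⟨m, hm⟩ := hK.bddBelow
  obtain ⟨C, hC⟩ := hd m
  obtain ⟨C', hC'⟩ := he m
  obtain ⟨D, hD⟩ := hG K hK (c + |d| + |e|)
  set M := Real.exp (3 * (|d| + |e|) * |m|)
  have key : ∀ z : ℝ × ℝ, m ≤ z.1 → m ≤ z.2 →
      -((c + |d| + |e|) * (z.1 + z.2)) + d * z.1 + e * z.2
        ≤ 3 * (|d| + |e|) * |m| + -(c * (z.1 + z.2)) := by
    intro z h1 h2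
    have := neg_abs_le m
    have a1 : (d - |d|) * (z.1 + |m|) ≤ 0 :=
      mul_nonpos_of_nonpos_of_nonneg (by linarith [le_abs_self d]) (by linarith)
    have a2 : (e - |e|) * (z.2 + |m|) ≤ 0 :=
      mul_nonpos_of_nonpos_of_nonneg (by linarith [le_abs_self e]) (by linarith)
    have a3 : 0 ≤ |e| * (z.1 + |m|) := mul_nonneg (abs_nonneg _) (by linarith)
    have a4 : 0 ≤ |d| * (z.2 + |m|) := mul_nonneg (abs_nonneg _) (by linarith)
    have a5 : 0 ≤ (|d| + d) * |m| := mul_nonneg (by linarith [neg_abs_le d]) (abs_nonneg _)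
    have a6 : 0 ≤ (|e| + e) * |m| := mul_nonneg (by linarith [neg_abs_le e]) (abs_nonneg _)
    nlinarith
  refine ⟨D * C * C' * M, fun s hs z h1 h2 => ?_⟩
  have k1 := hD s hs z h1 h2
  have k2 := hC _ ((hm hs).trans h1)
  have k3 := hC' _ ((hm hs).trans h2)
  rw [abs_mul, abs_mul]
  have hpos : 0 ≤ D * C * C' := by
    have e1 : 0 ≤ D := nonneg_of_mul_nonneg_left ((abs_nonneg _).trans k1) (Real.exp_pos _)
    have e2 : 0 ≤ C := nonneg_of_mul_nonneg_left ((abs_nonneg _).trans k2) (Real.exp_pos _)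
    have e3 : 0 ≤ C' := nonneg_of_mul_nonneg_left ((abs_nonneg _).trans k3) (Real.exp_pos _)
    positivity
  calc |G s z| * |g z.1| * |h z.2| ≤ (D * Real.exp (-((c + |d| + |e|) * (z.1 + z.2)))) *
        (C * Real.exp (d * z.1)) * (C' * Real.exp (e * z.2)) :=
        mul_le_mul (mul_le_mul k1 k2 (abs_nonneg _) ((abs_nonneg _).trans k1)) k3 (abs_nonneg _)
          (mul_nonneg ((abs_nonneg _).trans k1) ((abs_nonneg _).trans k2))
    _ = D * C * C' * (Real.exp (-((c + |d| + |e|) * (z.1 + z.2)) + d * z.1 + e * z.2)) := by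
        rw [Real.exp_add, Real.exp_add]; ring
    _ ≤ D * C * C' * (Real.exp (3 * (|d| + |e|) * |m| + -(c * (z.1 + z.2)))) := by
        refine mul_le_mul_of_nonneg_left (Real.exp_le_exp.2 ?_) hpos
        exact key z ((hm hs).trans h1) ((hm hs).trans h2)
    _ = _ := by rw [Real.exp_add]; ring

lemma KernelDecay₂.diag {G : ℝ → ℝ × ℝ → ℝ} (hG : KernelDecay₂ G) :
    KernelDecay fun s x => G s (s, x) := by
  intro K hK c
  obtain ⟨C, hC⟩ := hG K hK c
  obtain ⟨D, hD⟩ := hK.exists_bound_of_continuousOn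
    (f := fun s : ℝ => Real.exp (-(c * s))) (by fun_prop)
  refine ⟨C * D, fun s hs x hx => ?_⟩
  have h := hC s hs (s, x) le_rfl hx
  have hC0 : 0 ≤ C := nonneg_of_mul_nonneg_left ((abs_nonneg _).trans h) (Real.exp_pos _)
  have h2 := hD s hs
  rw [Real.norm_eq_abs, abs_of_pos (Real.exp_pos _)] at h2
  calc |G s (s, x)| ≤ C * Real.exp (-(c * (s + x))) := h
    _ = C * (Real.exp (-(c * s)) * Real.exp (-(c * x))) := by
        rw [← Real.exp_add]; ring_nf
    _ ≤ C * (D * Real.exp (-(c * x))) := by gcongr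
    _ = _ := by ring

/-- Decay in one variable of a two-variable kernel, the other variable being frozen. -/
lemma KernelDecay₂.left {G : ℝ → ℝ × ℝ → ℝ} (hG : KernelDecay₂ G) {s y : ℝ} (hy : s ≤ y) (c : ℝ) :
    ∃ C : ℝ, ∀ x, s ≤ x → |G s (x, y)| ≤ C * Real.exp (-(c * x)) := by
  obtain ⟨C, hC⟩ := hG {s} isCompact_singleton c
  refine ⟨C * Real.exp (-(c * y)), fun x hx => (hC s rfl (x, y) hx hy).trans_eq ?_⟩
  rw [mul_assoc, ← Real.exp_add]; ring_nf

lemma integrableOn_of_exp_bound {f : ℝ → ℝ} {s C c : ℝ} (hc : 0 < c) (hf : Continuous f)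
    (h : ∀ x, s ≤ x → |f x| ≤ C * Real.exp (-(c * x))) : IntegrableOn f (Ioi s) := by
  have h1 : IntegrableOn (fun x : ℝ => C * Real.exp (-(c * x))) (Ioi s) := by
    simpa [IntegrableOn] using (exp_neg_integrableOn_Ioi s hc).const_mul C
  refine h1.mono' hf.aestronglyMeasurable ?_
  filter_upwards [ae_restrict_mem measurableSet_Ioi] with x hx
  exact h x (le_of_lt hx)

lemma tendsto_zero_of_exp_bound {f : ℝ → ℝ} {s C c : ℝ} (hc : 0 < c)
    (h : ∀ x, s ≤ x → |f x| ≤ C * Real.exp (-(c * x))) : Tendsto f atTop (𝓝 0) := by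
  have h1 : Tendsto (fun x : ℝ => C * Real.exp (-(c * x))) atTop (𝓝 0) := by
    have : Tendsto (fun x : ℝ => Real.exp (-(c * x))) atTop (𝓝 0) :=
      Real.tendsto_exp_neg_atTop_nhds_zero.comp (tendsto_id.const_mul_atTop hc)
    simpa using this.const_mul C
  refine squeeze_zero_norm' ?_ h1
  filter_upwards [eventually_ge_atTop s] with x hx using h x hx

lemma KernelDecay.integrableOn {G : ℝ → ℝ → ℝ} (hG : KernelDecay G) {s : ℝ}
    (hc : Continuous (G s)) : IntegrableOn (G s) (Ioi s) := by
  obtain ⟨C, hC⟩ := hG {s} isCompact_singleton 1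
  exact integrableOn_of_exp_bound one_pos hc (hC s rfl)

lemma integrableOn_prod_exp (s C : ℝ) :
    IntegrableOn (fun z : ℝ × ℝ => C * Real.exp (-(1 * (z.1 + z.2)))) (Ioi s ×ˢ Ioi s) := by
  have h1 : IntegrableOn (fun x : ℝ => Real.exp (-1 * x)) (Ioi s) :=
    exp_neg_integrableOn_Ioi s one_pos
  rw [IntegrableOn, Measure.volume_eq_prod, ← Measure.prod_restrict]
  refine ((h1.mul_prod h1).const_mul C).congr (Eventually.of_forall fun z => ?_)
  simp only [← Real.exp_add]
  ring_nf

lemma KernelDecay₂.integrableOn {G : ℝ → ℝ × ℝ → ℝ} (hG : KernelDecay₂ G) {s : ℝ}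
    (hc : Continuous (G s)) {m : ℝ} (hm : s ≤ m) : IntegrableOn (G s) (Ioi m ×ˢ Ioi m) := by
  obtain ⟨C, hC⟩ := hG {s} isCompact_singleton 1
  refine (integrableOn_prod_exp m C).mono' hc.aestronglyMeasurable ?_
  filter_upwards [ae_restrict_mem (measurableSet_Ioi.prod measurableSet_Ioi)] with z hz
  exact hC s rfl z (hm.trans hz.1.le) (hm.trans hz.2.le)

lemma hasDerivAt_setIntegral_Ioi {H H' : ℝ → ℝ → ℝ} (hH : KernelDecay H) (hH' : KernelDecay H')
    (hc : ∀ s, Continuous (H s)) (hc' : ∀ s, Continuous (H' s))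
    (hd : ∀ s d, 0 ≤ d → HasDerivAt (fun t => H t (d + t)) (H' s (d + s)) s) (s : ℝ) :
    HasDerivAt (fun t => ∫ x in Ioi t, H t x) (∫ x in Ioi s, H' s x) s := by
  have shift : ∀ (f : ℝ → ℝ) (t : ℝ), ∫ x in Ioi (0 : ℝ), f (x + t) = ∫ x in Ioi t, f x := by
    intro f t
    have := (measurePreserving_add_right (volume : Measure ℝ) t).setIntegral_preimage_emb
      (measurableEmbedding_addRight t) f (Ioi t)
    simpa using this
  rw [funext fun t => (shift (H t) t).symm, ← shift (H' s) s]
  obtain ⟨C, hC⟩ := hH' (Icc (s - 1) (s + 1)) isCompact_Icc 1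
  refine (hasDerivAt_integral_of_dominated_loc_of_deriv_le (μ := volume.restrict (Ioi (0 : ℝ)))
    (F := fun t x => H t (x + t)) (F' := fun t x => H' t (x + t))
    (bound := fun x => |C| * Real.exp (1 - s) * Real.exp (-1 * x))
    (Icc_mem_nhds (a := s - 1) (b := s + 1) (by linarith) (by linarith))
    (Eventually.of_forall fun t => ((hc t).comp (by fun_prop)).aestronglyMeasurable) ?_
    ((hc' s).comp (by fun_prop)).aestronglyMeasurable ?_
    ((exp_neg_integrableOn_Ioi 0 one_pos).const_mul _) ?_).2
  · have := hH.integrableOn (hc s)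
    rw [← (measurePreserving_add_right (volume : Measure ℝ) s).integrableOn_comp_preimage
      (measurableEmbedding_addRight s)] at this
    simpa [IntegrableOn, Function.comp_def] using this
  · filter_upwards [ae_restrict_mem measurableSet_Ioi] with x hx t ht
    have hx' : (0 : ℝ) < x := hx
    refine (hC t ht (x + t) (by linarith)).trans ?_
    rw [mul_assoc, ← Real.exp_add]
    gcongr
    · exact le_abs_self C
    · linarith [ht.1]
  · filter_upwards [ae_restrict_mem measurableSet_Ioi] with x hx t _
    exact hd t x (le_of_lt hx)

lemma hasDerivAt_setIntegral_Ioi_prod {H H' : ℝ → ℝ × ℝ → ℝ} (hH : KernelDecay₂ H)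
    (hH' : KernelDecay₂ H') (hc : ∀ s, Continuous (H s)) (hc' : ∀ s, Continuous (H' s))
    (hd : ∀ (s : ℝ) (d : ℝ × ℝ), 0 ≤ d.1 → 0 ≤ d.2 →
      HasDerivAt (fun t => H t (d + (t, t))) (H' s (d + (s, s))) s) (s : ℝ) :
    HasDerivAt (fun t => ∫ z in Ioi t ×ˢ Ioi t, H t z) (∫ z in Ioi s ×ˢ Ioi s, H' s z) s := by
  have pre : ∀ t : ℝ, (fun z : ℝ × ℝ => z + (t, t)) ⁻¹' (Ioi t ×ˢ Ioi t) = Ioi 0 ×ˢ Ioi 0 := by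
    intro t; ext z; simp
  have shift : ∀ (f : ℝ × ℝ → ℝ) (t : ℝ),
      ∫ z in Ioi (0 : ℝ) ×ˢ Ioi (0 : ℝ), f (z + (t, t)) = ∫ z in Ioi t ×ˢ Ioi t, f z := by
    intro f t
    have := (measurePreserving_add_right (volume : Measure (ℝ × ℝ)) (t, t)).setIntegral_preimage_emb
      (measurableEmbedding_addRight (t, t)) f (Ioi t ×ˢ Ioi t)
    rwa [pre] at this
  rw [funext fun t => (shift (H t) t).symm, ← shift (H' s) s]
  obtain ⟨C, hC⟩ := hH' (Icc (s - 1) (s + 1)) isCompact_Icc 1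
  refine (hasDerivAt_integral_of_dominated_loc_of_deriv_le
    (μ := volume.restrict (Ioi (0 : ℝ) ×ˢ Ioi (0 : ℝ)))
    (F := fun t z => H t (z + (t, t))) (F' := fun t z => H' t (z + (t, t)))
    (bound := fun z => |C| * Real.exp (2 - 2 * s) * Real.exp (-(1 * (z.1 + z.2))))
    (Icc_mem_nhds (a := s - 1) (b := s + 1) (by linarith) (by linarith))
    (Eventually.of_forall fun t => ((hc t).comp (by fun_prop)).aestronglyMeasurable) ?_
    ((hc' s).comp (by fun_prop)).aestronglyMeasurable ?_
    (integrableOn_prod_exp 0 _) ?_).2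
  · have := hH.integrableOn (hc s) le_rfl
    rw [← (measurePreserving_add_right (volume : Measure (ℝ × ℝ)) (s, s)).integrableOn_comp_preimage
      (measurableEmbedding_addRight (s, s)), pre] at this
    exact this
  · filter_upwards [ae_restrict_mem (measurableSet_Ioi.prod measurableSet_Ioi)] with z hz t ht
    have h1 : (0 : ℝ) < z.1 := hz.1
    have h2 : (0 : ℝ) < z.2 := hz.2
    refine (hC t ht (z + (t, t)) (by simp [h1.le]) (by simp [h2.le])).trans ?_
    rw [mul_assoc, ← Real.exp_add]
    gcongr
    · exact le_abs_self C
    · simp only [Prod.fst_add, Prod.snd_add]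
      linarith [ht.1]
  · filter_upwards [ae_restrict_mem (measurableSet_Ioi.prod measurableSet_Ioi)] with z hz t _
    exact hd t z (le_of_lt hz.1) (le_of_lt hz.2)

lemma ExpBounded.exists_bound {g : ℝ → ℝ} {c d m : ℝ} (hcd : c ≤ d)
    (h : ∃ C, ∀ y, m ≤ y → |g y| ≤ C * Real.exp (c * y)) :
    ∃ C, ∀ y, m ≤ y → |g y| ≤ C * Real.exp (d * y) := by
  obtain ⟨C, hC⟩ := h
  refine ⟨C * Real.exp ((d - c) * |m|), fun y hy => (hC y hy).trans ?_⟩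
  have hC0 : 0 ≤ C := nonneg_of_mul_nonneg_left ((abs_nonneg _).trans (hC y hy)) (Real.exp_pos _)
  rw [mul_assoc, ← Real.exp_add]
  refine mul_le_mul_of_nonneg_left (Real.exp_le_exp.2 ?_) hC0
  nlinarith [mul_nonneg (sub_nonneg.2 hcd) (by linarith [neg_abs_le m] : 0 ≤ |m| + y)]

lemma ExpBounded.sub_const_mul {g h : ℝ → ℝ} (hg : ExpBounded g) (hh : ExpBounded h) (w : ℝ) :
    ExpBounded fun y => g y - w * h y := by
  obtain ⟨c, hc⟩ := hg
  obtain ⟨d, hd⟩ := hh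
  refine ⟨max c d, fun m => ?_⟩
  obtain ⟨C, hC⟩ := ExpBounded.exists_bound (le_max_left c d) (hc m)
  obtain ⟨D, hD⟩ := ExpBounded.exists_bound (le_max_right c d) (hd m)
  refine ⟨C + |w| * D, fun y hy => (abs_sub _ _).trans ?_⟩
  rw [abs_mul, add_mul, mul_assoc]
  exact add_le_add (hC y hy) (mul_le_mul_of_nonneg_left (hD y hy) (abs_nonneg w))

lemma expBounded_of_abs {g : ℝ → ℝ} {C c : ℝ} (h : ∀ y, |g y| ≤ C * Real.exp (c * |y|)) :
    ExpBounded g := by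
  refine ⟨|c|, fun m => ⟨C * Real.exp (2 * |c| * |m|), fun y hy => (h y).trans ?_⟩⟩
  have hC0 : 0 ≤ C := nonneg_of_mul_nonneg_left ((abs_nonneg _).trans (h y)) (Real.exp_pos _)
  rw [mul_assoc, ← Real.exp_add]
  refine mul_le_mul_of_nonneg_left (Real.exp_le_exp.2 ?_) hC0
  have h1 : c * |y| ≤ |c| * |y| := mul_le_mul_of_nonneg_right (le_abs_self c) (abs_nonneg y)
  have h2 : |y| ≤ 2 * |m| + y := by
    rcases abs_cases y with ⟨e, _⟩ | ⟨e, _⟩ <;> rw [e] <;>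
      linarith [neg_abs_le m, abs_nonneg m]
  nlinarith [mul_le_mul_of_nonneg_left h2 (abs_nonneg c)]

lemma setIntegral_Ioi_deriv_of_decay {f f' : ℝ → ℝ} {s C D : ℝ}
    (hd : ∀ x, HasDerivAt f (f' x) x) (hc : Continuous f')
    (hf : ∀ x, s ≤ x → |f x| ≤ C * Real.exp (-(1 * x)))
    (hf' : ∀ x, s ≤ x → |f' x| ≤ D * Real.exp (-(1 * x))) :
    ∫ x in Ioi s, f' x = -f s := by
  rw [integral_Ioi_of_hasDerivAt_of_tendsto' (fun x _ => hd x)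
    (integrableOn_of_exp_bound one_pos hc hf') (tendsto_zero_of_exp_bound one_pos hf), zero_sub]

/-- A function with its derivative, both of at most exponential growth, the derivative being
continuous. -/
structure Tame (g g' : ℝ → ℝ) : Prop where
  hasDerivAt : ∀ x, HasDerivAt g (g' x) x
  continuous_deriv : Continuous g'
  bound : ExpBounded g
  bound_deriv : ExpBounded g'

lemma Tame.continuous {g g' : ℝ → ℝ} (h : Tame g g') : Continuous g :=
  continuous_iff_continuousAt.2 fun x => (h.hasDerivAt x).continuousAt

/-- The directional derivative of a kernel `R s x y`. -/
abbrev kernelDeriv (R : ℝ → ℝ → ℝ → ℝ) (v : ℝ × ℝ × ℝ) (s : ℝ) (z : ℝ × ℝ) : ℝ :=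
  fderiv ℝ (fun pr : ℝ × ℝ × ℝ => R pr.1 pr.2.1 pr.2.2) (s, z) v

/-- A smooth symmetric kernel decaying superexponentially together with its gradient. -/
structure NiceKernel (R : ℝ → ℝ → ℝ → ℝ) : Prop where
  smooth : ContDiff ℝ (⊤ : ℕ∞) (fun pr : ℝ × ℝ × ℝ => R pr.1 pr.2.1 pr.2.2)
  decay : KernelDecay₂ fun s z => R s z.1 z.2
  decay_deriv : ∀ v, KernelDecay₂ (kernelDeriv R v)
  symm : ∀ s x y, s ≤ x → s ≤ y → R s x y = R s y x

namespace NiceKernel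

variable {R : ℝ → ℝ → ℝ → ℝ}

lemma continuous (hR : NiceKernel R) : Continuous fun pr : ℝ × ℝ × ℝ => R pr.1 pr.2.1 pr.2.2 :=
  hR.smooth.continuous

lemma continuous_comp (hR : NiceKernel R) {E : Type*} [TopologicalSpace E] {f g h : E → ℝ}
    (hf : Continuous f) (hg : Continuous g) (hh : Continuous h) :
    Continuous fun e => R (f e) (g e) (h e) :=
  hR.continuous.comp (hf.prodMk (hg.prodMk hh))

lemma continuous_deriv (hR : NiceKernel R) (v : ℝ × ℝ × ℝ) {E : Type*} [TopologicalSpace E]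
    {f : E → ℝ} {g : E → ℝ × ℝ} (hf : Continuous f) (hg : Continuous g) :
    Continuous fun e => kernelDeriv R v (f e) (g e) :=
  ((hR.smooth.continuous_fderiv (by simp)).comp (hf.prodMk hg)).clm_apply continuous_const

lemma hasDerivAt_comp (hR : NiceKernel R) {γ : ℝ → ℝ × ℝ × ℝ} {v : ℝ × ℝ × ℝ} {t : ℝ}
    (hγ : HasDerivAt γ v t) :
    HasDerivAt (fun t => R (γ t).1 (γ t).2.1 (γ t).2.2) (kernelDeriv R v (γ t).1 (γ t).2) t :=
  ((hR.smooth.differentiable (by simp) (γ t)).hasFDerivAt).comp_hasDerivAt t hγ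

lemma hasDerivAt_fst (hR : NiceKernel R) (s x y : ℝ) :
    HasDerivAt (fun t => R t x y) (kernelDeriv R (1, 0, 0) s (x, y)) s :=
  hR.hasDerivAt_comp (γ := fun t => (t, x, y))
    ((hasDerivAt_id s).prodMk ((hasDerivAt_const s x).prodMk (hasDerivAt_const s y)))

lemma hasDerivAt_snd (hR : NiceKernel R) (s x y : ℝ) :
    HasDerivAt (fun t => R s t y) (kernelDeriv R (0, 1, 0) s (x, y)) x :=
  hR.hasDerivAt_comp (γ := fun t => (s, t, y))
    ((hasDerivAt_const x s).prodMk ((hasDerivAt_id x).prodMk (hasDerivAt_const x y)))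

lemma hasDerivAt_trd (hR : NiceKernel R) (s x y : ℝ) :
    HasDerivAt (fun t => R s x t) (kernelDeriv R (0, 0, 1) s (x, y)) y :=
  hR.hasDerivAt_comp (γ := fun t => (s, x, t))
    ((hasDerivAt_const y s).prodMk ((hasDerivAt_const y x).prodMk (hasDerivAt_id y)))

lemma hasDerivAt_shift (hR : NiceKernel R) (s x y : ℝ) :
    HasDerivAt (fun t => R t (x + t) (y + t)) (kernelDeriv R (1, 1, 1) s (x + s, y + s)) s :=
  hR.hasDerivAt_comp (γ := fun t => (t, x + t, y + t))
    ((hasDerivAt_id s).prodMk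
      (((hasDerivAt_id s).const_add x).prodMk ((hasDerivAt_id s).const_add y)))

lemma deriv_shift (s : ℝ) (z : ℝ × ℝ) :
    kernelDeriv R (1, 1, 1) s z = kernelDeriv R (1, 0, 0) s z + kernelDeriv R (0, 1, 0) s z
      + kernelDeriv R (0, 0, 1) s z := by
  rw [← map_add, ← map_add]
  simp

/-- Leibniz rule for `∫_s^∞ R(s;s,y) g(y) dy`. -/
lemma hasDerivAt_integral_diag (hR : NiceKernel R) {g g' : ℝ → ℝ} (hg : Tame g g') (s : ℝ) :
    HasDerivAt (fun t => ∫ y in Ioi t, R t t y * g y)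
      (∫ y in Ioi s, (kernelDeriv R (1, 1, 1) s (s, y) * g y + R s s y * g' y)) s := by
  refine hasDerivAt_setIntegral_Ioi (H := fun t y => R t t y * g y)
    (H' := fun t y => kernelDeriv R (1, 1, 1) t (t, y) * g y + R t t y * g' y)
    (hR.decay.diag.mul hg.bound)
    (((hR.decay_deriv _).diag.mul hg.bound).add (hR.decay.diag.mul hg.bound_deriv))
    (fun t => ?_) (fun t => ?_) (fun t d _ => ?_) s
  · exact (hR.continuous_comp continuous_const continuous_const continuous_id).mul hg.continuous
  · exact ((hR.continuous_deriv _ continuous_const (by fun_prop)).mul hg.continuous).add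
      ((hR.continuous_comp continuous_const continuous_const continuous_id).mul hg.continuous_deriv)
  · have h1 := hR.hasDerivAt_shift t 0 d
    simp only [zero_add] at h1
    exact h1.mul ((hg.hasDerivAt (d + t)).comp_const_add d t)

/-- The double integral of `R` against two functions, as an integral over a product. -/
lemma integral_prod_eq (hR : NiceKernel R) {g g' h h' : ℝ → ℝ} (hg : Tame g g') (hh : Tame h h')
    (s : ℝ) :
    ∫ z in Ioi s ×ˢ Ioi s, R s z.1 z.2 * g z.1 * h z.2
      = ∫ x in Ioi s, ∫ y in Ioi s, R s x y * g x * h y := by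
  refine setIntegral_prod _ ((hR.decay.mul hg.bound hh.bound).integrableOn ?_ le_rfl)
  exact ((hR.continuous_comp continuous_const continuous_fst continuous_snd).mul
    (hg.continuous.comp continuous_fst)).mul (hh.continuous.comp continuous_snd)

lemma integral_swap (hR : NiceKernel R) {s : ℝ} (f : ℝ → ℝ) :
    ∫ x in Ioi s, R s x s * f x = ∫ x in Ioi s, R s s x * f x :=
  setIntegral_congr_fun measurableSet_Ioi fun x hx => by
    simp only [hR.symm s x s (le_of_lt hx) le_rfl]

lemma hasDerivAt_integral_prod (hR : NiceKernel R)
    (hRs : ∀ s x y, s < x → s < y → HasDerivAt (fun s' => R s' x y) (-(R s x s * R s s y)) s)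
    {g g' h h' : ℝ → ℝ} (hg : Tame g g') (hh : Tame h h') (s : ℝ) :
    HasDerivAt (fun t => ∫ z in Ioi t ×ˢ Ioi t, R t z.1 z.2 * g z.1 * h z.2)
      (g s * h s - (g s + ∫ y in Ioi s, R s s y * g y) * (h s + ∫ y in Ioi s, R s s y * h y)) s := by
  have hg1 := hg.continuous
  have hg2 := hg.continuous_deriv
  have hh1 := hh.continuous
  have hh2 := hh.continuous_deriv
  have cR : ∀ t, Continuous fun z : ℝ × ℝ => R t z.1 z.2 := fun t =>
    hR.continuous_comp continuous_const continuous_fst continuous_snd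
  have cD : ∀ v t, Continuous fun z : ℝ × ℝ => kernelDeriv R v t z := fun v t =>
    hR.continuous_deriv v continuous_const continuous_id
  have key := hasDerivAt_setIntegral_Ioi_prod (H := fun t z => R t z.1 z.2 * g z.1 * h z.2)
    (H' := fun t z => kernelDeriv R (1, 1, 1) t z * g z.1 * h z.2
      + (R t z.1 z.2 * g' z.1 * h z.2 + R t z.1 z.2 * g z.1 * h' z.2))
    (hR.decay.mul hg.bound hh.bound)
    (((hR.decay_deriv _).mul hg.bound hh.bound).add
      ((hR.decay.mul hg.bound_deriv hh.bound).add (hR.decay.mul hg.bound hh.bound_deriv)))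
    (fun t => by have := cR t; fun_prop) (fun t => by have := cR t; have := cD (1, 1, 1) t; fun_prop)
    (fun t d _ _ => by
      have h1 := hR.hasDerivAt_shift t d.1 d.2
      have h2 := (hg.hasDerivAt (d.1 + t)).comp_const_add d.1 t
      have h3 := (hh.hasDerivAt (d.2 + t)).comp_const_add d.2 t
      refine ((h1.mul h2).mul h3).congr_deriv ?_
      rw [show d + (t, t) = (d.1 + t, d.2 + t) from rfl]
      simp only [Pi.mul_apply]
      ring) s
  refine key.congr_deriv ?_
  have i1 := ((hR.decay_deriv (1, 0, 0)).mul hg.bound hh.bound).integrableOn (s := s)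
    (by have := cD (1, 0, 0) s; fun_prop) le_rfl
  have i2 := (((hR.decay_deriv (0, 1, 0)).mul hg.bound hh.bound).add
    (hR.decay.mul hg.bound_deriv hh.bound)).integrableOn (s := s)
    (by have := cD (0, 1, 0) s; have := cR s; fun_prop) le_rfl
  have i3 := (((hR.decay_deriv (0, 0, 1)).mul hg.bound hh.bound).add
    (hR.decay.mul hg.bound hh.bound_deriv)).integrableOn (s := s)
    (by have := cD (0, 0, 1) s; have := cR s; fun_prop) le_rfl
  have e1 : ∫ z in Ioi s ×ˢ Ioi s, kernelDeriv R (1, 0, 0) s z * g z.1 * h z.2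
      = -((∫ y in Ioi s, R s s y * g y) * ∫ y in Ioi s, R s s y * h y) := by
    rw [← hR.integral_swap g, ← setIntegral_prod_mul, ← integral_neg]
    refine setIntegral_congr_fun (measurableSet_Ioi.prod measurableSet_Ioi) fun z hz => ?_
    have := (hR.hasDerivAt_fst s z.1 z.2).unique (hRs s z.1 z.2 hz.1 hz.2)
    simp only [show kernelDeriv R (1, 0, 0) s z = _ from this]
    ring
  have e2 : ∫ z in Ioi s ×ˢ Ioi s, (kernelDeriv R (0, 1, 0) s z * g z.1 * h z.2
      + R s z.1 z.2 * g' z.1 * h z.2) = -(g s * ∫ y in Ioi s, R s s y * h y) := by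
    rw [← integral_const_mul, ← integral_neg]
    have := i2
    rw [IntegrableOn, Measure.volume_eq_prod, ← Measure.prod_restrict] at this
    rw [Measure.volume_eq_prod, ← Measure.prod_restrict, integral_prod_symm _ this]
    refine setIntegral_congr_fun measurableSet_Ioi fun y hy => ?_
    have hy' : s ≤ y := le_of_lt hy
    obtain ⟨C, hC⟩ := (hR.decay.mul hg.bound hh.bound).left hy' 1
    obtain ⟨D, hD⟩ := (((hR.decay_deriv (0, 1, 0)).mul hg.bound hh.bound).add
      (hR.decay.mul hg.bound_deriv hh.bound)).left hy' 1
    have := setIntegral_Ioi_deriv_of_decay (f := fun x => R s x y * g x * h y)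
      (f' := fun x => kernelDeriv R (0, 1, 0) s (x, y) * g x * h y + R s x y * g' x * h y)
      (fun x => (((hR.hasDerivAt_snd s x y).mul (hg.hasDerivAt x)).mul_const (h y)).congr_deriv
        (by ring))
      (by
        have c1 : Continuous fun x => kernelDeriv R (0, 1, 0) s (x, y) :=
          hR.continuous_deriv _ continuous_const (by fun_prop)
        have c2 : Continuous fun x => R s x y :=
          hR.continuous_comp continuous_const continuous_id continuous_const
        fun_prop) hC hD
    simp only [this]
    ring
  have e3 : ∫ z in Ioi s ×ˢ Ioi s, (kernelDeriv R (0, 0, 1) s z * g z.1 * h z.2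
      + R s z.1 z.2 * g z.1 * h' z.2) = -(h s * ∫ y in Ioi s, R s s y * g y) := by
    rw [← integral_const_mul, ← integral_neg]
    rw [Measure.volume_eq_prod, setIntegral_prod _ i3]
    refine setIntegral_congr_fun measurableSet_Ioi fun x hx => ?_
    have hx' : s ≤ x := le_of_lt hx
    obtain ⟨C, hC⟩ := (hR.decay.mul hg.bound hh.bound) {s} isCompact_singleton 1
    obtain ⟨D, hD⟩ := (((hR.decay_deriv (0, 0, 1)).mul hg.bound hh.bound).add
      (hR.decay.mul hg.bound hh.bound_deriv)) {s} isCompact_singleton 1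
    have split : ∀ y, Real.exp (-(1 * (x + y))) = Real.exp (-x) * Real.exp (-(1 * y)) := by
      intro y; rw [← Real.exp_add]; ring_nf
    have := setIntegral_Ioi_deriv_of_decay (s := s) (f := fun y => R s x y * g x * h y)
      (f' := fun y => kernelDeriv R (0, 0, 1) s (x, y) * g x * h y + R s x y * g x * h' y)
      (C := C * Real.exp (-x)) (D := D * Real.exp (-x))
      (fun y => (((hR.hasDerivAt_trd s x y).mul_const (g x)).mul (hh.hasDerivAt y)).congr_deriv
        (by ring))
      (by
        have c1 : Continuous fun y => kernelDeriv R (0, 0, 1) s (x, y) :=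
          hR.continuous_deriv _ continuous_const (by fun_prop)
        have c2 : Continuous fun y => R s x y :=
          hR.continuous_comp continuous_const continuous_const continuous_id
        fun_prop)
      (fun y hy => by rw [mul_assoc C, ← split]; exact hC s rfl (x, y) hx' hy)
      (fun y hy => by rw [mul_assoc D, ← split]; exact hD s rfl (x, y) hx' hy)
    simp only [this, hR.symm s x s hx' le_rfl]
    ring
  have total : ∫ z in Ioi s ×ˢ Ioi s, (kernelDeriv R (1, 1, 1) s z * g z.1 * h z.2
      + (R s z.1 z.2 * g' z.1 * h z.2 + R s z.1 z.2 * g z.1 * h' z.2))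
      = (∫ z in Ioi s ×ˢ Ioi s, kernelDeriv R (1, 0, 0) s z * g z.1 * h z.2)
      + (∫ z in Ioi s ×ˢ Ioi s, (kernelDeriv R (0, 1, 0) s z * g z.1 * h z.2
      + R s z.1 z.2 * g' z.1 * h z.2))
      + ∫ z in Ioi s ×ˢ Ioi s, (kernelDeriv R (0, 0, 1) s z * g z.1 * h z.2
      + R s z.1 z.2 * g z.1 * h' z.2) := by
    have i12 := integral_add (i1.add i2) i3
    simp only [Pi.add_apply] at i12
    rw [← integral_add i1 i2, ← i12]
    refine integral_congr_ae (Eventually.of_forall fun z => ?_)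
    simp only [deriv_shift]
    ring
  rw [total, e1, e2, e3]
  ring

lemma integral_prod_le (hR : NiceKernel R)
    (hRs : ∀ s x y, s < x → s < y → HasDerivAt (fun s' => R s' x y) (-(R s x s * R s s y)) s)
    {g g' : ℝ → ℝ} (hg : Tame g g') {s M : ℝ} (hsM : s ≤ M) :
    ∫ z in Ioi M ×ˢ Ioi M, R M z.1 z.2 * g z.1 * g z.2
      ≤ ∫ z in Ioi M ×ˢ Ioi M, R s z.1 z.2 * g z.1 * g z.2 := by
  have hg1 := hg.continuous
  have cR : ∀ t, Continuous fun z : ℝ × ℝ => R t z.1 z.2 := fun t =>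
    hR.continuous_comp continuous_const continuous_fst continuous_snd
  have cD : ∀ v t, Continuous fun z : ℝ × ℝ => kernelDeriv R v t z := fun v t =>
    hR.continuous_deriv v continuous_const continuous_id
  have hH := hR.decay.mul hg.bound hg.bound
  have hH' := (hR.decay_deriv (1, 0, 0)).mul hg.bound hg.bound
  have mS : MeasurableSet (Ioi M ×ˢ Ioi M) := measurableSet_Ioi.prod measurableSet_Ioi
  have hder : ∀ t ∈ Ioo s M,
      HasDerivAt (fun t => ∫ z in Ioi M ×ˢ Ioi M, R t z.1 z.2 * g z.1 * g z.2)
        (-(∫ y in Ioi M, R t t y * g y) ^ 2) t := by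
    intro t ht
    obtain ⟨C, hC⟩ := hH' (Icc s M) isCompact_Icc 1
    have := (hasDerivAt_integral_of_dominated_loc_of_deriv_le
      (μ := volume.restrict (Ioi M ×ˢ Ioi M))
      (F := fun t z => R t z.1 z.2 * g z.1 * g z.2)
      (F' := fun t z => kernelDeriv R (1, 0, 0) t z * g z.1 * g z.2)
      (Icc_mem_nhds ht.1 ht.2)
      (Eventually.of_forall fun t => Continuous.aestronglyMeasurable
        (by have := cR t; fun_prop))
      (hH.integrableOn (by have := cR t; fun_prop) ht.2.le)
      (Continuous.aestronglyMeasurable (by have := cD (1, 0, 0) t; fun_prop))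
      (by
        filter_upwards [ae_restrict_mem mS] with z hz r hr
        exact hC r hr z (hr.2.trans hz.1.le) (hr.2.trans hz.2.le))
      (integrableOn_prod_exp M C)
      (by
        filter_upwards with z r _
        exact ((hR.hasDerivAt_fst r z.1 z.2).mul_const _).mul_const _)).2
    refine this.congr_deriv ?_
    have e : ∫ y in Ioi M, R t y t * g y = ∫ y in Ioi M, R t t y * g y :=
      setIntegral_congr_fun measurableSet_Ioi fun y hy => by
        simp only [hR.symm t y t (ht.2.le.trans (le_of_lt hy)) le_rfl]
    rw [pow_two]
    nth_rewrite 1 [← e]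
    rw [← setIntegral_prod_mul, ← integral_neg]
    refine setIntegral_congr_fun mS fun z hz => ?_
    have := (hR.hasDerivAt_fst t z.1 z.2).unique
      (hRs t z.1 z.2 (ht.2.trans hz.1) (ht.2.trans hz.2))
    simp only [show kernelDeriv R (1, 0, 0) t z = _ from this]
    ring
  have hcont : ContinuousOn (fun t => ∫ z in Ioi M ×ˢ Ioi M, R t z.1 z.2 * g z.1 * g z.2)
      (Icc s M) := by
    obtain ⟨C, hC⟩ := hH (Icc s M) isCompact_Icc 1
    refine continuousOn_of_dominated (μ := volume.restrict (Ioi M ×ˢ Ioi M))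
      (bound := fun z : ℝ × ℝ => C * Real.exp (-(1 * (z.1 + z.2))))
      (fun t _ => Continuous.aestronglyMeasurable (by have := cR t; fun_prop)) (fun t ht => ?_)
      (integrableOn_prod_exp M C) ?_
    · filter_upwards [ae_restrict_mem mS] with z hz
      exact hC t ht z (ht.2.trans hz.1.le) (ht.2.trans hz.2.le)
    · filter_upwards with z
      have : Continuous fun t => R t z.1 z.2 :=
        hR.continuous_comp continuous_id continuous_const continuous_const
      fun_prop
  refine antitoneOn_of_deriv_nonpos (convex_Icc s M) hcont ?_ ?_ (left_mem_Icc.2 hsM)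
    (right_mem_Icc.2 hsM) hsM
  · rw [interior_Icc]
    exact fun t ht => (hder t ht).differentiableAt.differentiableWithinAt
  · rw [interior_Icc]
    intro t ht
    rw [(hder t ht).deriv]
    exact neg_nonpos.2 (sq_nonneg _)

lemma exists_integral_prod_le (hR : NiceKernel R)
    (hRs : ∀ s x y, s < x → s < y → HasDerivAt (fun s' => R s' x y) (-(R s x s * R s s y)) s)
    {g g' : ℝ → ℝ} (hg : Tame g g') (s : ℝ) :
    ∃ C, ∀ M, s ≤ M → ∫ z in Ioi M ×ˢ Ioi M, R M z.1 z.2 * g z.1 * g z.2 ≤ C := by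
  have hg1 := hg.continuous
  have cR : Continuous fun z : ℝ × ℝ => R s z.1 z.2 :=
    hR.continuous_comp continuous_const continuous_fst continuous_snd
  refine ⟨∫ z in Ioi s ×ˢ Ioi s, |R s z.1 z.2 * g z.1 * g z.2|, fun M hM =>
    (hR.integral_prod_le hRs hg hM).trans ?_⟩
  have i : IntegrableOn (fun z : ℝ × ℝ => R s z.1 z.2 * g z.1 * g z.2) (Ioi s ×ˢ Ioi s) :=
    (hR.decay.mul hg.bound hg.bound).integrableOn (by fun_prop) le_rfl
  have sub : Ioi M ×ˢ Ioi M ⊆ Ioi s ×ˢ Ioi s := prod_mono (Ioi_subset_Ioi hM) (Ioi_subset_Ioi hM)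
  calc _ ≤ ∫ z in Ioi M ×ˢ Ioi M, |R s z.1 z.2 * g z.1 * g z.2| :=
        integral_mono (i.mono_set sub) (i.mono_set sub).abs fun z => le_abs_self _
    _ ≤ _ := setIntegral_mono_set i.abs (Eventually.of_forall fun z => abs_nonneg _)
        (LE.le.eventuallyLE sub)

/-- If `Q = (1 + R) A` decays and `A = B' + w B` with `B` of exponential growth, then `A` is of
exponential growth as well. -/
lemma expBounded_of_resolvent (hR : NiceKernel R) {A B : ℝ → ℝ} {w : ℝ}
    (hB : ∀ y, HasDerivAt B (A y - w * B y) y) (hA : Continuous A) (hBb : ExpBounded B)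
    {Q : ℝ → ℝ → ℝ} (hQ : KernelDecay Q)
    (h1 : ∀ s x, s ≤ x → Q s x = A x + ∫ y in Ioi s, R s x y * A y) : ExpBounded A := by
  have hBc : Continuous B := continuous_iff_continuousAt.2 fun x => (hB x).continuousAt
  have one : ExpBounded fun _ => (1 : ℝ) := ⟨0, fun m => ⟨1, fun y _ => by simp⟩⟩
  refine ⟨0, fun s => ?_⟩
  obtain ⟨C, hC⟩ := hQ {s} isCompact_singleton 0
  have key : ∀ H : ℝ → ℝ × ℝ → ℝ, KernelDecay₂ H → ∃ D, ∀ x y, s ≤ x → s ≤ y →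
      |H s (x, y)| ≤ D * Real.exp (-(1 * y)) := by
    intro H hH
    obtain ⟨D, hD⟩ := hH {s} isCompact_singleton 1
    refine ⟨D * Real.exp (-s), fun x y hx hy => (hD s rfl (x, y) hx hy).trans ?_⟩
    have hD0 : 0 ≤ D := nonneg_of_mul_nonneg_left
      ((abs_nonneg _).trans (hD s rfl (x, y) hx hy)) (Real.exp_pos _)
    rw [mul_assoc, ← Real.exp_add]
    refine mul_le_mul_of_nonneg_left (Real.exp_le_exp.2 ?_) hD0
    linarith
  obtain ⟨D₁, hD₁⟩ := key _ (hR.decay.mul one hBb)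
  obtain ⟨D₂, hD₂⟩ := key _ ((hR.decay_deriv (0, 0, 1)).mul one hBb)
  simp only [mul_one] at hD₁ hD₂
  set I : ℝ := ∫ y : ℝ in Ioi s, Real.exp (-(1 * y)) with hI
  have hint : IntegrableOn (fun y : ℝ => Real.exp (-(1 * y))) (Ioi s) := by
    simpa [IntegrableOn] using exp_neg_integrableOn_Ioi s one_pos
  have bound_int : ∀ (f : ℝ → ℝ) (D : ℝ), (∀ y, s ≤ y → |f y| ≤ D * Real.exp (-(1 * y))) →
      |∫ y in Ioi s, f y| ≤ D * I := by
    intro f D hf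
    rw [hI, ← integral_const_mul, ← Real.norm_eq_abs]
    refine norm_integral_le_of_norm_le (hint.const_mul D) ?_
    filter_upwards [ae_restrict_mem measurableSet_Ioi] with y hy using hf y (le_of_lt hy)
  refine ⟨|C| + (|D₁| * Real.exp (-(1 * s)) + |D₂| * I + |w| * (|D₁| * I)), fun x hx => ?_⟩
  have hI0 : 0 ≤ I := integral_nonneg fun y => (Real.exp_pos _).le
  have hQx : |Q s x| ≤ |C| := by
    have := hC s rfl x hx
    simp only [zero_mul, neg_zero, Real.exp_zero, mul_one] at this
    exact this.trans (le_abs_self C)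
  have cR : Continuous fun y => R s x y :=
    hR.continuous_comp continuous_const continuous_const continuous_id
  have cD : Continuous fun y => kernelDeriv R (0, 0, 1) s (x, y) :=
    hR.continuous_deriv _ continuous_const (by fun_prop)
  have hint_bound : |∫ y in Ioi s, R s x y * A y|
      ≤ |D₁| * Real.exp (-(1 * s)) + |D₂| * I + |w| * (|D₁| * I) := by
    by_cases hi : IntegrableOn (fun y => R s x y * A y) (Ioi s)
    · have i1 : IntegrableOn (fun y => R s x y * B y) (Ioi s) :=
        integrableOn_of_exp_bound one_pos (by fun_prop) (hD₁ x · hx)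
      have i2 : IntegrableOn (fun y => kernelDeriv R (0, 0, 1) s (x, y) * B y) (Ioi s) :=
        integrableOn_of_exp_bound one_pos (by fun_prop) (hD₂ x · hx)
      have i3 := i1.const_mul w
      have hparts : ∫ y in Ioi s, (kernelDeriv R (0, 0, 1) s (x, y) * B y
          + (R s x y * A y - w * (R s x y * B y))) = 0 - R s x s * B s :=
        integral_Ioi_of_hasDerivAt_of_tendsto' (f := fun y => R s x y * B y)
          (fun y _ => ((hR.hasDerivAt_trd s x y).mul (hB y)).congr_deriv (by ring))
          (i2.add (hi.sub i3)) (tendsto_zero_of_exp_bound one_pos (hD₁ x · hx))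
      have e1 := integral_add i2 (hi.sub i3)
      have e2 := integral_sub hi i3
      simp only [Pi.sub_apply] at e1
      rw [e1, e2, integral_const_mul] at hparts
      have b1 := bound_int _ D₁ (hD₁ x · hx)
      have b2 := bound_int _ D₂ (hD₂ x · hx)
      have b3 := hD₁ x s hx le_rfl
      have e : ∫ y in Ioi s, R s x y * A y = -(R s x s * B s)
          - (∫ y in Ioi s, kernelDeriv R (0, 0, 1) s (x, y) * B y)
          + w * ∫ y in Ioi s, R s x y * B y := by linarith
      rw [e]
      refine (abs_add_le _ _).trans (add_le_add ((abs_sub _ _).trans (add_le_add ?_ ?_)) ?_)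
      · rw [abs_neg]
        exact b3.trans (by gcongr; exact le_abs_self _)
      · exact b2.trans (by gcongr; exact le_abs_self _)
      · rw [abs_mul]
        exact mul_le_mul_of_nonneg_left (b1.trans (by gcongr; exact le_abs_self _)) (abs_nonneg w)
    · rw [integral_undef hi, abs_zero]
      positivity
  have e : A x = Q s x - ∫ y in Ioi s, R s x y * A y := by rw [h1 s x hx]; ring
  rw [e, zero_mul, Real.exp_zero, mul_one]
  exact (abs_sub _ _).trans (add_le_add hQx hint_bound)

lemma integral_resolvent_eq (hR : NiceKernel R) {A g g' : ℝ → ℝ} (hA : Continuous A)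
    (hAb : ExpBounded A) (hg : Tame g g') {Q : ℝ → ℝ → ℝ} (hQ : KernelDecay Q)
    (hQc : ∀ s, Continuous (Q s))
    (h1 : ∀ s x, s ≤ x → Q s x = A x + ∫ y in Ioi s, R s x y * A y) (s : ℝ) :
    (∫ x in Ioi s, A x * g x) + ∫ x in Ioi s, ∫ y in Ioi s, R s x y * A x * g y
      = ∫ x in Ioi s, Q s x * g x := by
  have hgc := hg.continuous
  have i : Integrable (Function.uncurry fun x y => R s x y * A x * g y)
      ((volume.restrict (Ioi s)).prod (volume.restrict (Ioi s))) := by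
    rw [Measure.prod_restrict]
    refine (hR.decay.mul hAb hg.bound).integrableOn (s := s) ?_ le_rfl
    have cR : Continuous fun z : ℝ × ℝ => R s z.1 z.2 :=
      hR.continuous_comp continuous_const continuous_fst continuous_snd
    fun_prop
  have inner : ∀ y ∈ Ioi s, ∫ x in Ioi s, R s x y * A x * g y = Q s y * g y - A y * g y := by
    intro y hy
    have hy' : s ≤ y := le_of_lt hy
    rw [integral_mul_const, ← sub_mul, h1 s y hy', add_sub_cancel_left]
    congr 1
    exact setIntegral_congr_fun measurableSet_Ioi fun x hx => by
      simp only [hR.symm s x y (le_of_lt hx) hy']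
  have iQ : IntegrableOn (fun x => Q s x * g x) (Ioi s) :=
    (hQ.mul hg.bound).integrableOn (by have := hQc s; fun_prop)
  have iD : IntegrableOn (fun y => Q s y * g y - A y * g y) (Ioi s) := by
    refine (i.integral_prod_right).congr ?_
    filter_upwards [ae_restrict_mem measurableSet_Ioi] with y hy using inner y hy
  have iA : IntegrableOn (fun y => A y * g y) (Ioi s) := by
    refine (iQ.sub iD).congr (Eventually.of_forall fun y => ?_)
    simp
  rw [integral_integral_swap i, setIntegral_congr_fun measurableSet_Ioi inner,
    integral_sub iQ iA]
  ring

end NiceKernel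

lemma hasDerivAt_integral_column {R : ℝ → ℝ → ℝ → ℝ} {Q : ℝ → ℝ → ℝ} (hR : NiceKernel R)
    (hQs : ContDiff ℝ (⊤ : ℕ∞) (fun pr : ℝ × ℝ => Q pr.1 pr.2)) (hQ : KernelDecay Q)
    (hQ' : ∀ v, KernelDecay fun s x => fderiv ℝ (fun pr : ℝ × ℝ => Q pr.1 pr.2) (s, x) v)
    (h3 : ∀ s y, s ≤ y → HasDerivAt (fun s' => Q s' y) (-(Q s s * R s s y)) s)
    {g g' : ℝ → ℝ} (hg : Tame g g') (s : ℝ) :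
    HasDerivAt (fun t => ∫ x in Ioi t, Q t x * g x)
      (-(Q s s * (g s + ∫ y in Ioi s, R s s y * g y))) s := by
  have hg1 := hg.continuous
  have hg2 := hg.continuous_deriv
  set D : ℝ × ℝ → ℝ → ℝ → ℝ := fun v s x =>
    fderiv ℝ (fun pr : ℝ × ℝ => Q pr.1 pr.2) (s, x) v with hD
  have cQ : ∀ t, Continuous (Q t) := fun t =>
    hQs.continuous.comp (continuous_const.prodMk continuous_id)
  have cD : ∀ v t, Continuous (D v t) := fun v t =>
    ((hQs.continuous_fderiv (by simp)).comp
      (continuous_const.prodMk continuous_id)).clm_apply continuous_const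
  have comp : ∀ {γ : ℝ → ℝ × ℝ} {v : ℝ × ℝ} {t : ℝ}, HasDerivAt γ v t →
      HasDerivAt (fun t => Q (γ t).1 (γ t).2) (D v (γ t).1 (γ t).2) t := fun {γ v t} hγ =>
    ((hQs.differentiable (by simp) (γ t)).hasFDerivAt).comp_hasDerivAt t hγ
  have key := hasDerivAt_setIntegral_Ioi (H := fun t x => Q t x * g x)
    (H' := fun t x => D (1, 1) t x * g x + Q t x * g' x) (hQ.mul hg.bound)
    (((hQ' (1, 1)).mul hg.bound).add (hQ.mul hg.bound_deriv))
    (fun t => by have := cQ t; fun_prop)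
    (fun t => by have := cQ t; have := cD (1, 1) t; fun_prop)
    (fun t d _ => (comp ((hasDerivAt_id t).prodMk ((hasDerivAt_id t).const_add d))).mul
      ((hg.hasDerivAt (d + t)).comp_const_add d t)) s
  refine key.congr_deriv ?_
  have hsum := ((hQ' (0, 1)).mul hg.bound).add (hQ.mul hg.bound_deriv)
  have csum : Continuous fun x => D (0, 1) s x * g x + Q s x * g' x := by
    have := cQ s
    have := cD (0, 1) s
    fun_prop
  obtain ⟨C, hC⟩ := (hQ.mul hg.bound) {s} isCompact_singleton 1
  obtain ⟨C', hC'⟩ := hsum {s} isCompact_singleton 1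
  have e2 : ∫ x in Ioi s, (D (0, 1) s x * g x + Q s x * g' x) = -(Q s s * g s) :=
    setIntegral_Ioi_deriv_of_decay (f := fun x => Q s x * g x)
      (fun x => (comp (γ := fun x => (s, x))
        ((hasDerivAt_const x s).prodMk (hasDerivAt_id x))).mul (hg.hasDerivAt x))
      csum (hC s rfl) (hC' s rfl)
  have cR : Continuous fun x => R s s x :=
    hR.continuous_comp continuous_const continuous_const continuous_id
  have i1 : IntegrableOn (fun x => R s s x * g x) (Ioi s) :=
    (hR.decay.diag.mul hg.bound).integrableOn (cR.mul hg1)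
  have i2 : IntegrableOn (fun x => D (0, 1) s x * g x + Q s x * g' x) (Ioi s) :=
    hsum.integrableOn csum
  have split : ∫ x in Ioi s, (D (1, 1) s x * g x + Q s x * g' x)
      = ∫ x in Ioi s, (-Q s s * (R s s x * g x) + (D (0, 1) s x * g x + Q s x * g' x)) := by
    refine setIntegral_congr_fun measurableSet_Ioi fun x hx => ?_
    have e1 : D (1, 0) s x = -(Q s s * R s s x) :=
      (comp (γ := fun t => (t, x)) ((hasDerivAt_id s).prodMk (hasDerivAt_const s x))).unique
        (h3 s x (le_of_lt hx))
    have e3 : D (1, 1) s x = D (1, 0) s x + D (0, 1) s x := by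
      simp only [hD]
      rw [← map_add]
      simp
    simp only [e3, e1]
    ring
  rw [split, integral_add (i1.const_mul _) i2, integral_const_mul, e2]
  ring

lemma hasDerivAt_row {R : ℝ → ℝ → ℝ → ℝ} {Q : ℝ → ℝ → ℝ} (hR : NiceKernel R)
    (hQ : KernelDecay Q) (hQc : ∀ s, Continuous (Q s))
    (h4 : ∀ s x y, s ≤ x → s ≤ y →
      HasDerivAt (fun t => R (s + t) (x + t) (y + t)) (-(Q s x * Q s y)) 0)
    {A g : ℝ → ℝ} {w : ℝ} (hA : Continuous A) (hAb : ExpBounded A)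
    (h1 : ∀ s x, s ≤ x → Q s x = A x + ∫ y in Ioi s, R s x y * A y)
    (hg : Tame g fun y => A y - w * g y) (s : ℝ) :
    HasDerivAt (fun t => g t + ∫ y in Ioi t, R t t y * g y)
      (Q s s * (1 - ∫ x in Ioi s, Q s x * g x) - w * (g s + ∫ y in Ioi s, R s s y * g y)) s := by
  refine ((hg.hasDerivAt s).add (hR.hasDerivAt_integral_diag hg s)).congr_deriv ?_
  have hg1 := hg.continuous
  have cQ := hQc s
  have cR : Continuous fun x => R s s x :=
    hR.continuous_comp continuous_const continuous_const continuous_id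
  have iQ : IntegrableOn (fun y => Q s y * g y) (Ioi s) :=
    (hQ.mul hg.bound).integrableOn (by fun_prop)
  have iA : IntegrableOn (fun y => R s s y * A y) (Ioi s) :=
    (hR.decay.diag.mul hAb).integrableOn (cR.mul hA)
  have iR : IntegrableOn (fun y => R s s y * g y) (Ioi s) :=
    (hR.decay.diag.mul hg.bound).integrableOn (cR.mul hg1)
  have split : ∫ y in Ioi s, (kernelDeriv R (1, 1, 1) s (s, y) * g y + R s s y * (A y - w * g y))
      = ∫ y in Ioi s, (-Q s s * (Q s y * g y) + (R s s y * A y - w * (R s s y * g y))) := by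
    refine setIntegral_congr_fun measurableSet_Ioi fun y hy => ?_
    have e := hR.hasDerivAt_comp (γ := fun t => (s + t, s + t, y + t)) (t := 0)
      (((hasDerivAt_id (0 : ℝ)).const_add s).prodMk
        (((hasDerivAt_id (0 : ℝ)).const_add s).prodMk ((hasDerivAt_id (0 : ℝ)).const_add y)))
    simp only [add_zero] at e
    simp only [e.unique (h4 s s y le_rfl (le_of_lt hy))]
    ring
  have eA : ∫ y in Ioi s, R s s y * A y = Q s s - A s := by rw [h1 s s le_rfl]; ring
  have e := integral_add (iQ.const_mul (-Q s s)) (iA.sub (iR.const_mul w))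
  have e' := integral_sub iA (iR.const_mul w)
  simp only [Pi.sub_apply] at e
  rw [split, e, e', integral_const_mul, integral_const_mul, eA]
  ring

lemma hasDerivAt_setIntegral_Ioi_const {f : ℝ → ℝ} (hf : Continuous f)
    (hi : ∀ s, IntegrableOn f (Ioi s)) (s : ℝ) :
    HasDerivAt (fun t => ∫ y in Ioi t, f y) (-f s) s := by
  have e : (fun t => ∫ y in Ioi t, f y) = fun t => (∫ y in Ioi 0, f y) - ∫ y in 0..t, f y := by
    funext t
    rw [← intervalIntegral.integral_interval_add_Ioi (hi 0) (hi t)]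
    ring
  rw [e]
  exact (intervalIntegral.integral_hasDerivAt_right (hf.intervalIntegrable _ _)
    (hf.stronglyMeasurableAtFilter _ _) hf.continuousAt).const_sub _

/-- Square integrability at `+∞` from the conserved quantity of the system
`α' = q β`, `β' = q α - w β`. -/
lemma integrableOn_sq_of_system {R : ℝ → ℝ → ℝ → ℝ} (hR : NiceKernel R)
    (hRs : ∀ s x y, s < x → s < y → HasDerivAt (fun s' => R s' x y) (-(R s x s * R s s y)) s)
    {g g' : ℝ → ℝ} (hg : Tame g g') {w : ℝ} (hw : w ≠ 0) {α β q : ℝ → ℝ}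
    (hα : ∀ s, HasDerivAt α (q s * β s) s) (hβ : ∀ s, HasDerivAt β (q s * α s - w * β s) s)
    (hβ' : ∀ s, β s = g s + ∫ y in Ioi s, R s s y * g y)
    (hα1 : Tendsto α atTop (𝓝 1)) (hβ0 : Tendsto β atTop (𝓝 0)) (s : ℝ) :
    IntegrableOn (fun y => g y ^ 2) (Ioi s) := by
  have hg1 := hg.continuous
  have hc : Continuous fun y => g y ^ 2 := by fun_prop
  set J : ℝ → ℝ := fun t => ∫ z in Ioi t ×ˢ Ioi t, R t z.1 z.2 * g z.1 * g z.2 with hJ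
  set N : ℝ → ℝ := fun M =>
    (∫ y in s..M, g y ^ 2) - J M - (α M ^ 2 - β M ^ 2) / (2 * w) with hN
  have hN' : ∀ M, HasDerivAt N 0 M := by
    intro M
    have d1 := intervalIntegral.integral_hasDerivAt_right (hc.intervalIntegrable s M)
      (hc.stronglyMeasurableAtFilter _ _) hc.continuousAt
    have d2 := hR.hasDerivAt_integral_prod hRs hg hg M
    rw [← hβ'] at d2
    have d3 := (((hα M).pow 2).sub ((hβ M).pow 2)).div_const (2 * w)
    refine ((d1.sub d2).sub d3).congr_deriv ?_
    field_simp
    ring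
  have const : ∀ M, N M = N s := fun M =>
    is_const_of_deriv_eq_zero (fun t => (hN' t).differentiableAt) (fun t => (hN' t).deriv) M s
  obtain ⟨C, hC⟩ := hR.exists_integral_prod_le hRs hg s
  have lim : Tendsto (fun M => (α M ^ 2 - β M ^ 2) / (2 * w)) atTop
      (𝓝 ((1 ^ 2 - 0 ^ 2) / (2 * w))) := ((hα1.pow 2).sub (hβ0.pow 2)).div_const _
  refine integrableOn_Ioi_of_intervalIntegral_norm_bounded
    (N s + C + ((1 ^ 2 - 0 ^ 2) / (2 * w) + 1)) s
    (fun M : ℝ => (hc.intervalIntegrable s M).1) tendsto_id ?_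
  filter_upwards [eventually_ge_atTop s, lim.eventually_lt_const (lt_add_one _)] with M hM hl
  have e : ∫ y in s..M, ‖g y ^ 2‖ = ∫ y in s..M, g y ^ 2 := by
    simp only [Real.norm_eq_abs, abs_pow, sq_abs]
  have h1 := const M
  have h2 := hC M hM
  rw [e]
  simp only [hN, hJ] at h1 ⊢
  linarith

/-- Proposition 5.1, conditional on the resolvent relations.
In the setting of Proposition 4.1, with the extra resolvent-derivative relation and
the normalization at `s = +∞`, the `F₀`-point Fredholm expression factorizes as
`a(s,ω₊)a(s,ω₋) - b(s,ω₊)b(s,ω₋)`. -/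
theorem baik_rains_F0_factorization
    (B : ℝ → ℝ → ℝ)
    (hBsmooth : ContDiffOn ℝ (⊤ : ℕ∞) (fun pr : ℝ × ℝ => B pr.1 pr.2)
      (Set.univ ×ˢ {ω : ℝ | ω ≠ 0}))
    (hBy : ∀ y ω : ℝ, ω ≠ 0 →
      HasDerivAt (fun y' => B y' ω) (Airy y - ω * B y ω) y)
    (hBω : ∀ y ω : ℝ, ω ≠ 0 →
      HasDerivAt (fun ω' => B y ω')
        (deriv Airy y - ω * Airy y + (ω ^ 2 - y) * B y ω) ω)
    (hBgrowth : ∀ ω : ℝ, ω ≠ 0 → ∃ C c : ℝ, ∀ y, |B y ω| ≤ C * Real.exp (c * |y|))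
    (R : ℝ → ℝ → ℝ → ℝ) (Q P : ℝ → ℝ → ℝ)
    (hRsmooth : ContDiff ℝ (⊤ : ℕ∞) (fun pr : ℝ × ℝ × ℝ => R pr.1 pr.2.1 pr.2.2))
    (hQsmooth : ContDiff ℝ (⊤ : ℕ∞) (fun pr : ℝ × ℝ => Q pr.1 pr.2))
    (hPsmooth : ContDiff ℝ (⊤ : ℕ∞) (fun pr : ℝ × ℝ => P pr.1 pr.2))
    (hdecay : ∀ Kc : Set ℝ, IsCompact Kc → ∀ c : ℝ, ∃ C : ℝ, ∀ s ∈ Kc, ∀ x y : ℝ,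
      s ≤ x → s ≤ y →
      |R s x y| ≤ C * Real.exp (-(c * (x + y))) ∧
      ‖fderiv ℝ (fun pr : ℝ × ℝ × ℝ => R pr.1 pr.2.1 pr.2.2) (s, x, y)‖
        ≤ C * Real.exp (-(c * (x + y))) ∧
      |Q s x| ≤ C * Real.exp (-(c * x)) ∧
      ‖fderiv ℝ (fun pr : ℝ × ℝ => Q pr.1 pr.2) (s, x)‖ ≤ C * Real.exp (-(c * x)) ∧
      |P s x| ≤ C * Real.exp (-(c * x)) ∧
      ‖fderiv ℝ (fun pr : ℝ × ℝ => P pr.1 pr.2) (s, x)‖ ≤ C * Real.exp (-(c * x)))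
    (q p u v : ℝ → ℝ)
    (hq : ∀ s, q s = Q s s) (hp : ∀ s, p s = P s s)
    (hu : ∀ s, u s = ∫ x in Set.Ioi s, Q s x * Airy x)
    (hv : ∀ s, v s = ∫ x in Set.Ioi s, P s x * Airy x)
    (h1Q : ∀ s x, s ≤ x → Q s x = Airy x + ∫ y in Set.Ioi s, R s x y * Airy y)
    (h1P : ∀ s x, s ≤ x → P s x = deriv Airy x + ∫ y in Set.Ioi s, R s x y * deriv Airy y)
    (h2 : ∀ s x y, s ≤ x → s ≤ y → x ≠ y →
      R s x y = (Q s x * P s y - P s x * Q s y) / (x - y))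
    (h3 : ∀ s y, s ≤ y → HasDerivAt (fun s' => Q s' y) (-(q s * R s s y)) s)
    (h4 : ∀ s x y, s ≤ x → s ≤ y →
      HasDerivAt (fun t => R (s + t) (x + t) (y + t)) (-(Q s x * Q s y)) 0)
    (h5 : ∀ s y, s ≤ y → HasDerivAt (fun y' => Q s y')
      (P s y - u s * Q s y + q s * R s s y) y)
    (h6 : ∀ s y, s ≤ y → HasDerivAt (fun y' => P s y')
      (y * Q s y - 2 * v s * Q s y + u s * P s y + p s * R s s y) y)
    (h7 : ∀ s, u s ^ 2 - 2 * v s = q s ^ 2)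
    (h8 : ∀ s, HasDerivAt q (p s - q s * u s) s)
    (a b : ℝ → ℝ → ℝ)
    (ha : ∀ s ω, a s ω = 1 - (∫ x in Set.Ioi s, Airy x * B x ω)
      - ∫ x in Set.Ioi s, ∫ y in Set.Ioi s, R s x y * Airy x * B y ω)
    (hb : ∀ s ω, b s ω = B s ω + ∫ y in Set.Ioi s, R s s y * B y ω)
    -- the additional resolvent-derivative relation
    (hRs : ∀ s x y, s < x → s < y →
      HasDerivAt (fun s' => R s' x y) (-(R s x s * R s s y)) s)
    (ωp ωm : ℝ) (hωp : ωp ≠ 0) (hωm : ωm ≠ 0)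
    -- normalization at `s = +∞`
    (halim : Tendsto (fun s => a s ωp) atTop (𝓝 1))
    (halim' : Tendsto (fun s => a s ωm) atTop (𝓝 1))
    (hblim : Tendsto (fun s => b s ωp) atTop (𝓝 0))
    (hblim' : Tendsto (fun s => b s ωm) atTop (𝓝 0))
    (hBBlim : Tendsto (fun s => (∫ y in Set.Ioi s, B y ωp * B y ωm)
      + ∫ x in Set.Ioi s, ∫ y in Set.Ioi s, R s x y * B x ωp * B y ωm) atTop (𝓝 0)) :
    ∀ s : ℝ,
      1 - (ωp + ωm) * ((∫ y in Set.Ioi s, B y ωp * B y ωm)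
          + ∫ x in Set.Ioi s, ∫ y in Set.Ioi s, R s x y * B x ωp * B y ωm)
        = a s ωp * a s ωm - b s ωp * b s ωm := by
  have hA : Continuous Airy := by
    have c : Continuous fun y => B y ωp :=
      continuous_iff_continuousAt.2 fun y => (hBy y ωp hωp).continuousAt
    have smooth : ContDiff ℝ (⊤ : ℕ∞) fun y => B y ωp := by
      rw [← contDiffOn_univ]
      exact hBsmooth.comp (f := fun y : ℝ => (y, ωp)) (by fun_prop)
        fun y _ => ⟨mem_univ _, hωp⟩
    have d : deriv (fun y => B y ωp) = fun y => Airy y - ωp * B y ωp :=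
      funext fun y => (hBy y ωp hωp).deriv
    have e : Airy = fun y => deriv (fun y => B y ωp) y + ωp * B y ωp := by
      rw [d]; funext y; ring
    rw [e]
    exact (smooth.continuous_deriv (by simp)).add (continuous_const.mul c)
  have hR : NiceKernel R := by
    refine ⟨hRsmooth, fun K hK c => ?_, fun v K hK c => ?_, fun s x y hx hy => ?_⟩
    · obtain ⟨C, hC⟩ := hdecay K hK c
      exact ⟨C, fun s hs z h1 h2 => (hC s hs z.1 z.2 h1 h2).1⟩
    · obtain ⟨C, hC⟩ := hdecay K hK c
      refine ⟨C * ‖v‖, fun s hs z h1 h2 => (le_of_eq_of_le (Real.norm_eq_abs _).symm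
        (ContinuousLinearMap.le_opNorm _ v)).trans ?_⟩
      rw [mul_right_comm]
      exact mul_le_mul_of_nonneg_right (hC s hs z.1 z.2 h1 h2).2.1 (norm_nonneg v)
    · rcases eq_or_ne x y with rfl | hxy
      · rfl
      · rw [h2 s x y hx hy hxy, h2 s y x hy hx hxy.symm, ← neg_sub x y, div_neg, ← neg_div]
        ring
  have hQ : KernelDecay Q := fun K hK c => by
    obtain ⟨C, hC⟩ := hdecay K hK c
    exact ⟨C, fun s hs x hx => (hC s hs x x hx hx).2.2.1⟩
  have hQ' : ∀ v, KernelDecay fun s x => fderiv ℝ (fun pr : ℝ × ℝ => Q pr.1 pr.2) (s, x) v := by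
    intro v K hK c
    obtain ⟨C, hC⟩ := hdecay K hK c
    refine ⟨C * ‖v‖, fun s hs x hx => (le_of_eq_of_le (Real.norm_eq_abs _).symm
        (ContinuousLinearMap.le_opNorm _ v)).trans ?_⟩
    rw [mul_right_comm]
    exact mul_le_mul_of_nonneg_right (hC s hs x x hx hx).2.2.2.1 (norm_nonneg v)
  have hQc : ∀ s, Continuous (Q s) := fun s =>
    hQsmooth.continuous.comp (continuous_const.prodMk continuous_id)
  have hBb : ∀ ω, ω ≠ 0 → ExpBounded fun y => B y ω := fun ω hω => by
    obtain ⟨C, c, h⟩ := hBgrowth ω hω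
    exact expBounded_of_abs h
  have hAb : ExpBounded Airy :=
    hR.expBounded_of_resolvent (fun y => hBy y ωp hωp) hA (hBb ωp hωp) hQ h1Q
  have hT : ∀ ω, ω ≠ 0 → Tame (fun y => B y ω) fun y => Airy y - ω * B y ω := fun ω hω =>
    ⟨fun y => hBy y ω hω,
      hA.sub (continuous_const.mul
        (continuous_iff_continuousAt.2 fun y => (hBy y ω hω).continuousAt)),
      hBb ω hω, hAb.sub_const_mul (hBb ω hω) ω⟩
  have ha' : ∀ ω, ω ≠ 0 → ∀ s, a s ω = 1 - ∫ x in Ioi s, Q s x * B x ω := fun ω hω s => by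
    rw [ha, ← hR.integral_resolvent_eq hA hAb (hT ω hω) hQ hQc h1Q s]
    ring
  have hda : ∀ ω, ω ≠ 0 → ∀ s, HasDerivAt (fun t => a t ω) (Q s s * b s ω) s := fun ω hω s => by
    rw [funext fun t => ha' ω hω t, hb]
    refine ((hasDerivAt_integral_column hR hQsmooth hQ hQ' (fun s y hy => ?_)
      (hT ω hω) s).const_sub 1).congr_deriv (neg_neg _)
    rw [← hq]
    exact h3 s y hy
  have hdb : ∀ ω, ω ≠ 0 → ∀ s, HasDerivAt (fun t => b t ω) (Q s s * a s ω - ω * b s ω) s :=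
    fun ω hω s => by
      rw [funext fun t => hb t ω, hb, ha' ω hω]
      exact hasDerivAt_row hR hQ hQc h4 hA hAb h1Q (hT ω hω) s
  have hL2p : ∀ s, IntegrableOn (fun y => B y ωp ^ 2) (Ioi s) :=
    integrableOn_sq_of_system hR hRs (hT ωp hωp) hωp (hda ωp hωp) (hdb ωp hωp)
      (fun s => hb s ωp) halim hblim
  have hL2m : ∀ s, IntegrableOn (fun y => B y ωm ^ 2) (Ioi s) :=
    integrableOn_sq_of_system hR hRs (hT ωm hωm) hωm (hda ωm hωm) (hdb ωm hωm)
      (fun s => hb s ωm) halim' hblim'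
  have hcBB : Continuous fun y => B y ωp * B y ωm :=
    (hT ωp hωp).continuous.mul (hT ωm hωm).continuous
  have hBB : ∀ s, IntegrableOn (fun y => B y ωp * B y ωm) (Ioi s) := fun s => by
    refine ((hL2p s).add (hL2m s)).mono' hcBB.aestronglyMeasurable
      (Eventually.of_forall fun y => ?_)
    rw [Real.norm_eq_abs, abs_le, Pi.add_apply]
    constructor <;> nlinarith [sq_nonneg (B y ωp + B y ωm), sq_nonneg (B y ωp - B y ωm)]
  set F : ℝ → ℝ := fun s => (∫ y in Ioi s, B y ωp * B y ωm)
    + ∫ x in Ioi s, ∫ y in Ioi s, R s x y * B x ωp * B y ωm with hF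
  have hdF : ∀ s, HasDerivAt F (-(b s ωp * b s ωm)) s := fun s => by
    have d := (hasDerivAt_setIntegral_Ioi_const hcBB hBB s).add
      (hR.hasDerivAt_integral_prod hRs (hT ωp hωp) (hT ωm hωm) s)
    rw [← hb, ← hb] at d
    rw [hF, funext fun t => congrArg ((∫ y in Ioi t, B y ωp * B y ωm) + ·)
      (hR.integral_prod_eq (hT ωp hωp) (hT ωm hωm) t).symm]
    exact d.congr_deriv (by ring)
  set E : ℝ → ℝ := fun s =>
    1 - (ωp + ωm) * F s - (a s ωp * a s ωm - b s ωp * b s ωm) with hE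
  have hdE : ∀ s, HasDerivAt E 0 s := fun s => by
    refine ((((hdF s).const_mul (ωp + ωm)).const_sub 1).sub
      (((hda ωp hωp s).mul (hda ωm hωm s)).sub
        ((hdb ωp hωp s).mul (hdb ωm hωm s)))).congr_deriv ?_
    ring
  have hE0 : Tendsto E atTop (𝓝 0) := by
    have := ((hBBlim.const_mul (ωp + ωm)).const_sub 1).sub
      ((halim.mul halim').sub (hblim.mul hblim'))
    simpa using this
  intro s
  have hconst : E = fun _ => E s := funext fun t =>
    is_const_of_deriv_eq_zero (fun t => (hdE t).differentiableAt) (fun t => (hdE t).deriv) t s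
  rw [hconst] at hE0
  exact sub_eq_zero.1 (tendsto_nhds_unique tendsto_const_nhds hE0)

end
end

section
/- Let Ai(x)=(1/π)∫₀^∞cos(t³/3+xt)dt be the Airy function (which is smooth, bounded, and satisfies Ai''(x)=xAi(x)). For ω>0 define B(y,ω)=∫₀^∞ e^{−ωλ} Ai(y−λ) dλ. Then B is smooth in (y,ω) and satisfies (i) ∂_y B(y,ω) = Ai(y) − ω B(y,ω), and (ii) ∂_ω B(y,ω) = Ai'(y) − ω Ai(y) + (ω²−y) B(y,ω). -/
noncomputable section
open MeasureTheory Real Filter Topology Set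

/-- `B(y,ω) = ∫_0^∞ e^{-ωλ} Ai(y-λ) dλ` for `ω > 0`. -/
def Bpos (y ω : ℝ) : ℝ := ∫ l in Set.Ioi (0:ℝ), Real.exp (-ω * l) * Airy (y - l)

/-- The phase exponential `exp (i (z³/3 + x z))` whose integral represents the Airy function. -/
def airyKernel (x : ℝ) (z : ℂ) : ℂ := Complex.exp (Complex.I * (z ^ 3 / 3 + x * z))

lemma norm_airyKernel (x t η : ℝ) :
    ‖airyKernel x (t + η * Complex.I)‖ = Real.exp (-η * t ^ 2 + η ^ 3 / 3 - η * x) := by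
  rw [airyKernel, Complex.norm_exp]
  congr 1
  have h : Complex.I * (((t : ℂ) + η * Complex.I) ^ 3 / 3 + x * (t + η * Complex.I))
      = ((-η * t ^ 2 + η ^ 3 / 3 - η * x : ℝ) : ℂ)
        + ((t ^ 3 / 3 - t * η ^ 2 + x * t : ℝ) : ℂ) * Complex.I := by
    push_cast
    linear_combination (t ^ 2 * η + x * η + (Complex.I ^ 2 - 1) * η ^ 3 / 3
      + Complex.I * t * η ^ 2) * Complex.I_sq
  rw [h, Complex.add_re, Complex.re_ofReal_mul, Complex.I_re, Complex.ofReal_re, mul_zero,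
    add_zero]

lemma differentiable_airyKernel (x : ℝ) : Differentiable ℂ (airyKernel x) := by
  unfold airyKernel
  fun_prop

/-- The integrand of the `k`-th derivative of the Airy integral along the line `Im z = η`. -/
def airyLineIntegrand (η : ℝ) (k : ℕ) (x t : ℝ) : ℂ :=
  (Complex.I * (t + η * Complex.I)) ^ k * airyKernel x (t + η * Complex.I)

/-- The `k`-th derivative of the Airy integral along the line `Im z = η`. -/
def airyLine (η : ℝ) (k : ℕ) (x : ℝ) : ℂ := ∫ t : ℝ, airyLineIntegrand η k x t

lemma continuous_airyLineIntegrand (η : ℝ) (k : ℕ) (x : ℝ) :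
    Continuous (airyLineIntegrand η k x) := by
  unfold airyLineIntegrand airyKernel
  fun_prop

/-- The constant in the Gaussian bound for `airyLineIntegrand`. -/
def airyLineConst (η : ℝ) (k : ℕ) : ℝ :=
  k.factorial * Real.exp (η + 1 / (2 * η) + η ^ 3 / 3)

lemma norm_airyLineIntegrand_le {η : ℝ} (hη : 0 < η) (k : ℕ) (x t : ℝ) :
    ‖airyLineIntegrand η k x t‖
      ≤ airyLineConst η k * Real.exp (-η * x) * Real.exp (-(η / 2) * t ^ 2) := by
  rw [airyLineIntegrand, norm_mul, norm_pow, norm_airyKernel, airyLineConst]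
  have h1 : ‖Complex.I * ((t : ℂ) + η * Complex.I)‖ ≤ |t| + η := by
    rw [norm_mul, Complex.norm_I, one_mul]
    refine (norm_add_le _ _).trans ?_
    simp [abs_of_pos hη]
  have h2 : ‖Complex.I * ((t : ℂ) + η * Complex.I)‖ ^ k
      ≤ k.factorial * Real.exp (|t| + η) := by
    refine (pow_le_pow_left₀ (norm_nonneg _) h1 k).trans ?_
    have := Real.pow_div_factorial_le_exp (|t| + η) (by positivity) k
    rwa [div_le_iff₀' (by positivity)] at this
  have h3 : |t| ≤ η / 2 * t ^ 2 + 1 / (2 * η) := by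
    have : η / 2 * t ^ 2 + 1 / (2 * η) - |t| = (η * |t| - 1) ^ 2 / (2 * η) := by
      rw [← sq_abs t]
      field_simp
      ring
    have h : 0 ≤ (η * |t| - 1) ^ 2 / (2 * η) := by positivity
    linarith
  calc _ ≤ k.factorial * Real.exp (|t| + η) * Real.exp (-η * t ^ 2 + η ^ 3 / 3 - η * x) := by
        gcongr
    _ ≤ _ := by
        rw [mul_assoc, mul_assoc, mul_assoc, ← Real.exp_add, ← Real.exp_add, ← Real.exp_add]
        refine mul_le_mul_of_nonneg_left (Real.exp_le_exp.2 ?_) (Nat.cast_nonneg _)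
        linarith

lemma integrable_airyLineIntegrand {η : ℝ} (hη : 0 < η) (k : ℕ) (x : ℝ) :
    Integrable (airyLineIntegrand η k x) :=
  ((integrable_exp_neg_mul_sq (half_pos hη)).const_mul _).mono'
    (continuous_airyLineIntegrand η k x).aestronglyMeasurable
    (ae_of_all _ (norm_airyLineIntegrand_le hη k x))

lemma exists_norm_airyLine_le {η : ℝ} (hη : 0 < η) (k : ℕ) :
    ∃ C, 0 ≤ C ∧ ∀ x, ‖airyLine η k x‖ ≤ C * Real.exp (-η * x) := by
  refine ⟨airyLineConst η k * ∫ t : ℝ, Real.exp (-(η / 2) * t ^ 2),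
    mul_nonneg (by unfold airyLineConst; positivity)
      (integral_nonneg fun _ => (Real.exp_pos _).le), fun x => ?_⟩
  refine (norm_integral_le_of_norm_le
    ((integrable_exp_neg_mul_sq (half_pos hη)).const_mul
      (airyLineConst η k * Real.exp (-η * x)))
    (ae_of_all _ (norm_airyLineIntegrand_le hη k x))).trans_eq ?_
  rw [integral_const_mul]
  ring

lemma hasDerivAt_airyLine {η : ℝ} (hη : 0 < η) (k : ℕ) (x : ℝ) :
    HasDerivAt (airyLine η k) (airyLine η (k + 1) x) x := by
  refine (hasDerivAt_integral_of_dominated_loc_of_deriv_le (𝕜 := ℝ)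
    (bound := fun t => airyLineConst η (k + 1) * Real.exp (-η * (x - 1))
      * Real.exp (-(η / 2) * t ^ 2))
    (Ioi_mem_nhds (sub_one_lt x))
    (Eventually.of_forall fun y => (continuous_airyLineIntegrand η k y).aestronglyMeasurable)
    (integrable_airyLineIntegrand hη k x)
    (F' := airyLineIntegrand η (k + 1))
    (continuous_airyLineIntegrand η (k + 1) x).aestronglyMeasurable
    (ae_of_all _ fun t y hy => ?_)
    ((integrable_exp_neg_mul_sq (half_pos hη)).const_mul _)
    (ae_of_all _ fun t y _ => ?_)).2
  · refine (norm_airyLineIntegrand_le hη (k + 1) y t).trans ?_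
    have h : 0 ≤ airyLineConst η (k + 1) := by unfold airyLineConst; positivity
    have hy' : x - 1 ≤ y := (mem_Ioi.1 hy).le
    have : -η * y ≤ -η * (x - 1) := by nlinarith
    gcongr
  · unfold airyLineIntegrand airyKernel
    have h1 : HasDerivAt (fun y : ℝ => Complex.I * (((t : ℂ) + η * Complex.I) ^ 3 / 3
        + y * (t + η * Complex.I))) (Complex.I * (t + η * Complex.I)) y := by
      simpa using (((Complex.ofRealCLM.hasDerivAt (x := y)).mul_const
        ((t : ℂ) + η * Complex.I)).const_add
          (((t : ℂ) + η * Complex.I) ^ 3 / 3)).const_mul Complex.I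
    exact (h1.cexp.const_mul ((Complex.I * ((t : ℂ) + η * Complex.I)) ^ k)).congr_deriv (by ring)

lemma airyLine_two {η : ℝ} (hη : 0 < η) (x : ℝ) :
    airyLine η 2 x = x * airyLine η 0 x := by
  have hder : ∀ t : ℝ, HasDerivAt (airyLineIntegrand η 0 x)
      (Complex.I * (x * airyLineIntegrand η 0 x t - airyLineIntegrand η 2 x t)) t := by
    intro t
    have h0 : HasDerivAt (fun t : ℝ => (t : ℂ) + η * Complex.I) 1 t := by
      simpa using (Complex.ofRealCLM.hasDerivAt (x := t)).add_const (η * Complex.I)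
    have h1 := ((((h0.pow 3).div_const 3).add (h0.const_mul (x : ℂ))).const_mul Complex.I).cexp
    have he : airyLineIntegrand η 0 x = fun t : ℝ => Complex.exp (Complex.I *
        (((t : ℂ) + η * Complex.I) ^ 3 / 3 + x * (t + η * Complex.I))) := by
      funext t
      simp [airyLineIntegrand, airyKernel]
    rw [he]
    refine h1.congr_deriv ?_
    simp only [airyLineIntegrand, airyKernel, Pi.add_apply, Pi.pow_apply]
    rw [mul_pow, Complex.I_sq]
    push_cast
    ring
  have h0 := integrable_airyLineIntegrand hη 0 x
  have h2 := integrable_airyLineIntegrand hη 2 x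
  have h := integral_eq_zero_of_hasDerivAt_of_integrable hder
    (((h0.const_mul (x : ℂ)).sub h2).const_mul Complex.I) h0
  rw [integral_const_mul, integral_sub (h0.const_mul _) h2, integral_const_mul] at h
  have h' := (mul_eq_zero.1 h).resolve_left Complex.I_ne_zero
  exact (sub_eq_zero.1 h').symm

lemma tendsto_integral_airyKernel_real {η : ℝ} (hη : 0 < η) (x : ℝ) :
    Tendsto (fun T : ℝ => ∫ t in (-T)..T, airyKernel x t) atTop (𝓝 (airyLine η 0 x)) := by
  have hside : ∀ s : ℝ → ℝ, (∀ T, s T ^ 2 = T ^ 2) →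
      Tendsto (fun T : ℝ => ∫ y in (0 : ℝ)..η, airyKernel x (s T + y * Complex.I))
        atTop (𝓝 0) := by
    intro s hs
    have hc : ∀ T : ℝ, Continuous fun y : ℝ => airyKernel x (s T + y * Complex.I) := by
      intro T
      unfold airyKernel
      fun_prop
    have h := intervalIntegral.tendsto_integral_filter_of_dominated_convergence
      (μ := volume) (a := 0) (b := η) (l := atTop)
      (F := fun (T y : ℝ) => airyKernel x (s T + y * Complex.I)) (f := fun _ => 0)
      (fun y => Real.exp (y ^ 3 / 3 - y * x))
      (Eventually.of_forall fun T => (hc T).aestronglyMeasurable)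
      (Eventually.of_forall fun T => ae_of_all _ fun y hy => ?_)
      (Continuous.intervalIntegrable (by fun_prop) _ _)
      (ae_of_all _ fun y hy => ?_)
    · simpa using h
    · rw [uIoc_of_le hη.le] at hy
      rw [norm_airyKernel]
      gcongr
      nlinarith [hy.1, sq_nonneg (s T), mul_nonneg hy.1.le (sq_nonneg (s T))]
    · rw [uIoc_of_le hη.le] at hy
      rw [tendsto_zero_iff_norm_tendsto_zero]
      simp only [norm_airyKernel, hs]
      refine Real.tendsto_exp_atBot.comp ?_
      refine tendsto_atBot_add_const_right _ _ (tendsto_atBot_add_const_right _ _ ?_)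
      exact (tendsto_pow_atTop two_ne_zero).const_mul_atTop_of_neg (neg_lt_zero.2 hy.1)
  have hline : Tendsto (fun T : ℝ => ∫ t in (-T)..T, airyKernel x (t + η * Complex.I))
      atTop (𝓝 (airyLine η 0 x)) := by
    have h := intervalIntegral_tendsto_integral (integrable_airyLineIntegrand hη 0 x)
      tendsto_neg_atTop_atBot tendsto_id
    simpa [airyLine, airyLineIntegrand] using h
  have hsum := (hline.sub ((hside id fun _ => rfl).const_mul Complex.I)).add
    ((hside (fun T => -T) fun T => neg_sq T).const_mul Complex.I)
  simp only [mul_zero, sub_zero, add_zero] at hsum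
  refine hsum.congr fun T => ?_
  have hrect := Complex.integral_boundary_rect_eq_zero_of_differentiableOn (airyKernel x)
    (-T : ℝ) (T + η * Complex.I) (differentiable_airyKernel x).differentiableOn
  simp at hrect
  simp only [id, Complex.ofReal_neg]
  linear_combination -hrect

lemma re_airyKernel_ofReal (x t : ℝ) :
    (airyKernel x t).re = Real.cos (t ^ 3 / 3 + x * t) := by
  have h : Complex.I * ((t : ℂ) ^ 3 / 3 + x * t) = ((t ^ 3 / 3 + x * t : ℝ) : ℂ) * Complex.I := by
    push_cast
    ring
  rw [airyKernel, h, Complex.exp_ofReal_mul_I_re]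

lemma Airy_eq_re_airyLine {η : ℝ} (hη : 0 < η) (x : ℝ) :
    Airy x = (2 * Real.pi)⁻¹ * (airyLine η 0 x).re := by
  have hc : Continuous fun t : ℝ => Real.cos (t ^ 3 / 3 + x * t) := by fun_prop
  have hk : Continuous fun t : ℝ => airyKernel x t := by
    unfold airyKernel
    fun_prop
  have h : ∀ T : ℝ, (2⁻¹ : ℝ) * (∫ t in (-T)..T, airyKernel x t).re
      = ∫ t in (0 : ℝ)..T, Real.cos (t ^ 3 / 3 + x * t) := by
    intro T
    have h1 : (∫ t in (-T)..T, airyKernel x t).re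
        = ∫ t in (-T)..T, Real.cos (t ^ 3 / 3 + x * t) := by
      rw [← Complex.reCLM_apply,
        ← Complex.reCLM.intervalIntegral_comp_comm (hk.intervalIntegrable _ _)]
      simp only [Complex.reCLM_apply, re_airyKernel_ofReal]
    have h2 : ∫ t in (-T)..0, Real.cos (t ^ 3 / 3 + x * t)
        = ∫ t in (0 : ℝ)..T, Real.cos (t ^ 3 / 3 + x * t) := by
      rw [← neg_zero, ← intervalIntegral.integral_comp_neg, neg_zero]
      refine intervalIntegral.integral_congr fun t _ => ?_
      rw [← Real.cos_neg]
      ring_nf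
    rw [h1, ← intervalIntegral.integral_add_adjacent_intervals
      (hc.intervalIntegrable _ 0) (hc.intervalIntegrable _ _), h2]
    ring
  have hlim : Tendsto (fun T : ℝ => ∫ t in (0 : ℝ)..T, Real.cos (t ^ 3 / 3 + x * t)) atTop
      (𝓝 (2⁻¹ * (airyLine η 0 x).re)) :=
    (((Complex.continuous_re.tendsto _).comp
      (tendsto_integral_airyKernel_real hη x)).const_mul _).congr h
  rw [Airy, iInt, hlim.limUnder_eq]
  field_simp

lemma hasDerivAt_re_airyLine {η : ℝ} (hη : 0 < η) (k : ℕ) (x : ℝ) :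
    HasDerivAt (fun x => (2 * Real.pi)⁻¹ * (airyLine η k x).re)
      ((2 * Real.pi)⁻¹ * (airyLine η (k + 1) x).re) x :=
  ((Complex.reCLM.hasFDerivAt.comp_hasDerivAt x (hasDerivAt_airyLine hη k x))).const_mul _

lemma Airy_eq_fun {η : ℝ} (hη : 0 < η) :
    Airy = fun x => (2 * Real.pi)⁻¹ * (airyLine η 0 x).re :=
  funext (Airy_eq_re_airyLine hη)

lemma deriv_Airy_eq {η : ℝ} (hη : 0 < η) :
    deriv Airy = fun x => (2 * Real.pi)⁻¹ * (airyLine η 1 x).re := by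
  rw [Airy_eq_fun hη]
  exact funext fun x => (hasDerivAt_re_airyLine hη 0 x).deriv

lemma hasDerivAt_Airy (x : ℝ) : HasDerivAt Airy (deriv Airy x) x := by
  rw [deriv_Airy_eq one_pos, Airy_eq_fun one_pos]
  exact hasDerivAt_re_airyLine one_pos 0 x

lemma hasDerivAt_deriv_Airy (x : ℝ) : HasDerivAt (deriv Airy) (x * Airy x) x := by
  rw [deriv_Airy_eq one_pos, Airy_eq_fun one_pos]
  refine (hasDerivAt_re_airyLine one_pos 1 x).congr_deriv ?_
  rw [airyLine_two one_pos, Complex.re_ofReal_mul]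
  ring

lemma contDiff_Airy (n : ℕ) : ContDiff ℝ n Airy ∧ ContDiff ℝ n (deriv Airy) := by
  induction n with
  | zero =>
    exact ⟨contDiff_zero.2 (continuous_iff_continuousAt.2
        fun x => (hasDerivAt_Airy x).continuousAt),
      contDiff_zero.2 (continuous_iff_continuousAt.2
        fun x => (hasDerivAt_deriv_Airy x).continuousAt)⟩
  | succ n ih =>
    push_cast
    refine ⟨contDiff_succ_iff_deriv.2 ⟨fun x => (hasDerivAt_Airy x).differentiableAt,
        by simp, ih.2⟩,
      contDiff_succ_iff_deriv.2 ⟨fun x => (hasDerivAt_deriv_Airy x).differentiableAt,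
        by simp, ?_⟩⟩
    rw [show deriv (deriv Airy) = fun x => x * Airy x from
      funext fun x => (hasDerivAt_deriv_Airy x).deriv]
    exact contDiff_id.mul ih.1

lemma exists_abs_Airy_le {η : ℝ} (hη : 0 < η) :
    ∃ C, 0 ≤ C ∧ ∀ x, |Airy x| ≤ C * Real.exp (-η * x)
      ∧ |deriv Airy x| ≤ C * Real.exp (-η * x) := by
  have key : ∀ k, ∃ C, 0 ≤ C ∧ ∀ x, |(2 * Real.pi)⁻¹ * (airyLine η k x).re|
      ≤ C * Real.exp (-η * x) := by
    intro k
    obtain ⟨C, hC, h⟩ := exists_norm_airyLine_le hη k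
    refine ⟨(2 * Real.pi)⁻¹ * C, by positivity, fun x => ?_⟩
    rw [abs_mul, abs_of_pos (by positivity : 0 < (2 * Real.pi)⁻¹), mul_assoc]
    gcongr
    exact (Complex.abs_re_le_norm _).trans (h x)
  obtain ⟨C₀, h₀, b₀⟩ := key 0
  obtain ⟨C₁, h₁, b₁⟩ := key 1
  rw [deriv_Airy_eq hη, Airy_eq_fun hη]
  refine ⟨C₀ + C₁, by positivity, fun x => ⟨(b₀ x).trans ?_, (b₁ x).trans ?_⟩⟩ <;>
  · gcongr
    linarith

lemma exists_exp_mul_abs_Airy_le (y₁ : ℝ) {ω₁ : ℝ} (hω₁ : 0 < ω₁) :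
    ∃ K, ∀ y ω l, y₁ ≤ y → ω₁ ≤ ω → 0 ≤ l →
      Real.exp (-ω * l) * ((1 + l) * |Airy (y - l)|) ≤ K * Real.exp (-(ω₁ / 2) * l) ∧
      Real.exp (-ω * l) * ((1 + l) * |deriv Airy (y - l)|) ≤ K * Real.exp (-(ω₁ / 2) * l) := by
  set η := ω₁ / 4 with hη_def
  have hη : 0 < η := by positivity
  obtain ⟨C, hC, hb⟩ := exists_abs_Airy_le hη
  have key : ∀ y ω l a, y₁ ≤ y → ω₁ ≤ ω → 0 ≤ l → |a| ≤ C * Real.exp (-η * (y - l)) →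
      Real.exp (-ω * l) * ((1 + l) * |a|)
        ≤ (1 + 1 / η) * C * Real.exp (-η * y₁) * Real.exp (-(ω₁ / 2) * l) := by
    intro y ω l a hy hω hl ha
    have h1 : 1 + l ≤ (1 + 1 / η) * Real.exp (η * l) := by
      have h2 : 1 ≤ Real.exp (η * l) := Real.one_le_exp (by positivity)
      have h3 : η * l ≤ Real.exp (η * l) := by linarith [Real.add_one_le_exp (η * l)]
      have h4 : l ≤ 1 / η * Real.exp (η * l) := by
        rw [one_div_mul_eq_div, le_div_iff₀' hη]
        exact h3
      linarith
    calc _ ≤ Real.exp (-ω * l) * (((1 + 1 / η) * Real.exp (η * l))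
            * (C * Real.exp (-η * (y - l)))) := by gcongr
      _ = (1 + 1 / η) * C * Real.exp (-ω * l + η * l + -η * (y - l)) := by
          rw [Real.exp_add, Real.exp_add]
          ring
      _ ≤ (1 + 1 / η) * C * Real.exp (-η * y₁ + -(ω₁ / 2) * l) := by
          refine mul_le_mul_of_nonneg_left (Real.exp_le_exp.2 ?_) (by positivity)
          have := mul_le_mul_of_nonneg_right hω hl
          have := mul_le_mul_of_nonneg_left hy hη.le
          rw [hη_def] at *
          linarith
      _ = _ := by
          rw [Real.exp_add]
          ring
  exact ⟨_, fun y ω l hy hω hl =>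
    ⟨key y ω l _ hy hω hl (hb _).1, key y ω l _ hy hω hl (hb _).2⟩⟩

lemma continuous_Airy : Continuous Airy := (contDiff_Airy 0).1.continuous

lemma continuous_deriv_Airy : Continuous (deriv Airy) := (contDiff_Airy 0).2.continuous

/-- Integrability of `e^{-ωλ} Ai(y-λ)`, `e^{-ωλ} Ai'(y-λ)` and `λ e^{-ωλ} Ai(y-λ)`
over `(0, ∞)`. -/
lemma integrableOn_exp_mul_Airy (y : ℝ) {ω : ℝ} (hω : 0 < ω) :
    IntegrableOn (fun l => Real.exp (-ω * l) * Airy (y - l)) (Ioi 0) ∧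
    IntegrableOn (fun l => Real.exp (-ω * l) * deriv Airy (y - l)) (Ioi 0) ∧
    IntegrableOn (fun l => l * (Real.exp (-ω * l) * Airy (y - l))) (Ioi 0) := by
  obtain ⟨K, hK⟩ := exists_exp_mul_abs_Airy_le y hω
  have hi := (exp_neg_integrableOn_Ioi 0 (half_pos hω)).const_mul K
  have hc := continuous_Airy
  have hc' := continuous_deriv_Airy
  refine ⟨hi.mono' (by fun_prop) ?_, hi.mono' (by fun_prop) ?_, hi.mono' (by fun_prop) ?_⟩ <;>
    refine (ae_restrict_mem measurableSet_Ioi).mono fun l (hl : 0 < l) => ?_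
  · refine le_trans ?_ (hK y ω l le_rfl le_rfl hl.le).1
    rw [norm_mul, Real.norm_eq_abs, Real.norm_eq_abs, Real.abs_exp]
    gcongr
    exact le_mul_of_one_le_left (abs_nonneg _) (by linarith)
  · refine le_trans ?_ (hK y ω l le_rfl le_rfl hl.le).2
    rw [norm_mul, Real.norm_eq_abs, Real.norm_eq_abs, Real.abs_exp]
    gcongr
    exact le_mul_of_one_le_left (abs_nonneg _) (by linarith)
  · refine le_trans ?_ (hK y ω l le_rfl le_rfl hl.le).1
    rw [norm_mul, norm_mul, Real.norm_eq_abs, Real.norm_eq_abs, Real.norm_eq_abs, Real.abs_exp,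
      abs_of_pos hl, mul_left_comm]
    gcongr
    linarith

lemma hasDerivAt_exp_mul_comp_sub {f : ℝ → ℝ} {f' : ℝ} (y ω l : ℝ)
    (hf : HasDerivAt f f' (y - l)) :
    HasDerivAt (fun l => Real.exp (-ω * l) * f (y - l))
      (-ω * (Real.exp (-ω * l) * f (y - l)) - Real.exp (-ω * l) * f') l := by
  have h1 : HasDerivAt (fun l => Real.exp (-ω * l)) (Real.exp (-ω * l) * -ω) l := by
    simpa using ((hasDerivAt_id l).const_mul (-ω)).exp
  have h2 : HasDerivAt (fun l => f (y - l)) (-f') l :=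
    hf.comp_const_sub y l
  exact (h1.mul h2).congr_deriv (by ring)

lemma integral_exp_mul_deriv_Airy (y : ℝ) {ω : ℝ} (hω : 0 < ω) :
    ∫ l in Ioi (0 : ℝ), Real.exp (-ω * l) * deriv Airy (y - l) = Airy y - ω * Bpos y ω := by
  obtain ⟨i0, i1, -⟩ := integrableOn_exp_mul_Airy y hω
  have hd := fun l => hasDerivAt_exp_mul_comp_sub y ω l (hasDerivAt_Airy (y - l))
  have i2 := (i0.const_mul (-ω)).sub i1
  have h := integral_Ioi_of_hasDerivAt_of_tendsto' (a := 0) (fun l _ => hd l) i2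
    (tendsto_zero_of_hasDerivAt_of_integrableOn_Ioi (a := 0) (fun l _ => hd l) i2 i0)
  rw [integral_sub (i0.const_mul _) i1, integral_const_mul] at h
  simp only [mul_zero, Real.exp_zero, sub_zero, one_mul] at h
  rw [Bpos]
  linarith

lemma integral_mul_exp_mul_Airy (y : ℝ) {ω : ℝ} (hω : 0 < ω) :
    ∫ l in Ioi (0 : ℝ), l * (Real.exp (-ω * l) * Airy (y - l))
      = -(deriv Airy y - ω * Airy y + (ω ^ 2 - y) * Bpos y ω) := by
  obtain ⟨i0, i1, i2⟩ := integrableOn_exp_mul_Airy y hω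
  have hd : ∀ l, HasDerivAt (fun l => Real.exp (-ω * l) * deriv Airy (y - l)
      - ω * (Real.exp (-ω * l) * Airy (y - l)))
      ((ω ^ 2 - y) * (Real.exp (-ω * l) * Airy (y - l))
        + l * (Real.exp (-ω * l) * Airy (y - l))) l := fun l =>
    ((hasDerivAt_exp_mul_comp_sub y ω l (hasDerivAt_deriv_Airy (y - l))).sub
      ((hasDerivAt_exp_mul_comp_sub y ω l (hasDerivAt_Airy (y - l))).const_mul ω)).congr_deriv
        (by ring)
  have i3 := (i0.const_mul (ω ^ 2 - y)).add i2
  have h := integral_Ioi_of_hasDerivAt_of_tendsto' (a := 0) (fun l _ => hd l) i3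
    (tendsto_zero_of_hasDerivAt_of_integrableOn_Ioi (a := 0) (fun l _ => hd l) i3
      (i1.sub (i0.const_mul ω)))
  rw [integral_add (i0.const_mul _) i2, integral_const_mul] at h
  simp only [mul_zero, Real.exp_zero, sub_zero, one_mul] at h
  rw [Bpos]
  linarith

/-- The total derivative of `Bpos` at `(y, ω)`. -/
def BposFDeriv (p : ℝ × ℝ) : ℝ × ℝ →L[ℝ] ℝ :=
  (Airy p.1 - p.2 * Bpos p.1 p.2) • ContinuousLinearMap.fst ℝ ℝ ℝ
    + (deriv Airy p.1 - p.2 * Airy p.1 + (p.2 ^ 2 - p.1) * Bpos p.1 p.2)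
      • ContinuousLinearMap.snd ℝ ℝ ℝ

lemma hasFDerivAt_Bpos {p : ℝ × ℝ} (hp : 0 < p.2) :
    HasFDerivAt (fun q : ℝ × ℝ => Bpos q.1 q.2) (BposFDeriv p) p := by
  have hc := continuous_Airy
  have hc' := continuous_deriv_Airy
  obtain ⟨K, hK⟩ := exists_exp_mul_abs_Airy_le (p.1 - 1) (half_pos hp)
  obtain ⟨i0, i1, i2⟩ := integrableOn_exp_mul_Airy p.1 hp
  have h := hasFDerivAt_integral_of_dominated_of_fderiv_le (𝕜 := ℝ)
    (μ := volume.restrict (Ioi (0 : ℝ))) (x₀ := p)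
    (F := fun (q : ℝ × ℝ) l => Real.exp (-q.2 * l) * Airy (q.1 - l))
    (F' := fun (q : ℝ × ℝ) l =>
      (Real.exp (-q.2 * l) * deriv Airy (q.1 - l)) • ContinuousLinearMap.fst ℝ ℝ ℝ
        - (l * (Real.exp (-q.2 * l) * Airy (q.1 - l))) • ContinuousLinearMap.snd ℝ ℝ ℝ)
    (bound := fun l => 2 * (K * Real.exp (-(p.2 / 2 / 2) * l)))
    (prod_mem_nhds (Ici_mem_nhds (sub_one_lt p.1)) (Ici_mem_nhds (half_lt_self hp)))
    (Eventually.of_forall fun q => by fun_prop) i0 (by fun_prop)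
    ((ae_restrict_mem measurableSet_Ioi).mono fun l (hl : 0 < l) q hq => ?_)
    (((exp_neg_integrableOn_Ioi 0 (half_pos (half_pos hp))).const_mul K).const_mul 2)
    (ae_of_all _ fun l q _ => ?_)
  · refine h.congr_fderiv ?_
    rw [integral_sub (i1.smul_const _) (i2.smul_const _), integral_smul_const,
      integral_smul_const, integral_exp_mul_deriv_Airy _ hp, integral_mul_exp_mul_Airy _ hp,
      neg_smul, sub_neg_eq_add, BposFDeriv]
  · obtain ⟨b0, b1⟩ := hK q.1 q.2 l hq.1 hq.2 hl.le
    have n1 : ‖(Real.exp (-q.2 * l) * deriv Airy (q.1 - l)) • ContinuousLinearMap.fst ℝ ℝ ℝ‖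
        ≤ K * Real.exp (-(p.2 / 2 / 2) * l) := by
      rw [norm_smul]
      refine ((mul_le_of_le_one_right (norm_nonneg _)
        (ContinuousLinearMap.norm_fst_le ..)).trans (le_trans ?_ b1))
      rw [norm_mul, Real.norm_eq_abs, Real.norm_eq_abs, Real.abs_exp]
      gcongr
      exact le_mul_of_one_le_left (abs_nonneg _) (by linarith)
    have n2 : ‖(l * (Real.exp (-q.2 * l) * Airy (q.1 - l))) • ContinuousLinearMap.snd ℝ ℝ ℝ‖
        ≤ K * Real.exp (-(p.2 / 2 / 2) * l) := by
      rw [norm_smul]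
      refine ((mul_le_of_le_one_right (norm_nonneg _)
        (ContinuousLinearMap.norm_snd_le ..)).trans (le_trans ?_ b0))
      rw [norm_mul, norm_mul, Real.norm_eq_abs, Real.norm_eq_abs, Real.norm_eq_abs,
        Real.abs_exp, abs_of_pos hl, mul_left_comm]
      gcongr
      linarith
    refine (norm_sub_le _ _).trans ?_
    linarith
  · have h1 : HasFDerivAt (fun q : ℝ × ℝ => Real.exp (-q.2 * l))
        (Real.exp (-q.2 * l) • (l • -ContinuousLinearMap.snd ℝ ℝ ℝ)) q :=
      ((hasFDerivAt_snd (p := q)).neg.mul_const l).exp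
    have h2 : HasFDerivAt (fun q : ℝ × ℝ => Airy (q.1 - l))
        (deriv Airy (q.1 - l) • ContinuousLinearMap.fst ℝ ℝ ℝ) q :=
      HasDerivAt.comp_hasFDerivAt (f := fun q : ℝ × ℝ => q.1 - l) q (hasDerivAt_Airy (q.1 - l))
        ((hasFDerivAt_fst (p := q)).sub_const l)
    refine (h1.mul h2).congr_fderiv ?_
    ext <;> simp
    ring

lemma contDiffOn_Bpos (n : ℕ) :
    ContDiffOn ℝ n (fun q : ℝ × ℝ => Bpos q.1 q.2) (univ ×ˢ Ioi 0) := by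
  have hd : ∀ q ∈ (univ ×ˢ Ioi 0 : Set (ℝ × ℝ)),
      HasFDerivAt (fun q : ℝ × ℝ => Bpos q.1 q.2) (BposFDeriv q) q :=
    fun q hq => hasFDerivAt_Bpos hq.2
  induction n with
  | zero =>
    exact contDiffOn_zero.2 fun q hq => (hd q hq).continuousAt.continuousWithinAt
  | succ n ih =>
    push_cast
    refine (contDiffOn_succ_iff_fderiv_of_isOpen (isOpen_univ.prod isOpen_Ioi)).2
      ⟨fun q hq => (hd q hq).differentiableAt.differentiableWithinAt, by simp, ?_⟩
    refine ContDiffOn.congr (f := BposFDeriv) ?_ fun q hq => (hd q hq).fderiv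
    have h1 : ContDiff ℝ n fun q : ℝ × ℝ => Airy q.1 := (contDiff_Airy n).1.comp contDiff_fst
    have h2 : ContDiff ℝ n fun q : ℝ × ℝ => deriv Airy q.1 :=
      (contDiff_Airy n).2.comp contDiff_fst
    unfold BposFDeriv
    exact ((h1.contDiffOn.sub (contDiff_snd.contDiffOn.mul ih)).smul contDiffOn_const).add
      (((h2.sub (contDiff_snd.mul h1)).contDiffOn.add
        (((contDiff_snd.pow 2).sub contDiff_fst).contDiffOn.mul ih)).smul contDiffOn_const)

/-- For `ω > 0`, the function `B(y,ω) = ∫_0^∞ e^{-ωλ} Ai(y-λ) dλ`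
is smooth in `(y,ω)` and satisfies `∂_y B = Ai(y) - ωB` and
`∂_ω B = Ai'(y) - ωAi(y) + (ω² - y)B`. -/
theorem Bpos_smooth_and_derivs :
    ContDiffOn ℝ (⊤ : ℕ∞) (fun pr : ℝ × ℝ => Bpos pr.1 pr.2) (Set.univ ×ˢ Set.Ioi (0:ℝ)) ∧
    (∀ y ω : ℝ, 0 < ω →
      HasDerivAt (fun y' => Bpos y' ω) (Airy y - ω * Bpos y ω) y) ∧
    (∀ y ω : ℝ, 0 < ω →
      HasDerivAt (fun ω' => Bpos y ω')
        (deriv Airy y - ω * Airy y + (ω ^ 2 - y) * Bpos y ω) ω) := by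
  refine ⟨contDiffOn_infty.2 contDiffOn_Bpos, fun y ω hω => ?_, fun y ω hω => ?_⟩
  · refine ((hasFDerivAt_Bpos (p := (y, ω)) hω).comp_hasDerivAt y
      ((hasDerivAt_id y).prodMk (hasDerivAt_const y ω))).congr_deriv ?_
    simp [BposFDeriv]
  · refine ((hasFDerivAt_Bpos (p := (y, ω)) hω).comp_hasDerivAt ω
      ((hasDerivAt_const ω y).prodMk (hasDerivAt_id ω))).congr_deriv ?_
    simp [BposFDeriv]

end
end
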